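/- There exists a real-analytic function U : [-1,1] → ℝ (a shear flow) such that the following holds. For every s ∈ ℕ, every α ∈ (0,1], and every k ∈ ℕ, there exist a point (x₀,z₀) ∈ 𝕋 × (-1,1), a constant C > 0, an ε₀ > 0, and for every ε ∈ (0,ε₀] a time t_ε ∈ (0, C·ε·|log ε|] together with a smooth solution ω_ε of the vorticity formulation of the hydrostatic Euler equations on [0,t_ε] × 𝕋 × [-1,1], such that ‖ω_ε − U′‖_{L²([0,t_ε] × Ω_ε)} / (‖ω_ε(0,·,·) − U′‖_{H^s(𝕋×(−1,1))})^α → +∞ as ε → 0, where Ω_ε = B(x₀, ε^k) × B(z₀, ε^k). -/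

import Mathlib

open MeasureTheory Set Filter

/-- Mixed partial derivative `∂_x^i ∂_z^j g` for `g : ℝ → ℝ → ℝ`, `g = g x z`. -/
noncomputable def pd2 (i j : ℕ) (g : ℝ → ℝ → ℝ) : ℝ → ℝ → ℝ :=
  fun x z => iteratedDeriv i (fun x' => iteratedDeriv j (g x') z) x

/-- Square of the `L²` norm over `𝕋 × (-1,1)`, the torus being represented by `[0,1)`. -/
noncomputable def L2sqTZ (g : ℝ → ℝ → ℝ) : ℝ :=
  ∫ p in (Set.Ico (0:ℝ) 1) ×ˢ (Set.Ioo (-1:ℝ) 1), (g p.1 p.2) ^ 2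

/-- The Sobolev `H^s` norm of `g : 𝕋 × (-1,1) → ℝ`:
`(Σ_{|β| ≤ s} ‖∂^β g‖²_{L²})^{1/2}`, the sum running over multi-indices `β = (i,j)` with
`i + j ≤ s`. -/
noncomputable def HsNormTZ (s : ℕ) (g : ℝ → ℝ → ℝ) : ℝ :=
  Real.sqrt (∑ i ∈ Finset.range (s+1), ∑ j ∈ Finset.range (s+1-i), L2sqTZ (pd2 i j g))

/-- `ω : [0,T] × 𝕋 × [-1,1] → ℝ` is a smooth solution of the vorticity formulation of the
hydrostatic Euler equations: functions on the torus `𝕋 = ℝ/ℤ` are represented by `1`-periodic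
functions on `ℝ`, and there is a smooth stream function `φ` with `∂_z² φ = ω`,
`φ(t,x,±1) = 0`, such that, with `u := ∂_z φ` and `v := -∂_x φ`,
`∂_t ω + u ∂_x ω + v ∂_z ω = 0`. -/
def IsHydroSol (T : ℝ) (ω : ℝ → ℝ → ℝ → ℝ) : Prop :=
  ContDiff ℝ (⊤ : ℕ∞) (fun p : ℝ × ℝ × ℝ => ω p.1 p.2.1 p.2.2) ∧
  (∀ t x z, ω t (x + 1) z = ω t x z) ∧
  ∃ φ : ℝ → ℝ → ℝ → ℝ,
    ContDiff ℝ (⊤ : ℕ∞) (fun p : ℝ × ℝ × ℝ => φ p.1 p.2.1 p.2.2) ∧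
    (∀ t x z, φ t (x + 1) z = φ t x z) ∧
    (∀ t ∈ Set.Icc (0:ℝ) T, ∀ x : ℝ, φ t x (-1) = 0 ∧ φ t x 1 = 0) ∧
    (∀ t ∈ Set.Icc (0:ℝ) T, ∀ x : ℝ, ∀ z ∈ Set.Icc (-1:ℝ) 1,
      iteratedDeriv 2 (fun z' => φ t x z') z = ω t x z) ∧
    (∀ t ∈ Set.Icc (0:ℝ) T, ∀ x : ℝ, ∀ z ∈ Set.Icc (-1:ℝ) 1,
      deriv (fun t' => ω t' x z) t
        + deriv (fun z' => φ t x z') z * deriv (fun x' => ω t x' z) x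
        + (- deriv (fun x' => φ t x' z) x) * deriv (fun z' => ω t x z') z = 0)

/-- Joint smoothness of a curried function of three real variables. -/
def Smooth3 (F : ℝ → ℝ → ℝ → ℝ) : Prop :=
  ContDiff ℝ (⊤ : ℕ∞) (fun p : ℝ × ℝ × ℝ => F p.1 p.2.1 p.2.2)

/-- Partial derivative in the first variable. -/
noncomputable def d1 (F : ℝ → ℝ → ℝ → ℝ) : ℝ → ℝ → ℝ → ℝ :=
  fun t x z => deriv (fun s => F s x z) t

/-- Partial derivative in the second variable. -/
noncomputable def d2 (F : ℝ → ℝ → ℝ → ℝ) : ℝ → ℝ → ℝ → ℝ :=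
  fun t x z => deriv (fun s => F t s z) x

/-- Partial derivative in the third variable. -/
noncomputable def d3 (F : ℝ → ℝ → ℝ → ℝ) : ℝ → ℝ → ℝ → ℝ :=
  fun t x z => deriv (fun s => F t x s) z

namespace Smooth3

variable {F G : ℝ → ℝ → ℝ → ℝ}

theorem hasFDerivAt (hF : Smooth3 F) (p : ℝ × ℝ × ℝ) :
    HasFDerivAt (fun p : ℝ × ℝ × ℝ => F p.1 p.2.1 p.2.2)
      (fderiv ℝ (fun p : ℝ × ℝ × ℝ => F p.1 p.2.1 p.2.2) p) p :=
  ((ContDiff.differentiable hF (by simp)) p).hasFDerivAt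

theorem comp_hasDerivAt (hF : Smooth3 F) {a b c : ℝ → ℝ} {a' b' c' s : ℝ}
    (ha : HasDerivAt a a' s) (hb : HasDerivAt b b' s) (hc : HasDerivAt c c' s) :
    HasDerivAt (fun s => F (a s) (b s) (c s))
      (fderiv ℝ (fun p : ℝ × ℝ × ℝ => F p.1 p.2.1 p.2.2) (a s, b s, c s) (a', b', c')) s :=
  HasFDerivAt.comp_hasDerivAt (l := fun p : ℝ × ℝ × ℝ => F p.1 p.2.1 p.2.2) s
    (hF.hasFDerivAt (a s, b s, c s)) (ha.prodMk (hb.prodMk hc))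

theorem d1_eq (hF : Smooth3 F) (t x z : ℝ) :
    d1 F t x z = fderiv ℝ (fun p : ℝ × ℝ × ℝ => F p.1 p.2.1 p.2.2) (t, x, z) (1, 0, 0) :=
  (hF.comp_hasDerivAt (hasDerivAt_id t) (hasDerivAt_const t x) (hasDerivAt_const t z)).deriv

theorem d2_eq (hF : Smooth3 F) (t x z : ℝ) :
    d2 F t x z = fderiv ℝ (fun p : ℝ × ℝ × ℝ => F p.1 p.2.1 p.2.2) (t, x, z) (0, 1, 0) :=
  (hF.comp_hasDerivAt (hasDerivAt_const x t) (hasDerivAt_id x) (hasDerivAt_const x z)).deriv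

theorem d3_eq (hF : Smooth3 F) (t x z : ℝ) :
    d3 F t x z = fderiv ℝ (fun p : ℝ × ℝ × ℝ => F p.1 p.2.1 p.2.2) (t, x, z) (0, 0, 1) :=
  (hF.comp_hasDerivAt (hasDerivAt_const z t) (hasDerivAt_const z x) (hasDerivAt_id z)).deriv

theorem chain (hF : Smooth3 F) {a b c : ℝ → ℝ} {a' b' c' s : ℝ}
    (ha : HasDerivAt a a' s) (hb : HasDerivAt b b' s) (hc : HasDerivAt c c' s) :
    HasDerivAt (fun s => F (a s) (b s) (c s))
      (d1 F (a s) (b s) (c s) * a' + d2 F (a s) (b s) (c s) * b'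
        + d3 F (a s) (b s) (c s) * c') s := by
  convert hF.comp_hasDerivAt ha hb hc using 1
  rw [hF.d1_eq, hF.d2_eq, hF.d3_eq]
  have h : ((a', b', c') : ℝ × ℝ × ℝ)
      = a' • ((1, 0, 0) : ℝ × ℝ × ℝ) + b' • ((0, 1, 0) : ℝ × ℝ × ℝ)
        + c' • ((0, 0, 1) : ℝ × ℝ × ℝ) := by simp
  rw [h, map_add, map_add, map_smul, map_smul, map_smul]
  simp only [smul_eq_mul]; ring

theorem hasDerivAt1 (hF : Smooth3 F) (t x z : ℝ) :
    HasDerivAt (fun s => F s x z) (d1 F t x z) t := by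
  simpa using hF.chain (hasDerivAt_id t) (hasDerivAt_const t x) (hasDerivAt_const t z)

theorem hasDerivAt2 (hF : Smooth3 F) (t x z : ℝ) :
    HasDerivAt (fun s => F t s z) (d2 F t x z) x := by
  simpa using hF.chain (hasDerivAt_const x t) (hasDerivAt_id x) (hasDerivAt_const x z)

theorem hasDerivAt3 (hF : Smooth3 F) (t x z : ℝ) :
    HasDerivAt (fun s => F t x s) (d3 F t x z) z := by
  simpa using hF.chain (hasDerivAt_const z t) (hasDerivAt_const z x) (hasDerivAt_id z)

theorem smooth_fderiv_apply (hF : Smooth3 F) (v : ℝ × ℝ × ℝ) :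
    ContDiff ℝ (⊤ : ℕ∞)
      (fun p => fderiv ℝ (fun p : ℝ × ℝ × ℝ => F p.1 p.2.1 p.2.2) p v) :=
  (ContDiff.fderiv_right (m := (⊤ : ℕ∞)) hF (by simp)).clm_apply contDiff_const

theorem d2 (hF : Smooth3 F) : Smooth3 (d2 F) := by
  have h := hF.smooth_fderiv_apply (0, 1, 0)
  simpa only [Smooth3, hF.d2_eq] using h

theorem d3 (hF : Smooth3 F) : Smooth3 (d3 F) := by
  have h := hF.smooth_fderiv_apply (0, 0, 1)
  simpa only [Smooth3, hF.d3_eq] using h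

theorem comp3 (hF : Smooth3 F) (hG : Smooth3 G) : Smooth3 (fun t x z => F t x (G t x z)) := by
  have : ContDiff ℝ (⊤ : ℕ∞) (fun p : ℝ × ℝ × ℝ => (p.1, p.2.1, G p.1 p.2.1 p.2.2)) :=
    contDiff_fst.prodMk (contDiff_snd.fst.prodMk hG)
  exact ContDiff.comp hF this

theorem comp1 {f : ℝ → ℝ} (hf : ContDiff ℝ (⊤ : ℕ∞) f) (hG : Smooth3 G) :
    Smooth3 (fun t x z => f (G t x z)) :=
  hf.comp hG

theorem add (hF : Smooth3 F) (hG : Smooth3 G) : Smooth3 (fun t x z => F t x z + G t x z) :=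
  ContDiff.add hF hG

theorem sub (hF : Smooth3 F) (hG : Smooth3 G) : Smooth3 (fun t x z => F t x z - G t x z) :=
  ContDiff.sub hF hG

theorem mul (hF : Smooth3 F) (hG : Smooth3 G) : Smooth3 (fun t x z => F t x z * G t x z) :=
  ContDiff.mul hF hG

theorem inv (hF : Smooth3 F) (h : ∀ t x z, F t x z ≠ 0) : Smooth3 (fun t x z => (F t x z)⁻¹) :=
  ContDiff.inv hF fun _ => h _ _ _

theorem thd : Smooth3 (fun _ _ z => z) := contDiff_snd.snd

end Smooth3

/-- The fibrewise inverse of a smooth function that is uniformly increasing in the last variable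
is smooth. -/
theorem exists_smooth_fibre_inverse {Z : ℝ → ℝ → ℝ → ℝ} (hZ : Smooth3 Z)
    (hpos : ∀ t x θ, 1 / 2 ≤ d3 Z t x θ) :
    ∃ Θ : ℝ → ℝ → ℝ → ℝ, Smooth3 Θ ∧ (∀ t x z, Z t x (Θ t x z) = z) ∧
      ∀ t x θ, Θ t x (Z t x θ) = θ := by
  have hmono : ∀ t x, StrictMono (Z t x) := fun t x =>
    strictMono_of_deriv_pos fun θ => lt_of_lt_of_le (by norm_num) (hpos t x θ)
  have hcont : ∀ t x, Continuous (Z t x) := fun t x =>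
    continuous_iff_continuousAt.2 fun θ => (hZ.hasDerivAt3 t x θ).continuousAt
  have hgrow : ∀ t x a b, a ≤ b → (b - a) / 2 ≤ Z t x b - Z t x a := by
    intro t x a b hab
    have := mul_sub_le_image_sub_of_le_deriv (f := Z t x)
      (fun θ => (hZ.hasDerivAt3 t x θ).differentiableAt) (C := 1 / 2) (hpos t x) hab
    linarith
  have hsurj : ∀ t x, Function.Surjective (Z t x) := by
    intro t x
    refine (hcont t x).surjective ?_ ?_
    · refine tendsto_atTop.2 fun b => ?_
      filter_upwards [eventually_ge_atTop (0 : ℝ), eventually_ge_atTop (2 * (b - Z t x 0))]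
        with θ h0 h1
      have := hgrow t x 0 θ h0
      linarith
    · refine tendsto_atBot.2 fun b => ?_
      filter_upwards [eventually_le_atBot (0 : ℝ), eventually_le_atBot (-(2 * (Z t x 0 - b)))]
        with θ h0 h1
      have := hgrow t x θ 0 h0
      linarith
  let Ψ : ℝ × ℝ × ℝ → ℝ × ℝ × ℝ := fun p => (p.1, p.2.1, Z p.1 p.2.1 p.2.2)
  have hΨs : ContDiff ℝ (⊤ : ℕ∞) Ψ := contDiff_fst.prodMk (contDiff_snd.fst.prodMk hZ)
  have hbij : Function.Bijective Ψ := by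
    constructor
    · rintro ⟨t, x, θ⟩ ⟨t', x', θ'⟩ h
      simp only [Ψ, Prod.mk.injEq] at h
      obtain ⟨rfl, rfl, h⟩ := h
      rw [(hmono t x).injective h]
    · rintro ⟨t, x, z⟩
      obtain ⟨θ, hθ⟩ := hsurj t x z
      exact ⟨(t, x, θ), by simp [Ψ, hθ]⟩
  let L : ℝ × ℝ × ℝ → (ℝ × ℝ × ℝ →L[ℝ] ℝ) :=
    fderiv ℝ (fun p : ℝ × ℝ × ℝ => Z p.1 p.2.1 p.2.2)
  have hL3 : ∀ p, L p (0, 0, 1) ≠ 0 := by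
    rintro ⟨t, x, θ⟩
    have h := hpos t x θ
    rw [hZ.d3_eq] at h
    exact ne_of_gt (lt_of_lt_of_le (by norm_num) h)
  have hLsplit : ∀ p (a b c : ℝ), L p (a, b, c) = L p (a, b, 0) + c * L p (0, 0, 1) := by
    intro p a b c
    have : ((a, b, c) : ℝ × ℝ × ℝ) = (a, b, 0) + c • ((0, 0, 1) : ℝ × ℝ × ℝ) := by simp
    rw [this, map_add, map_smul, smul_eq_mul]
  let pr1 : ℝ × ℝ × ℝ →L[ℝ] ℝ := ContinuousLinearMap.fst ℝ ℝ (ℝ × ℝ)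
  let pr2 : ℝ × ℝ × ℝ →L[ℝ] ℝ :=
    (ContinuousLinearMap.fst ℝ ℝ ℝ).comp (ContinuousLinearMap.snd ℝ ℝ (ℝ × ℝ))
  let pr3 : ℝ × ℝ × ℝ →L[ℝ] ℝ :=
    (ContinuousLinearMap.snd ℝ ℝ ℝ).comp (ContinuousLinearMap.snd ℝ ℝ (ℝ × ℝ))
  let fwd : ℝ × ℝ × ℝ → (ℝ × ℝ × ℝ →L[ℝ] ℝ × ℝ × ℝ) := fun p => pr1.prod (pr2.prod (L p))
  let bwd : ℝ × ℝ × ℝ → (ℝ × ℝ × ℝ →L[ℝ] ℝ × ℝ × ℝ) := fun p =>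
    pr1.prod (pr2.prod ((L p (0, 0, 1))⁻¹ •
      (pr3 - (L p).comp (pr1.prod (pr2.prod (0 : ℝ × ℝ × ℝ →L[ℝ] ℝ))))))
  have hfwd : ∀ p a b c, fwd p (a, b, c) = (a, b, L p (a, b, c)) := fun p a b c => rfl
  have hbwd : ∀ p a b c, bwd p (a, b, c) = (a, b, (L p (0, 0, 1))⁻¹ * (c - L p (a, b, 0))) :=
    fun p a b c => rfl
  let e : ℝ × ℝ × ℝ → ((ℝ × ℝ × ℝ) ≃L[ℝ] ℝ × ℝ × ℝ) := fun p =>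
    ContinuousLinearEquiv.equivOfInverse (fwd p) (bwd p)
      (by
        rintro ⟨a, b, c⟩
        rw [hfwd, hbwd, hLsplit p a b c, add_sub_cancel_left, mul_comm c,
          inv_mul_cancel_left₀ (hL3 p)])
      (by
        rintro ⟨a, b, c⟩
        rw [hbwd, hfwd, hLsplit, mul_comm, mul_inv_cancel_left₀ (hL3 p),
          add_sub_cancel])
  have hder : ∀ p, HasFDerivAt Ψ (e p : ℝ × ℝ × ℝ →L[ℝ] ℝ × ℝ × ℝ) p := by
    intro p
    exact hasFDerivAt_fst.prodMk
      ((hasFDerivAt_snd.fst).prodMk (hZ.hasFDerivAt p))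
  have hopen : IsOpenMap Ψ := by
    refine isOpenMap_iff_nhds_le.2 fun p => ?_
    have hs : HasStrictFDerivAt Ψ (e p : ℝ × ℝ × ℝ →L[ℝ] ℝ × ℝ × ℝ) p := by
      have := hΨs.contDiffAt.hasStrictFDerivAt (x := p) (by simp)
      rwa [(hder p).fderiv] at this
    exact hs.map_nhds_eq_of_equiv.ge
  let H : ℝ × ℝ × ℝ ≃ₜ ℝ × ℝ × ℝ :=
    (Equiv.ofBijective Ψ hbij).toHomeomorphOfContinuousOpen hΨs.continuous hopen
  have hHs : ContDiff ℝ (⊤ : ℕ∞) H.symm := H.contDiff_symm hder hΨs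
  have hH : ∀ p, Ψ (H.symm p) = p := fun p => H.apply_symm_apply p
  have hform : ∀ t x z, H.symm (t, x, z) = (t, x, (H.symm (t, x, z)).2.2)
      ∧ Z t x (H.symm (t, x, z)).2.2 = z := by
    intro t x z
    have h := hH (t, x, z)
    set q := H.symm (t, x, z)
    obtain ⟨q1, q2, q3⟩ := q
    simp only [Ψ, Prod.mk.injEq] at h
    obtain ⟨rfl, rfl, h⟩ := h
    exact ⟨rfl, h⟩
  refine ⟨fun t x z => (H.symm (t, x, z)).2.2, ?_, fun t x z => (hform t x z).2, ?_⟩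
  · exact hHs.snd.snd
  · intro t x θ
    exact (hmono t x).injective (hform t x (Z t x θ)).2

/-- All `x, θ`-derivatives of `F` of order at most `n` are bounded by a multiple of `lam t` for
times `t ≤ t₁` and `θ ∈ [-1, 1]`. -/
def BoundedDerivs (t₁ : ℝ) (lam : ℝ → ℝ) : ℕ → (ℝ → ℝ → ℝ → ℝ) → Prop
  | 0, F => ∃ C, ∀ t ≤ t₁, ∀ x, ∀ θ ∈ Icc (-1 : ℝ) 1, |F t x θ| ≤ C * lam t
  | n + 1, F => (∃ C, ∀ t ≤ t₁, ∀ x, ∀ θ ∈ Icc (-1 : ℝ) 1, |F t x θ| ≤ C * lam t) ∧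
      BoundedDerivs t₁ lam n (d2 F) ∧ BoundedDerivs t₁ lam n (d3 F)

/-- The data produced by the semi-Lagrangian construction: the height `Z` of the vorticity level
sets, the flux `Q` below them and the velocity `u` on them, for an ancient solution that converges
exponentially to the shear flow `U` in the infinite past. -/
structure AncientFlow (U : ℝ → ℝ) (Z Q u : ℝ → ℝ → ℝ → ℝ) (t₁ β : ℝ) : Prop where
  smooth_shear : ContDiff ℝ (⊤ : ℕ∞) U
  shear_inj : ∀ a b, deriv U a = deriv U b → a = b ∨ a = -b
  rate_pos : 0 < β
  smoothZ : Smooth3 Z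
  smoothQ : Smooth3 Q
  periodicZ : ∀ t x θ, Z t (x + 2 * Real.pi) θ = Z t x θ
  periodicQ : ∀ t x θ, Q t (x + 2 * Real.pi) θ = Q t x θ
  half_le : ∀ t x θ, 1 / 2 ≤ d3 Z t x θ
  continuity : ∀ t ≤ t₁, ∀ x θ, d1 Z t x θ = -d2 Q t x θ
  flux : ∀ t ≤ t₁, ∀ x θ, d3 Q t x θ = u t x θ * d3 Z t x θ
  vorticity : ∀ t ≤ t₁, ∀ x θ, HasDerivAt (u t x) (deriv U θ * d3 Z t x θ) θ
  bottomZ : ∀ t ≤ t₁, ∀ x, Z t x (-1) = -1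
  topZ : ∀ t ≤ t₁, ∀ x, Z t x 1 = 1
  bottomQ : ∀ t ≤ t₁, ∀ x, Q t x (-1) = 0
  topQ : ∀ t ≤ t₁, ∀ x, Q t x 1 = 0
  decay : ∀ n, BoundedDerivs t₁ (fun t => Real.exp (β * t)) n (fun t x θ => Z t x θ - θ)
  nontrivial : ∃ t ≤ t₁, ∃ x, ∃ θ ∈ Ioo (-1 : ℝ) 1, Z t x θ ≠ θ

section FibreInverse

variable {Z Θ : ℝ → ℝ → ℝ → ℝ}

theorem fibre_inverse_derivs (hZ : Smooth3 Z) (hpos : ∀ t x θ, 1 / 2 ≤ d3 Z t x θ)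
    (hΘ : Smooth3 Θ) (hZΘ : ∀ t x z, Z t x (Θ t x z) = z) (t x z : ℝ) :
    d3 Θ t x z = (d3 Z t x (Θ t x z))⁻¹ ∧
    d2 Θ t x z = -d2 Z t x (Θ t x z) * (d3 Z t x (Θ t x z))⁻¹ ∧
    d1 Θ t x z = -d1 Z t x (Θ t x z) * (d3 Z t x (Θ t x z))⁻¹ := by
  have hne : d3 Z t x (Θ t x z) ≠ 0 := by
    have := hpos t x (Θ t x z)
    intro h; rw [h] at this; norm_num at this
  have h3 := hZ.chain (hasDerivAt_const z t) (hasDerivAt_const z x) (hΘ.hasDerivAt3 t x z)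
  have h2 := hZ.chain (hasDerivAt_const x t) (hasDerivAt_id x) (hΘ.hasDerivAt2 t x z)
  have h1 := hZ.chain (hasDerivAt_id t) (hasDerivAt_const t x) (hΘ.hasDerivAt1 t x z)
  simp only [id, hZΘ] at h1 h2 h3
  have e3 := h3.unique (hasDerivAt_id z)
  have e2 := h2.unique (hasDerivAt_const x z)
  have e1 := h1.unique (hasDerivAt_const t z)
  refine ⟨?_, ?_, ?_⟩ <;> field_simp <;> linarith

/-- `z`-derivative along the fibres, read in the coordinate `θ`. -/
noncomputable def lagZ (Z F : ℝ → ℝ → ℝ → ℝ) : ℝ → ℝ → ℝ → ℝ :=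
  fun t x θ => d3 F t x θ * (d3 Z t x θ)⁻¹

/-- `x`-derivative at fixed height, read in the coordinate `θ`. -/
noncomputable def lagX (Z F : ℝ → ℝ → ℝ → ℝ) : ℝ → ℝ → ℝ → ℝ :=
  fun t x θ => d2 F t x θ - d2 Z t x θ * (d3 F t x θ * (d3 Z t x θ)⁻¹)

theorem hasDerivAt_z_comp {F : ℝ → ℝ → ℝ → ℝ} (hF : Smooth3 F) (hZ : Smooth3 Z)
    (hpos : ∀ t x θ, 1 / 2 ≤ d3 Z t x θ)
    (hΘ : Smooth3 Θ) (hZΘ : ∀ t x z, Z t x (Θ t x z) = z) (t x z : ℝ) :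
    HasDerivAt (fun z' => F t x (Θ t x z')) (lagZ Z F t x (Θ t x z)) z := by
  have h := hF.chain (hasDerivAt_const z t) (hasDerivAt_const z x) (hΘ.hasDerivAt3 t x z)
  rw [(fibre_inverse_derivs hZ hpos hΘ hZΘ t x z).1] at h
  simpa [lagZ] using h

theorem hasDerivAt_x_comp {F : ℝ → ℝ → ℝ → ℝ} (hF : Smooth3 F) (hZ : Smooth3 Z)
    (hpos : ∀ t x θ, 1 / 2 ≤ d3 Z t x θ)
    (hΘ : Smooth3 Θ) (hZΘ : ∀ t x z, Z t x (Θ t x z) = z) (t x z : ℝ) :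
    HasDerivAt (fun x' => F t x' (Θ t x' z)) (lagX Z F t x (Θ t x z)) x := by
  have h := hF.chain (hasDerivAt_const x t) (hasDerivAt_id x) (hΘ.hasDerivAt2 t x z)
  rw [(fibre_inverse_derivs hZ hpos hΘ hZΘ t x z).2.1] at h
  refine h.congr_deriv ?_
  simp only [lagX, id]
  ring

theorem hasDerivAt_t_comp {F : ℝ → ℝ → ℝ → ℝ} (hF : Smooth3 F) (hZ : Smooth3 Z)
    (hpos : ∀ t x θ, 1 / 2 ≤ d3 Z t x θ)
    (hΘ : Smooth3 Θ) (hZΘ : ∀ t x z, Z t x (Θ t x z) = z) (t x z : ℝ) :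
    HasDerivAt (fun t' => F t' x (Θ t' x z)) (d1 F t x (Θ t x z)
      - d1 Z t x (Θ t x z) * (d3 F t x (Θ t x z) * (d3 Z t x (Θ t x z))⁻¹)) t := by
  have h := hF.chain (hasDerivAt_id t) (hasDerivAt_const t x) (hΘ.hasDerivAt1 t x z)
  rw [(fibre_inverse_derivs hZ hpos hΘ hZΘ t x z).2.2] at h
  refine h.congr_deriv ?_
  simp only [id]
  ring

theorem smooth3_lagZ {F : ℝ → ℝ → ℝ → ℝ} (hF : Smooth3 F) (hZ : Smooth3 Z)
    (hpos : ∀ t x θ, 1 / 2 ≤ d3 Z t x θ) : Smooth3 (lagZ Z F) :=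
  hF.d3.mul (hZ.d3.inv fun t x θ => by
    have := hpos t x θ
    intro h; rw [h] at this; norm_num at this)

theorem smooth3_lagX {F : ℝ → ℝ → ℝ → ℝ} (hF : Smooth3 F) (hZ : Smooth3 Z)
    (hpos : ∀ t x θ, 1 / 2 ≤ d3 Z t x θ) : Smooth3 (lagX Z F) :=
  hF.d2.sub (hZ.d2.mul (smooth3_lagZ hF hZ hpos))

end FibreInverse

/-- Rescaling an ancient flow gives solutions of the hydrostatic Euler equations. -/
theorem AncientFlow.isHydroSol {U : ℝ → ℝ} {Z Q u Θ : ℝ → ℝ → ℝ → ℝ} {t₁ β : ℝ}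
    (h : AncientFlow U Z Q u t₁ β) (hΘ : Smooth3 Θ) (hZΘ : ∀ t x z, Z t x (Θ t x z) = z)
    (hΘZ : ∀ t x θ, Θ t x (Z t x θ) = θ)
    {N : ℕ} {ν T τ x₁ S : ℝ} (hν : ν = N * (2 * Real.pi)) (hν0 : 0 < ν) (hS : ν * S ≤ T)
    (hτ : τ ≤ t₁) :
    IsHydroSol S (fun t x z => deriv U (Θ (ν * t - T + τ) (ν * x + x₁) z)) := by
  have hperΘ : ∀ t x z, Θ t (x + 2 * Real.pi) z = Θ t x z := by
    intro t x z
    have := hΘZ t (x + 2 * Real.pi) (Θ t x z)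
    rwa [h.periodicZ, hZΘ] at this
  have hper : ∀ {F : ℝ → ℝ → ℝ → ℝ}, (∀ t x z, F t (x + 2 * Real.pi) z = F t x z) →
      ∀ (n : ℕ) t x z, F t (x + n * (2 * Real.pi)) z = F t x z := by
    intro F hF n t x z
    induction n with
    | zero => simp
    | succ n ih =>
      rw [← ih, ← hF t (x + n * (2 * Real.pi))]
      congr 1; push_cast; ring
  have hU' : ContDiff ℝ (⊤ : ℕ∞) (deriv U) :=
    (contDiff_infty_iff_deriv.1 h.smooth_shear).2
  have hU3 : Smooth3 (fun _ _ θ => deriv U θ) := Smooth3.comp1 hU' Smooth3.thd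
  have hω : Smooth3 (fun t x z => deriv U (Θ t x z)) := Smooth3.comp1 hU' hΘ
  have hφ : Smooth3 (fun t x z => Q t x (Θ t x z)) := h.smoothQ.comp3 hΘ
  have hscale : ∀ {F : ℝ → ℝ → ℝ → ℝ}, Smooth3 F →
      Smooth3 (fun t x z => ν⁻¹ * ν * F (ν * t - T + τ) (ν * x + x₁) z) := by
    intro F hF
    have : ContDiff ℝ (⊤ : ℕ∞)
        (fun p : ℝ × ℝ × ℝ => (ν * p.1 - T + τ, ν * p.2.1 + x₁, p.2.2)) := by fun_prop
    exact contDiff_const.mul (ContDiff.comp hF this)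
  simp only [inv_mul_cancel₀ hν0.ne', one_mul] at hscale
  have htime : ∀ t ∈ Icc (0 : ℝ) S, ν * t - T + τ ≤ t₁ := by
    intro t ht
    nlinarith [ht.2]
  have hfix : ∀ t ≤ t₁, ∀ x, Θ t x (-1) = -1 ∧ Θ t x 1 = 1 := by
    intro t ht x
    have h1 := hΘZ t x (-1)
    have h2 := hΘZ t x 1
    rw [h.bottomZ t ht] at h1
    rw [h.topZ t ht] at h2
    exact ⟨h1, h2⟩
  have hne : ∀ t x θ, d3 Z t x θ ≠ 0 := by
    intro t x θ h0
    have := h.half_le t x θ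
    rw [h0] at this; norm_num at this
  have hφz : ∀ t ≤ t₁, ∀ x z,
      HasDerivAt (fun z' => Q t x (Θ t x z')) (u t x (Θ t x z)) z := by
    intro t ht x z
    have := hasDerivAt_z_comp h.smoothQ h.smoothZ h.half_le hΘ hZΘ t x z
    rwa [lagZ, h.flux t ht, mul_assoc, mul_inv_cancel₀ (hne _ _ _), mul_one] at this
  have hlin : ∀ (x b : ℝ), HasDerivAt (fun s => ν * s + b) ν x := by
    intro x b
    simpa using ((hasDerivAt_id x).const_mul ν).add_const b
  refine ⟨hscale hω, ?_, fun t x z => Q (ν * t - T + τ) (ν * x + x₁) (Θ (ν * t - T + τ)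
    (ν * x + x₁) z), hscale hφ, ?_, ?_, ?_, ?_⟩
  · intro t x z
    have e1 := hper hperΘ N (ν * t - T + τ) (ν * x + x₁) z
    have e3 : ν * (x + 1) + x₁ = ν * x + x₁ + N * (2 * Real.pi) := by rw [hν]; ring
    simp only [e3, e1]
  · intro t x z
    have e1 := hper hperΘ N (ν * t - T + τ) (ν * x + x₁) z
    have e2 := hper h.periodicQ N (ν * t - T + τ) (ν * x + x₁) (Θ (ν * t - T + τ) (ν * x + x₁) z)
    have e3 : ν * (x + 1) + x₁ = ν * x + x₁ + N * (2 * Real.pi) := by rw [hν]; ring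
    simp only [e3, e1, e2]
  · intro t ht x
    have hf := hfix _ (htime t ht) (ν * x + x₁)
    simp only [hf.1, hf.2]
    exact ⟨h.bottomQ _ (htime t ht) _, h.topQ _ (htime t ht) _⟩
  · intro t ht x z _
    have ht' := htime t ht
    rw [iteratedDeriv_succ, iteratedDeriv_one]
    rw [show deriv (fun z' => Q (ν * t - T + τ) (ν * x + x₁) (Θ (ν * t - T + τ) (ν * x + x₁) z'))
        = fun z' => u (ν * t - T + τ) (ν * x + x₁) (Θ (ν * t - T + τ) (ν * x + x₁) z') from
      funext fun z' => (hφz _ ht' _ z').deriv]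
    have h2 := (h.vorticity _ ht' (ν * x + x₁) (Θ (ν * t - T + τ) (ν * x + x₁) z)).comp z
      (hΘ.hasDerivAt3 (ν * t - T + τ) (ν * x + x₁) z)
    rw [(fibre_inverse_derivs h.smoothZ h.half_le hΘ hZΘ _ _ z).1, mul_assoc,
      mul_inv_cancel₀ (hne _ _ _), mul_one] at h2
    exact h2.deriv
  · intro t ht x z _
    have ht' := htime t ht
    have hcz := hasDerivAt_z_comp hU3 h.smoothZ h.half_le hΘ hZΘ (ν * t - T + τ) (ν * x + x₁) z
    have hcx := (hasDerivAt_x_comp hU3 h.smoothZ h.half_le hΘ hZΘ (ν * t - T + τ)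
      (ν * x + x₁) z).comp x (hlin x x₁)
    have hct := (hasDerivAt_t_comp hU3 h.smoothZ h.half_le hΘ hZΘ (ν * t - T + τ)
      (ν * x + x₁) z).comp t ((by simpa [sub_add] using hlin t (-(T - τ)) :
        HasDerivAt (fun s => ν * s - T + τ) ν t))
    have hpx := (hasDerivAt_x_comp h.smoothQ h.smoothZ h.half_le hΘ hZΘ (ν * t - T + τ)
      (ν * x + x₁) z).comp x (hlin x x₁)
    have e1 := hct.deriv
    have e2 := hcx.deriv
    have e3 := hpx.deriv
    simp only [Function.comp_def] at e1 e2 e3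
    rw [e1, e2, e3, hcz.deriv, (hφz _ ht' _ z).deriv]
    have c0 : ∀ a b c, d2 (fun _ _ θ => deriv U θ) a b c = 0 := fun a b c => by simp [d2]
    have c1 : ∀ a b c, d1 (fun _ _ θ => deriv U θ) a b c = 0 := fun a b c => by simp [d1]
    simp only [lagX, lagZ, c0, c1, h.flux _ ht', h.continuity _ ht']
    have := hne (ν * t - T + τ) (ν * x + x₁) (Θ (ν * t - T + τ) (ν * x + x₁) z)
    field_simp
    ring

section BoundedDerivs

variable {t₁ : ℝ} {lam mu : ℝ → ℝ} {F G Z : ℝ → ℝ → ℝ → ℝ} {n : ℕ}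

namespace BoundedDerivs

theorem zero (h : BoundedDerivs t₁ lam n F) :
    ∃ C, ∀ t ≤ t₁, ∀ x, ∀ θ ∈ Icc (-1 : ℝ) 1, |F t x θ| ≤ C * lam t := by
  cases n with
  | zero => exact h
  | succ n => exact h.1

theorem pred (h : BoundedDerivs t₁ lam (n + 1) F) : BoundedDerivs t₁ lam n F := by
  induction n generalizing F with
  | zero => exact h.1
  | succ n ih => exact ⟨h.1, ih h.2.1, ih h.2.2⟩

theorem add (hF : Smooth3 F) (hG : Smooth3 G) (h : BoundedDerivs t₁ lam n F)
    (h' : BoundedDerivs t₁ lam n G) :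
    BoundedDerivs t₁ lam n (fun t x θ => F t x θ + G t x θ) := by
  induction n generalizing F G with
  | zero =>
    obtain ⟨C, hC⟩ := h
    obtain ⟨D, hD⟩ := h'
    refine ⟨C + D, fun t ht x θ hθ => (abs_add_le _ _).trans ?_⟩
    linarith [hC t ht x θ hθ, hD t ht x θ hθ, add_mul C D (lam t)]
  | succ n ih =>
    obtain ⟨C, hC⟩ := h.1
    obtain ⟨D, hD⟩ := h'.1
    refine ⟨⟨C + D, fun t ht x θ hθ => (abs_add_le _ _).trans ?_⟩, ?_, ?_⟩
    · linarith [hC t ht x θ hθ, hD t ht x θ hθ, add_mul C D (lam t)]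
    · convert ih hF.d2 hG.d2 h.2.1 h'.2.1 using 1
      funext t x θ
      exact ((hF.hasDerivAt2 t x θ).add (hG.hasDerivAt2 t x θ)).deriv
    · convert ih hF.d3 hG.d3 h.2.2 h'.2.2 using 1
      funext t x θ
      exact ((hF.hasDerivAt3 t x θ).add (hG.hasDerivAt3 t x θ)).deriv

theorem mul (hF : Smooth3 F) (hG : Smooth3 G) (h : BoundedDerivs t₁ lam n F)
    (h' : BoundedDerivs t₁ mu n G) :
    BoundedDerivs t₁ (fun t => lam t * mu t) n (fun t x θ => F t x θ * G t x θ) := by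
  have key : ∀ {F G : ℝ → ℝ → ℝ → ℝ},
      (∃ C, ∀ t ≤ t₁, ∀ x, ∀ θ ∈ Icc (-1 : ℝ) 1, |F t x θ| ≤ C * lam t) →
      (∃ C, ∀ t ≤ t₁, ∀ x, ∀ θ ∈ Icc (-1 : ℝ) 1, |G t x θ| ≤ C * mu t) →
      ∃ C, ∀ t ≤ t₁, ∀ x, ∀ θ ∈ Icc (-1 : ℝ) 1,
        |F t x θ * G t x θ| ≤ C * (lam t * mu t) := by
    rintro F G ⟨C, hC⟩ ⟨D, hD⟩
    refine ⟨C * D, fun t ht x θ hθ => ?_⟩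
    rw [abs_mul]
    calc _ ≤ (C * lam t) * (D * mu t) := mul_le_mul (hC t ht x θ hθ) (hD t ht x θ hθ)
          (abs_nonneg _) ((abs_nonneg _).trans (hC t ht x θ hθ))
      _ = _ := by ring
  induction n generalizing F G with
  | zero => exact key h h'
  | succ n ih =>
    refine ⟨key h.1 h'.1, ?_, ?_⟩
    · convert add (hF.d2.mul hG) (hF.mul hG.d2) (ih hF.d2 hG h.2.1 h'.pred)
        (ih hF hG.d2 h.pred h'.2.1) using 1
      funext t x θ
      exact ((hF.hasDerivAt2 t x θ).mul (hG.hasDerivAt2 t x θ)).deriv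
    · convert add (hF.d3.mul hG) (hF.mul hG.d3) (ih hF.d3 hG h.2.2 h'.pred)
        (ih hF hG.d3 h.pred h'.2.2) using 1
      funext t x θ
      exact ((hF.hasDerivAt3 t x θ).mul (hG.hasDerivAt3 t x θ)).deriv

theorem const (c : ℝ) : BoundedDerivs t₁ (fun _ => 1) n (fun _ _ _ => c) := by
  induction n generalizing c with
  | zero => exact ⟨|c|, by simp⟩
  | succ n ih =>
    refine ⟨⟨|c|, by simp⟩, ?_, ?_⟩
    · convert ih 0 using 1
      funext t x θ
      simp [d2]
    · convert ih 0 using 1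
      funext t x θ
      simp [d3]

theorem weaken (hl : ∃ C, ∀ t ≤ t₁, lam t ≤ C * mu t) (hl0 : ∀ t, 0 ≤ lam t)
    (h : BoundedDerivs t₁ lam n F) : BoundedDerivs t₁ mu n F := by
  obtain ⟨D, hD⟩ := hl
  have key : ∀ {F : ℝ → ℝ → ℝ → ℝ},
      (∃ C, ∀ t ≤ t₁, ∀ x, ∀ θ ∈ Icc (-1 : ℝ) 1, |F t x θ| ≤ C * lam t) →
      ∃ C, ∀ t ≤ t₁, ∀ x, ∀ θ ∈ Icc (-1 : ℝ) 1, |F t x θ| ≤ C * mu t := by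
    rintro F ⟨C, hC⟩
    refine ⟨|C| * D, fun t ht x θ hθ => (hC t ht x θ hθ).trans ?_⟩
    calc C * lam t ≤ |C| * lam t := mul_le_mul_of_nonneg_right (le_abs_self C) (hl0 t)
      _ ≤ |C| * (D * mu t) := mul_le_mul_of_nonneg_left (hD t ht) (abs_nonneg C)
      _ = _ := by ring
  induction n generalizing F with
  | zero => exact key h
  | succ n ih => exact ⟨key h.1, ih h.2.1, ih h.2.2⟩

end BoundedDerivs

theorem smooth3_const (c : ℝ) : Smooth3 (fun _ _ _ => c) := contDiff_const

/-- Reciprocals of a function bounded below inherit derivative bounds. -/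
theorem boundedDerivs_inv (hF : Smooth3 F) (hpos : ∀ t x θ, 1 / 2 ≤ F t x θ)
    (h : BoundedDerivs t₁ (fun _ => 1) n F) :
    BoundedDerivs t₁ (fun _ => 1) n (fun t x θ => (F t x θ)⁻¹) := by
  have hne : ∀ t x θ, F t x θ ≠ 0 := fun t x θ =>
    (lt_of_lt_of_le one_half_pos (hpos t x θ)).ne'
  have key : ∃ C, ∀ t ≤ t₁, ∀ x, ∀ θ ∈ Icc (-1 : ℝ) 1, |(F t x θ)⁻¹| ≤ C * (1 : ℝ) := by
    refine ⟨2, fun t _ x θ _ => ?_⟩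
    have := hpos t x θ
    rw [abs_of_pos (inv_pos.2 (by linarith)), mul_one]
    exact inv_le_of_inv_le₀ (by norm_num) (by linarith)
  induction n with
  | zero => exact key
  | succ n ih =>
    have hi := ih h.pred
    have hs := hF.inv hne
    have h1 : BoundedDerivs t₁ (fun _ => (1 : ℝ)) n (fun _ _ _ => (-1 : ℝ)) :=
      BoundedDerivs.const _
    refine ⟨key, ?_, ?_⟩
    · have := BoundedDerivs.mul (hs.mul hs) ((smooth3_const (-1)).mul hF.d2)
        (BoundedDerivs.mul hs hs hi hi) (BoundedDerivs.mul (smooth3_const (-1)) hF.d2 h1 h.2.1)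
      simp only [mul_one] at this
      convert this using 1
      funext t x θ
      refine ((hF.hasDerivAt2 t x θ).inv (hne t x θ)).deriv.trans ?_
      field_simp [hne t x θ]
    · have := BoundedDerivs.mul (hs.mul hs) ((smooth3_const (-1)).mul hF.d3)
        (BoundedDerivs.mul hs hs hi hi) (BoundedDerivs.mul (smooth3_const (-1)) hF.d3 h1 h.2.2)
      simp only [mul_one] at this
      convert this using 1
      funext t x θ
      refine ((hF.hasDerivAt3 t x θ).inv (hne t x θ)).deriv.trans ?_
      field_simp [hne t x θ]

/-- Smooth functions of a function with values in `[-1, 1]` inherit derivative bounds. -/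
theorem boundedDerivs_comp {V : ℝ → ℝ} (hV : ContDiff ℝ (⊤ : ℕ∞) V) (hZ : Smooth3 Z)
    (hmaps : ∀ t ≤ t₁, ∀ x, ∀ θ ∈ Icc (-1 : ℝ) 1, Z t x θ ∈ Icc (-1 : ℝ) 1)
    (h : BoundedDerivs t₁ (fun _ => 1) n Z) :
    BoundedDerivs t₁ (fun _ => 1) n (fun t x θ => V (Z t x θ)) := by
  have key : ∀ {V : ℝ → ℝ}, ContDiff ℝ (⊤ : ℕ∞) V →
      ∃ C, ∀ t ≤ t₁, ∀ x, ∀ θ ∈ Icc (-1 : ℝ) 1, |V (Z t x θ)| ≤ C * (1 : ℝ) := by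
    intro V hV
    obtain ⟨C, hC⟩ := isCompact_Icc.exists_bound_of_continuousOn
      (hV.continuous.continuousOn (s := Icc (-1 : ℝ) 1))
    exact ⟨C, fun t ht x θ hθ => by simpa using hC _ (hmaps t ht x θ hθ)⟩
  induction n generalizing V with
  | zero => exact key hV
  | succ n ih =>
    have hV' := (contDiff_infty_iff_deriv.1 hV).2
    have hVd := fun y => ((contDiff_infty_iff_deriv.1 hV).1 y).hasDerivAt
    refine ⟨key hV, ?_, ?_⟩
    · have := BoundedDerivs.mul (Smooth3.comp1 hV' hZ) hZ.d2 (ih hV' h.pred) h.2.1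
      simp only [mul_one] at this
      convert this using 1
      funext t x θ
      exact ((hVd _).comp x (hZ.hasDerivAt2 t x θ)).deriv
    · have := BoundedDerivs.mul (Smooth3.comp1 hV' hZ) hZ.d3 (ih hV' h.pred) h.2.2
      simp only [mul_one] at this
      convert this using 1
      funext t x θ
      exact ((hVd _).comp θ (hZ.hasDerivAt3 t x θ)).deriv

theorem boundedDerivs_sub_thd (hZ : Smooth3 Z)
    (h : BoundedDerivs t₁ lam (n + 1) (fun t x θ => Z t x θ - θ)) :
    BoundedDerivs t₁ lam n (d2 Z) ∧ BoundedDerivs t₁ lam n (fun t x θ => d3 Z t x θ - 1) := by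
  constructor
  · convert h.2.1 using 1
    funext t x θ
    exact (((hZ.hasDerivAt2 t x θ).sub_const θ).deriv).symm
  · convert h.2.2 using 1
    funext t x θ
    exact (((hZ.hasDerivAt3 t x θ).sub (hasDerivAt_id θ)).deriv).symm

/-- The difference `V(θ) - V(Z)` is as small as `Z - θ`. -/
theorem boundedDerivs_comp_sub {V : ℝ → ℝ} (hV : ContDiff ℝ (⊤ : ℕ∞) V) (hZ : Smooth3 Z)
    (hmaps : ∀ t ≤ t₁, ∀ x, ∀ θ ∈ Icc (-1 : ℝ) 1, Z t x θ ∈ Icc (-1 : ℝ) 1)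
    (h1 : BoundedDerivs t₁ (fun _ => 1) n Z)
    (h : BoundedDerivs t₁ lam n (fun t x θ => Z t x θ - θ)) :
    BoundedDerivs t₁ lam n (fun t x θ => V θ - V (Z t x θ)) := by
  have key : ∀ {V : ℝ → ℝ}, ContDiff ℝ (⊤ : ℕ∞) V →
      (∃ C, ∀ t ≤ t₁, ∀ x, ∀ θ ∈ Icc (-1 : ℝ) 1, |Z t x θ - θ| ≤ C * lam t) →
      ∃ C, ∀ t ≤ t₁, ∀ x, ∀ θ ∈ Icc (-1 : ℝ) 1, |V θ - V (Z t x θ)| ≤ C * lam t := by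
    rintro V hV ⟨C, hC⟩
    have hV' := (contDiff_infty_iff_deriv.1 hV).2
    obtain ⟨D, hD⟩ := isCompact_Icc.exists_bound_of_continuousOn
      (hV'.continuous.continuousOn (s := Icc (-1 : ℝ) 1))
    have hD0 : 0 ≤ D := (norm_nonneg _).trans (hD 0 (by norm_num))
    refine ⟨D * C, fun t ht x θ hθ => ?_⟩
    have := (convex_Icc (-1 : ℝ) 1).norm_image_sub_le_of_norm_deriv_le
      (fun y _ => (contDiff_infty_iff_deriv.1 hV).1 y) hD (hmaps t ht x θ hθ) hθ
    rw [Real.norm_eq_abs, Real.norm_eq_abs, abs_sub_comm θ] at this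
    calc _ ≤ D * |Z t x θ - θ| := this
      _ ≤ D * (C * lam t) := mul_le_mul_of_nonneg_left (hC t ht x θ hθ) hD0
      _ = _ := by ring
  induction n generalizing V with
  | zero => exact key hV h
  | succ n ih =>
    have hV' := (contDiff_infty_iff_deriv.1 hV).2
    have hVd := fun y => ((contDiff_infty_iff_deriv.1 hV).1 y).hasDerivAt
    obtain ⟨hx, hθ⟩ := boundedDerivs_sub_thd hZ h
    have hc := boundedDerivs_comp hV' hZ hmaps h1.pred
    have hm : BoundedDerivs t₁ (fun _ => (1 : ℝ)) n (fun t x θ => -1 * deriv V (Z t x θ)) := by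
      have := BoundedDerivs.mul (smooth3_const (-1)) (Smooth3.comp1 hV' hZ)
        (BoundedDerivs.const (-1)) hc
      simpa only [mul_one] using this
    have hms := (smooth3_const (-1)).mul (Smooth3.comp1 hV' hZ)
    refine ⟨key hV h.1, ?_, ?_⟩
    · have := BoundedDerivs.mul hms hZ.d2 hm hx
      simp only [one_mul] at this
      convert this using 1
      funext t x θ
      refine (((hVd _).comp x (hZ.hasDerivAt2 t x θ)).const_sub (V θ)).deriv.trans ?_
      ring
    · have hs1 := hZ.d3.sub (smooth3_const 1)
      have := BoundedDerivs.add ((Smooth3.comp1 hV' Smooth3.thd).sub (Smooth3.comp1 hV' hZ))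
        (hms.mul hs1) (ih hV' h1.pred h.pred)
        (by simpa only [one_mul] using BoundedDerivs.mul hms hs1 hm hθ)
      convert this using 1
      funext t x θ
      refine ((hVd θ).sub ((hVd _).comp θ (hZ.hasDerivAt3 t x θ))).deriv.trans ?_
      ring

end BoundedDerivs

section Eulerian

variable {U : ℝ → ℝ} {Z Q u Θ : ℝ → ℝ → ℝ → ℝ} {t₁ β : ℝ}

theorem iteratedDeriv_z_comp {F : ℝ → ℝ → ℝ → ℝ} (hF : Smooth3 F) (hZ : Smooth3 Z)
    (hpos : ∀ t x θ, 1 / 2 ≤ d3 Z t x θ)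
    (hΘ : Smooth3 Θ) (hZΘ : ∀ t x z, Z t x (Θ t x z) = z) (j : ℕ) :
    Smooth3 ((lagZ Z)^[j] F) ∧ ∀ t x z, iteratedDeriv j (fun z' => F t x (Θ t x z')) z
      = (lagZ Z)^[j] F t x (Θ t x z) := by
  induction j with
  | zero => exact ⟨hF, fun t x z => by simp⟩
  | succ j ih =>
    rw [Function.iterate_succ_apply']
    refine ⟨smooth3_lagZ ih.1 hZ hpos, fun t x z => ?_⟩
    rw [iteratedDeriv_succ, show iteratedDeriv j (fun z' => F t x (Θ t x z'))
      = fun z' => (lagZ Z)^[j] F t x (Θ t x z') from funext fun z' => ih.2 t x z']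
    exact (hasDerivAt_z_comp ih.1 hZ hpos hΘ hZΘ t x z).deriv

theorem iteratedDeriv_x_comp {F : ℝ → ℝ → ℝ → ℝ} (hF : Smooth3 F) (hZ : Smooth3 Z)
    (hpos : ∀ t x θ, 1 / 2 ≤ d3 Z t x θ)
    (hΘ : Smooth3 Θ) (hZΘ : ∀ t x z, Z t x (Θ t x z) = z) (ν x₁ : ℝ) (i : ℕ) :
    Smooth3 ((lagX Z)^[i] F) ∧
      ∀ t x z, iteratedDeriv i (fun x' => F t (ν * x' + x₁) (Θ t (ν * x' + x₁) z)) x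
      = ν ^ i * (lagX Z)^[i] F t (ν * x + x₁) (Θ t (ν * x + x₁) z) := by
  induction i with
  | zero => exact ⟨hF, fun t x z => by simp⟩
  | succ i ih =>
    rw [Function.iterate_succ_apply']
    refine ⟨smooth3_lagX ih.1 hZ hpos, fun t x z => ?_⟩
    rw [iteratedDeriv_succ,
      show iteratedDeriv i (fun x' => F t (ν * x' + x₁) (Θ t (ν * x' + x₁) z))
        = fun x' => ν ^ i * (lagX Z)^[i] F t (ν * x' + x₁) (Θ t (ν * x' + x₁) z) from
      funext fun x' => ih.2 t x' z]
    have hlin : HasDerivAt (fun s => ν * s + x₁) ν x := by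
      simpa using ((hasDerivAt_id x).const_mul ν).add_const x₁
    refine (((hasDerivAt_x_comp ih.1 hZ hpos hΘ hZΘ t (ν * x + x₁) z).comp x
      hlin).const_mul (ν ^ i)).deriv.trans ?_
    ring

theorem L2sqTZ_le {g : ℝ → ℝ → ℝ} {B : ℝ}
    (h : ∀ x, ∀ z ∈ Icc (-1 : ℝ) 1, |g x z| ≤ B) : L2sqTZ g ≤ 2 * B ^ 2 := by
  have hvol : (volume : Measure (ℝ × ℝ)) (Ico (0 : ℝ) 1 ×ˢ Ioo (-1 : ℝ) 1) = 2 := by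
    rw [Measure.volume_eq_prod, Measure.prod_prod, Real.volume_Ico, Real.volume_Ioo]
    norm_num
  have := norm_setIntegral_le_of_norm_le_const (μ := (volume : Measure (ℝ × ℝ)))
    (s := Ico (0 : ℝ) 1 ×ˢ Ioo (-1 : ℝ) 1) (f := fun p : ℝ × ℝ => (g p.1 p.2) ^ 2) (C := B ^ 2)
    (by rw [hvol]; norm_num) (by
      rintro ⟨x, z⟩ hp
      have := h x z (Ioo_subset_Icc_self hp.2)
      simp only [Real.norm_eq_abs, abs_pow]
      exact pow_le_pow_left₀ (abs_nonneg _) this 2)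
  rw [measureReal_def, hvol] at this
  refine (le_abs_self _).trans (this.trans (le_of_eq ?_))
  norm_num
  ring

theorem L2sqTZ_pos {g : ℝ → ℝ → ℝ} (hg : Continuous fun p : ℝ × ℝ => g p.1 p.2)
    (hper : ∀ x z, g (x + 1) z = g x z) {x z : ℝ} (hz : z ∈ Ioo (-1 : ℝ) 1) (h : g x z ≠ 0) :
    0 < L2sqTZ g := by
  have hperZ : ∀ (n : ℤ) x, g (x + n) z = g x z := by
    intro n x
    have : Function.Periodic (fun x => g x z) 1 := fun x => hper x z
    simpa using this.int_mul n x
  have h' : g (Int.fract x) z ≠ 0 := by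
    rwa [← hperZ ⌊x⌋, Int.fract_add_floor]
  have hopen : IsOpen {p : ℝ × ℝ | g p.1 p.2 ≠ 0} := isOpen_ne_fun hg continuous_const
  have hcl : (Int.fract x, z) ∈ closure (Ioo (0 : ℝ) 1 ×ˢ Ioo (-1 : ℝ) 1) := by
    rw [closure_prod_eq, closure_Ioo (by norm_num), closure_Ioo (by norm_num)]
    exact ⟨⟨Int.fract_nonneg x, (Int.fract_lt_one x).le⟩, Ioo_subset_Icc_self hz⟩
  have hne := mem_closure_iff.1 hcl _ hopen h'
  have hpos := (hopen.inter (isOpen_Ioo.prod isOpen_Ioo)).measure_pos volume hne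
  unfold L2sqTZ
  have hintg : IntegrableOn (fun p : ℝ × ℝ => (g p.1 p.2) ^ 2)
      (Ico (0 : ℝ) 1 ×ˢ Ioo (-1 : ℝ) 1) :=
    ((hg.pow 2).continuousOn.integrableOn_compact
      ((isCompact_Icc (a := (0 : ℝ)) (b := 1)).prod (isCompact_Icc (a := (-1 : ℝ)) (b := 1)))).mono_set
      (prod_mono Ico_subset_Icc_self Ioo_subset_Icc_self)
  rw [setIntegral_pos_iff_support_of_nonneg_ae (ae_of_all _ fun p => sq_nonneg _) hintg]
  refine hpos.trans_le (measure_mono ?_)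
  rintro p ⟨hp, hp1, hp2⟩
  exact ⟨pow_ne_zero 2 hp, Ioo_subset_Ico_self hp1, hp2⟩

theorem HsNormTZ_pos {s : ℕ} {g : ℝ → ℝ → ℝ} (h : 0 < L2sqTZ g) : 0 < HsNormTZ s g := by
  have hnn : ∀ i j, 0 ≤ L2sqTZ (pd2 i j g) := fun i j => integral_nonneg fun p => sq_nonneg _
  refine Real.sqrt_pos.2 (Finset.sum_pos' (fun i _ => Finset.sum_nonneg fun j _ => hnn i j)
    ⟨0, by simp, Finset.sum_pos' (fun j _ => hnn 0 j) ⟨0, by simp, ?_⟩⟩)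
  have h0 : pd2 0 0 g = g := by funext x z; simp [pd2]
  rwa [h0]

namespace AncientFlow

theorem maps_fwd (h : AncientFlow U Z Q u t₁ β) {t : ℝ} (ht : t ≤ t₁) (x : ℝ) :
    StrictMono (Z t x) ∧ ∀ θ ∈ Icc (-1 : ℝ) 1, Z t x θ ∈ Icc (-1 : ℝ) 1 := by
  have hm : StrictMono (Z t x) := by
    refine strictMono_of_deriv_pos fun θ => ?_
    have := h.half_le t x θ
    have h3 : d3 Z t x θ = deriv (Z t x) θ := rfl
    rw [← h3]; linarith
  refine ⟨hm, fun θ hθ => ⟨?_, ?_⟩⟩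
  · simpa [h.bottomZ t ht x] using hm.monotone hθ.1
  · simpa [h.topZ t ht x] using hm.monotone hθ.2

theorem maps_inv (h : AncientFlow U Z Q u t₁ β) (hZΘ : ∀ t x z, Z t x (Θ t x z) = z)
    {t : ℝ} (ht : t ≤ t₁) (x : ℝ) {z : ℝ} (hz : z ∈ Icc (-1 : ℝ) 1) :
    Θ t x z ∈ Icc (-1 : ℝ) 1 := by
  have hm := (h.maps_fwd ht x).1
  constructor
  · rw [← hm.le_iff_le, h.bottomZ t ht, hZΘ]; exact hz.1
  · rw [← hm.le_iff_le, h.topZ t ht, hZΘ]; exact hz.2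

theorem bounded_weight (h : AncientFlow U Z Q u t₁ β) {n : ℕ} {F : ℝ → ℝ → ℝ → ℝ}
    (hF : BoundedDerivs t₁ (fun t => Real.exp (β * t)) n F) :
    BoundedDerivs t₁ (fun _ => 1) n F :=
  hF.weaken ⟨Real.exp (β * t₁), fun t ht => by
    rw [mul_one]
    exact Real.exp_le_exp.2 (mul_le_mul_of_nonneg_left ht h.rate_pos.le)⟩
    fun t => (Real.exp_pos _).le

theorem boundedDerivs_coeffs (h : AncientFlow U Z Q u t₁ β) (n : ℕ) :
    BoundedDerivs t₁ (fun _ => 1) n (d2 Z) ∧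
    BoundedDerivs t₁ (fun _ => 1) n (fun t x θ => (d3 Z t x θ)⁻¹) := by
  obtain ⟨h2, h3⟩ := boundedDerivs_sub_thd h.smoothZ (h.decay (n + 1))
  refine ⟨h.bounded_weight h2, boundedDerivs_inv h.smoothZ.d3 h.half_le ?_⟩
  simpa using (h.bounded_weight h3).add (h.smoothZ.d3.sub (smooth3_const 1)) (smooth3_const 1)
    (BoundedDerivs.const 1)

theorem inv_smooth (h : AncientFlow U Z Q u t₁ β) :
    Smooth3 (fun t x θ => (d3 Z t x θ)⁻¹) :=
  h.smoothZ.d3.inv fun t x θ h0 => by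
    have := h.half_le t x θ
    rw [h0] at this; norm_num at this

theorem boundedDerivs_lag (h : AncientFlow U Z Q u t₁ β) {F : ℝ → ℝ → ℝ → ℝ} (hF : Smooth3 F)
    (hb : ∀ n, BoundedDerivs t₁ (fun t => Real.exp (β * t)) n F) :
    (∀ n, BoundedDerivs t₁ (fun t => Real.exp (β * t)) n (lagZ Z F)) ∧
    ∀ n, BoundedDerivs t₁ (fun t => Real.exp (β * t)) n (lagX Z F) := by
  have hz : ∀ n, BoundedDerivs t₁ (fun t => Real.exp (β * t)) n (lagZ Z F) := by
    intro n
    have := BoundedDerivs.mul hF.d3 h.inv_smooth (hb (n + 1)).2.2 (h.boundedDerivs_coeffs n).2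
    simp only [mul_one] at this
    exact this
  refine ⟨hz, fun n => ?_⟩
  have hzs := smooth3_lagZ hF h.smoothZ h.half_le
  have h1 := BoundedDerivs.mul h.smoothZ.d2 hzs (h.boundedDerivs_coeffs n).1 (hz n)
  have h2 := BoundedDerivs.mul (smooth3_const (-1)) (h.smoothZ.d2.mul hzs)
    (BoundedDerivs.const (-1)) h1
  simp only [one_mul] at h2
  convert (hb (n + 1)).2.1.add hF.d2 ((smooth3_const (-1)).mul (h.smoothZ.d2.mul hzs)) h2 using 1
  funext t x θ
  simp only [lagX, lagZ]
  ring

/-- The Sobolev norm of the perturbation decays exponentially in the infinite past. -/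
theorem HsNormTZ_le (h : AncientFlow U Z Q u t₁ β) (hΘ : Smooth3 Θ)
    (hZΘ : ∀ t x z, Z t x (Θ t x z) = z) (s : ℕ) :
    ∃ C, 0 < C ∧ ∀ t ≤ t₁, ∀ ν x₁, 1 ≤ ν →
      HsNormTZ s (fun x z => deriv U (Θ t (ν * x + x₁) z) - deriv U z)
        ≤ C * (ν ^ s * Real.exp (β * t)) := by
  have hU' : ContDiff ℝ (⊤ : ℕ∞) (deriv U) := (contDiff_infty_iff_deriv.1 h.smooth_shear).2
  set G : ℝ → ℝ → ℝ → ℝ := fun t x θ => deriv U θ - deriv U (Z t x θ) with hG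
  have hGs : Smooth3 G := (Smooth3.comp1 hU' Smooth3.thd).sub (Smooth3.comp1 hU' h.smoothZ)
  have hmaps := fun t ht x => (h.maps_fwd (t := t) ht x).2
  have hone : ∀ n, BoundedDerivs t₁ (fun _ => 1) n (fun _ _ θ : ℝ => θ) := by
    intro n
    cases n with
    | zero => exact ⟨1, fun t _ x θ hθ => by rw [mul_one]; exact abs_le.2 hθ⟩
    | succ n =>
      refine ⟨⟨1, fun t _ x θ hθ => by rw [mul_one]; exact abs_le.2 hθ⟩, ?_, ?_⟩
      · convert BoundedDerivs.const (t₁ := t₁) (n := n) 0 using 1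
        funext t x θ
        simp [d2]
      · convert BoundedDerivs.const (t₁ := t₁) (n := n) 1 using 1
        funext t x θ
        simp [d3]
  have hZb : ∀ n, BoundedDerivs t₁ (fun _ => 1) n Z := by
    intro n
    simpa using (h.bounded_weight (h.decay n)).add (h.smoothZ.sub Smooth3.thd) Smooth3.thd (hone n)
  have hGb : ∀ n, BoundedDerivs t₁ (fun t => Real.exp (β * t)) n G := fun n =>
    boundedDerivs_comp_sub hU' h.smoothZ hmaps (hZb n) (h.decay n)
  have hj : ∀ j, Smooth3 ((lagZ Z)^[j] G) ∧
      ∀ n, BoundedDerivs t₁ (fun t => Real.exp (β * t)) n ((lagZ Z)^[j] G) := by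
    intro j
    induction j with
    | zero => exact ⟨hGs, hGb⟩
    | succ j ih =>
      rw [Function.iterate_succ_apply']
      exact ⟨smooth3_lagZ ih.1 h.smoothZ h.half_le, (h.boundedDerivs_lag ih.1 ih.2).1⟩
  have hij : ∀ j i, Smooth3 ((lagX Z)^[i] ((lagZ Z)^[j] G)) ∧
      ∀ n, BoundedDerivs t₁ (fun t => Real.exp (β * t)) n ((lagX Z)^[i] ((lagZ Z)^[j] G)) := by
    intro j i
    induction i with
    | zero => exact hj j
    | succ i ih =>
      rw [Function.iterate_succ_apply']
      exact ⟨smooth3_lagX ih.1 h.smoothZ h.half_le, (h.boundedDerivs_lag ih.1 ih.2).2⟩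
  have hbd := fun i j => ((hij j i).2 0).zero
  choose C hC using hbd
  have hgG : ∀ t ν x₁, (fun x z => deriv U (Θ t (ν * x + x₁) z) - deriv U z)
      = fun x z => G t (ν * x + x₁) (Θ t (ν * x + x₁) z) := by
    intro t ν x₁
    funext x z
    simp only [hG, hZΘ]
  have hpd : ∀ i j t ν x₁ x z, pd2 i j (fun x z => deriv U (Θ t (ν * x + x₁) z) - deriv U z) x z
      = ν ^ i * (lagX Z)^[i] ((lagZ Z)^[j] G) t (ν * x + x₁) (Θ t (ν * x + x₁) z) := by
    intro i j t ν x₁ x z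
    rw [hgG, pd2]
    simp only [(iteratedDeriv_z_comp hGs h.smoothZ h.half_le hΘ hZΘ j).2]
    exact (iteratedDeriv_x_comp (hj j).1 h.smoothZ h.half_le hΘ hZΘ ν x₁ i).2 t x z
  refine ⟨Real.sqrt (∑ i ∈ Finset.range (s + 1), ∑ j ∈ Finset.range (s + 1 - i), 2 * C i j ^ 2) + 1,
    by positivity, fun t ht ν x₁ hν => ?_⟩
  have hw : 0 ≤ ν ^ s * Real.exp (β * t) := by positivity
  refine le_trans ?_ (mul_le_mul_of_nonneg_right (le_add_of_nonneg_right zero_le_one) hw)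
  unfold HsNormTZ
  rw [← Real.sqrt_sq hw, ← Real.sqrt_mul (by positivity), Finset.sum_mul]
  refine Real.sqrt_le_sqrt (Finset.sum_le_sum fun i hi => ?_)
  rw [Finset.sum_mul]
  refine Finset.sum_le_sum fun j _ => ?_
  have hi' : i ≤ s := by simpa [Nat.lt_succ_iff] using hi
  refine (L2sqTZ_le (B := C i j * (ν ^ s * Real.exp (β * t))) fun x z hz => ?_).trans
    (le_of_eq (by rw [mul_pow, mul_assoc]))
  rw [hpd, abs_mul, abs_of_nonneg (by positivity : (0 : ℝ) ≤ ν ^ i)]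
  have hb := hC i j t ht (ν * x + x₁) _ (h.maps_inv hZΘ ht (ν * x + x₁) hz)
  have hpw : ν ^ i ≤ ν ^ s := pow_le_pow_right₀ hν hi'
  calc _ ≤ ν ^ s * (C i j * Real.exp (β * t)) :=
        mul_le_mul hpw hb (abs_nonneg _) (by positivity)
    _ = _ := by ring

theorem exists_vorticity_ne (h : AncientFlow U Z Q u t₁ β)
    (hZΘ : ∀ t x z, Z t x (Θ t x z) = z) (hΘZ : ∀ t x θ, Θ t x (Z t x θ) = θ)
    {t x θ : ℝ} (ht : t ≤ t₁) (hθ : θ ∈ Ioo (-1 : ℝ) 1) (hne : Z t x θ ≠ θ) :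
    ∃ z ∈ Ioo (-1 : ℝ) 1, deriv U (Θ t x z) ≠ deriv U z := by
  by_contra! hcon
  have hm := (h.maps_fwd ht x).1
  have h0 : Θ t x 0 = 0 := by
    rcases h.shear_inj _ _ (hcon 0 (by norm_num)) with h | h
    · exact h
    · simpa using h
  have hZ0 : Z t x 0 = 0 := by rw [← h0, hZΘ, h0]
  have hzI : Z t x θ ∈ Ioo (-1 : ℝ) 1 := by
    constructor
    · simpa [h.bottomZ t ht x] using hm hθ.1
    · simpa [h.topZ t ht x] using hm hθ.2
  rcases h.shear_inj _ _ (hcon _ hzI) with h1 | h1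
  · rw [hΘZ] at h1
    exact hne h1.symm
  · rw [hΘZ] at h1
    rcases lt_trichotomy θ 0 with hlt | heq | hgt
    · have := hm hlt
      rw [hZ0] at this; linarith
    · rw [heq, hZ0] at hne; exact hne rfl
    · have := hm hgt
      rw [hZ0] at this; linarith

end AncientFlow

end Eulerian

theorem integrableOn_box {F : ℝ × ℝ × ℝ → ℝ} (hF : Continuous F) (a b x₀ z₀ r : ℝ) :
    IntegrableOn F (Icc a b ×ˢ (Metric.ball x₀ r ×ˢ Metric.ball z₀ r)) :=
  (hF.continuousOn.integrableOn_compact ((isCompact_Icc (a := a) (b := b)).prod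
    ((isCompact_closedBall x₀ r).prod (isCompact_closedBall z₀ r)))).mono_set
    (prod_mono le_rfl (prod_mono Metric.ball_subset_closedBall Metric.ball_subset_closedBall))

/-- A lower bound for the `L²` norm of a function over a box, from a smaller box. -/
theorem le_sqrt_integral_box {F : ℝ × ℝ × ℝ → ℝ} (hF : Continuous F) {b x₀ z₀ r R c : ℝ}
    (hr : 0 < r) (hr1 : r ≤ 1) (hrb : r ≤ b) (hrR : r ≤ R) (hc : 0 ≤ c)
    (hlow : ∀ p ∈ Icc (b - r) b ×ˢ (Metric.ball x₀ r ×ˢ Metric.ball z₀ r), c ≤ |F p|) :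
    2 * c * r ^ 2 ≤
      Real.sqrt (∫ p in Icc 0 b ×ˢ (Metric.ball x₀ R ×ˢ Metric.ball z₀ R), F p ^ 2) := by
  have hsub : Icc (b - r) b ×ˢ (Metric.ball x₀ r ×ˢ Metric.ball z₀ r)
      ⊆ Icc 0 b ×ˢ (Metric.ball x₀ R ×ˢ Metric.ball z₀ R) :=
    prod_mono (Icc_subset_Icc (by linarith) le_rfl)
      (prod_mono (Metric.ball_subset_ball hrR) (Metric.ball_subset_ball hrR))
  have hvol : (volume : Measure (ℝ × ℝ × ℝ))
      (Icc (b - r) b ×ˢ (Metric.ball x₀ r ×ˢ Metric.ball z₀ r)) = ENNReal.ofReal (4 * r ^ 3) := by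
    rw [Measure.volume_eq_prod, Measure.prod_prod, Measure.volume_eq_prod, Measure.prod_prod,
      Real.volume_Icc, Real.volume_ball, Real.volume_ball, ← ENNReal.ofReal_mul (by linarith),
      ← ENNReal.ofReal_mul (by linarith)]
    congr 1; ring
  have h1 : c ^ 2 * (4 * r ^ 3) ≤
      ∫ p in Icc (b - r) b ×ˢ (Metric.ball x₀ r ×ˢ Metric.ball z₀ r), F p ^ 2 := by
    have := setIntegral_mono_on (μ := (volume : Measure (ℝ × ℝ × ℝ)))
      (f := fun _ => c ^ 2) (g := fun p => F p ^ 2)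
      (s := Icc (b - r) b ×ˢ (Metric.ball x₀ r ×ˢ Metric.ball z₀ r))
      (integrableOn_const (by rw [hvol]; exact ENNReal.ofReal_ne_top))
      (integrableOn_box (hF.pow 2) _ _ _ _ _)
      (measurableSet_Icc.prod (measurableSet_ball.prod measurableSet_ball))
      (fun p hp => by
        rw [← sq_abs (F p)]
        exact pow_le_pow_left₀ hc (hlow p hp) 2)
    rw [setIntegral_const, measureReal_def, hvol, ENNReal.toReal_ofReal (by positivity)] at this
    rw [smul_eq_mul] at this
    linarith
  have h2 := setIntegral_mono_set (integrableOn_box (hF.pow 2) 0 b x₀ z₀ R)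
    (ae_of_all _ fun p => sq_nonneg (F p)) hsub.eventuallyLE
  refine Real.le_sqrt_of_sq_le (le_trans ?_ (h1.trans h2))
  have : r ^ 4 ≤ r ^ 3 := pow_le_pow_of_le_one hr.le hr1 (by norm_num)
  nlinarith [sq_nonneg c]

theorem continuous_L2sqTZ {F : ℝ → ℝ → ℝ → ℝ} (hF : Smooth3 F) :
    Continuous fun t => L2sqTZ (F t) := by
  have h1 : ∀ t, L2sqTZ (F t)
      = ∫ p in Icc (0 : ℝ) 1 ×ˢ Icc (-1 : ℝ) 1, (F t p.1 p.2) ^ 2 := fun t =>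
    setIntegral_congr_set (Measure.set_prod_ae_eq Ico_ae_eq_Icc Ioo_ae_eq_Icc)
  simp only [h1]
  refine continuous_parametric_integral_of_continuous ?_ (isCompact_Icc.prod isCompact_Icc)
  exact (ContDiff.continuous hF).pow 2

theorem Smooth3.pd2 {F : ℝ → ℝ → ℝ → ℝ} (hF : Smooth3 F) (i j : ℕ) :
    Smooth3 (fun t x z => pd2 i j (F t) x z) := by
  have hz : ∀ j, Smooth3 (fun t x z => iteratedDeriv j (F t x) z) := by
    intro j
    induction j with
    | zero => simpa using hF
    | succ j ih =>
      have := ih.d3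
      simp only [iteratedDeriv_succ]
      exact this
  have hx : ∀ i, Smooth3 (fun t x z => iteratedDeriv i (fun x' => iteratedDeriv j (F t x') z) x) := by
    intro i
    induction i with
    | zero => simpa using hz j
    | succ i ih =>
      have := ih.d2
      simp only [iteratedDeriv_succ]
      exact this
  exact hx i

theorem continuous_HsNormTZ {F : ℝ → ℝ → ℝ → ℝ} (hF : Smooth3 F) (s : ℕ) :
    Continuous fun t => HsNormTZ s (F t) := by
  unfold HsNormTZ
  refine Continuous.sqrt (continuous_finsetSum _ fun i _ => continuous_finsetSum _ fun j _ => ?_)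
  exact continuous_L2sqTZ (hF.pd2 i j)

set_option maxHeartbeats 2000000 in
theorem AncientFlow.illposed {U : ℝ → ℝ} {Z Q u : ℝ → ℝ → ℝ → ℝ} {t₁ β : ℝ}
    (h : AncientFlow U Z Q u t₁ β) (s : ℕ) (α : ℝ) (hα : α ∈ Set.Ioc (0:ℝ) 1) (k : ℕ) :
    ∃ (x₀ z₀ C ε₀ : ℝ), z₀ ∈ Set.Ioo (-1:ℝ) 1 ∧ 0 < C ∧ 0 < ε₀ ∧
          ∃ (t : ℝ → ℝ) (ω : ℝ → ℝ → ℝ → ℝ → ℝ),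
            (∀ ε ∈ Set.Ioc (0:ℝ) ε₀,
              0 < t ε ∧ t ε ≤ C * ε * |Real.log ε| ∧ IsHydroSol (t ε) (ω ε)) ∧
            Tendsto
              (fun ε : ℝ =>
                Real.sqrt (∫ p in (Set.Icc (0:ℝ) (t ε)) ×ˢ
                    ((Metric.ball x₀ (ε ^ k)) ×ˢ (Metric.ball z₀ (ε ^ k))),
                  (ω ε p.1 p.2.1 p.2.2 - deriv U p.2.2) ^ 2)
                / (HsNormTZ s (fun x z => ω ε 0 x z - deriv U z)) ^ α)
              (nhdsWithin 0 (Set.Ioc 0 ε₀)) atTop := by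
  obtain ⟨Θ, hΘ, hZΘ, hΘZ⟩ := exists_smooth_fibre_inverse h.smoothZ h.half_le
  have hU' : ContDiff ℝ (⊤ : ℕ∞) (deriv U) := (contDiff_infty_iff_deriv.1 h.smooth_shear).2
  have hdiff : Smooth3 (fun t x z => deriv U (Θ t x z) - deriv U z) :=
    (Smooth3.comp1 hU' hΘ).sub (Smooth3.comp1 hU' Smooth3.thd)
  obtain ⟨τ, hτ, x₁, θ, hθ, hne⟩ := h.nontrivial
  obtain ⟨z₁, hz₁, hne₁⟩ := h.exists_vorticity_ne hZΘ hΘZ hτ hθ hne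
  obtain ⟨c, δ, hc, hδ, hδ1, hlow⟩ : ∃ c δ : ℝ, 0 < c ∧ 0 < δ ∧ δ ≤ 1 ∧
      ∀ t x z, |t - τ| < δ → |x - x₁| < δ → |z - z₁| < δ →
        c ≤ |deriv U (Θ t x z) - deriv U z| := by
    have hpos : 0 < |deriv U (Θ τ x₁ z₁) - deriv U z₁| := abs_pos.2 (sub_ne_zero.2 hne₁)
    have hcont := (ContDiff.continuous hdiff).abs.continuousAt (x := (τ, x₁, z₁))
    have hev := hcont.eventually (lt_mem_nhds (half_lt_self hpos))
    obtain ⟨δ, hδ, hb⟩ := Metric.eventually_nhds_iff.1 hev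
    refine ⟨_, min δ 1, half_pos hpos, lt_min hδ one_pos, min_le_right _ _, ?_⟩
    intro t x z ht hx hz
    have := @hb (t, x, z) (by
      simp only [Prod.dist_eq, Real.dist_eq, max_lt_iff]
      exact ⟨ht.trans_le (min_le_left _ _), hx.trans_le (min_le_left _ _),
        hz.trans_le (min_le_left _ _)⟩)
    exact this.le
  obtain ⟨D, hD0, hD⟩ := h.HsNormTZ_le hΘ hZΘ s
  obtain ⟨M, hM1, hM⟩ : ∃ M : ℝ, 1 ≤ M ∧ 2 * k + 3 ≤ (β * M - s) * α := by
    refine ⟨max 1 ((s + (2 * k + 3) / α) / β), le_max_left _ _, ?_⟩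
    have h1 : (s + (2 * k + 3) / α) / β ≤ max 1 ((s + (2 * k + 3) / α) / β) := le_max_right _ _
    rw [div_le_iff₀ h.rate_pos] at h1
    have h2 : (2 * k + 3) / α ≤ β * max 1 ((s + (2 * k + 3) / α) / β) - s := by linarith
    rwa [div_le_iff₀ hα.1] at h2
  have hπ := Real.pi_gt_three
  have hπ4 := Real.pi_lt_four
  set ν : ℝ → ℝ := fun ε => (⌈1 / ε⌉₊ : ℝ) * (2 * Real.pi) with hν
  have hνb : ∀ ε, 0 < ε → ε ≤ 1 / 4 → 2 * Real.pi / ε ≤ ν ε ∧ ν ε ≤ 4 * Real.pi / ε := by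
    intro ε h0 h1
    have hN1 := Nat.le_ceil (1 / ε)
    have hN2 := (Nat.ceil_lt_add_one (by positivity : (0 : ℝ) ≤ 1 / ε)).le
    have h4 : 1 ≤ 1 / ε := by rw [le_div_iff₀ h0]; linarith
    constructor
    · calc 2 * Real.pi / ε = 1 / ε * (2 * Real.pi) := by ring
        _ ≤ _ := mul_le_mul_of_nonneg_right hN1 (by positivity)
    · calc ν ε ≤ (1 / ε + 1) * (2 * Real.pi) := mul_le_mul_of_nonneg_right hN2 (by positivity)
        _ ≤ (1 / ε + 1 / ε) * (2 * Real.pi) := by gcongr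
        _ = _ := by ring
  have hlog1 : ∀ ε, 0 < ε → ε ≤ 1 / 4 → 1 ≤ |Real.log ε| := by
    intro ε h0 h1
    have : Real.log ε ≤ Real.log (Real.exp (-1)) := by
      refine Real.log_le_log h0 (h1.trans ?_)
      rw [Real.exp_neg, one_div]
      exact inv_anti₀ (Real.exp_pos _) (by linarith [Real.exp_one_lt_d9])
    rw [Real.log_exp] at this
    rw [abs_of_neg (by linarith)]
    linarith
  have hν1 : ∀ ε, 0 < ε → ε ≤ 1 / 4 → 1 ≤ ν ε := by
    intro ε h0 h1
    refine le_trans ?_ (hνb ε h0 h1).1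
    rw [le_div_iff₀ h0]; linarith
  set H : ℝ → ℝ → ℝ := fun ε T =>
    HsNormTZ s (fun x z => deriv U (Θ (τ - T) (ν ε * x + x₁) z) - deriv U z) with hHdef
  have hHpos : ∀ ε T, 0 < ε → ε ≤ 1 / 4 → 0 < T → T < δ → 0 < H ε T := by
    intro ε T h0 h1 hT0 hTδ
    have hν0 : 0 < ν ε := by linarith [hν1 ε h0 h1]
    refine HsNormTZ_pos (L2sqTZ_pos (x := 0) ?_ ?_ hz₁ ?_)
    · exact ((ContDiff.continuous hdiff).comp (g := fun p : ℝ × ℝ × ℝ =>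
          deriv U (Θ p.1 p.2.1 p.2.2) - deriv U p.2.2) (f := fun p : ℝ × ℝ =>
            (τ - T, ν ε * p.1 + x₁, p.2)) (by fun_prop))
    · have := (h.isHydroSol hΘ hZΘ hΘZ (N := ⌈1 / ε⌉₊) (ν := ν ε) (T := T) (τ := τ) (x₁ := x₁)
        (S := T / ν ε) rfl hν0 (by rw [mul_div_cancel₀ _ hν0.ne']) hτ).2.1 0
      intro x z
      have h2 := this x z
      have htime : ν ε * 0 - T + τ = τ - T := by ring
      simp only [htime] at h2
      rw [h2]
    · intro h0
      have := hlow (τ - T) (ν ε * 0 + x₁) z₁ (by rw [abs_lt]; constructor <;> linarith)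
        (by simpa using hδ) (by simpa using hδ)
      rw [h0, abs_zero] at this
      linarith
  set b : ℝ → ℝ := fun ε => D * ((4 * Real.pi) ^ s * Real.exp (β * τ)) * ε ^ (β * M - s) with hb
  have hHle : ∀ ε T, 0 < ε → ε ≤ 1 / 4 → M * |Real.log ε| ≤ T → H ε T ≤ b ε := by
    intro ε T h0 h1 hT1
    have hν0 : 0 < ν ε := by linarith [hν1 ε h0 h1]
    have hT0 : 0 ≤ T := le_trans (by positivity) hT1
    refine (hD (τ - T) (by linarith [hτ]) (ν ε) x₁ (hν1 ε h0 h1)).trans ?_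
    simp only [hb, mul_assoc D]
    refine mul_le_mul_of_nonneg_left ?_ hD0.le
    have e1 : ν ε ^ s ≤ (4 * Real.pi / ε) ^ s := pow_le_pow_left₀ hν0.le (hνb ε h0 h1).2 s
    have e2 : Real.exp (β * (τ - T)) ≤ Real.exp (β * τ) * ε ^ (β * M) := by
      rw [Real.rpow_def_of_pos h0, ← Real.exp_add]
      refine Real.exp_le_exp.2 ?_
      have hlogneg : Real.log ε < 0 := Real.log_neg h0 (by linarith)
      rw [abs_of_neg hlogneg] at hT1
      nlinarith [h.rate_pos]
    calc _ ≤ (4 * Real.pi / ε) ^ s * (Real.exp (β * τ) * ε ^ (β * M)) :=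
          mul_le_mul e1 e2 (Real.exp_pos _).le (by positivity)
      _ = _ := by
        rw [Real.rpow_sub h0, Real.rpow_natCast, div_pow]
        field_simp
  have hT : ∀ ε : ℝ, ∃ T, 0 < ε → ε ≤ 1 / 4 → δ / 2 ≤ T ∧ T ≤ M * |Real.log ε| ∧
      0 < H ε T ∧ H ε T ≤ b ε := by
    intro ε
    by_cases hε : 0 < ε ∧ ε ≤ 1 / 4
    · obtain ⟨h0, h1⟩ := hε
      have hL := hlog1 ε h0 h1
      have hML : 1 ≤ M * |Real.log ε| := by nlinarith
      have hδM : δ / 2 ≤ M * |Real.log ε| := by linarith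
      have hp := hHpos ε (δ / 2) h0 h1 (by linarith) (by linarith)
      have hb0 : 0 < b ε := by positivity
      have hcont : Continuous (H ε) := by
        have hlin : Smooth3 (fun T x z => deriv U (Θ (τ - T) (ν ε * x + x₁) z) - deriv U z) :=
          ContDiff.comp (g := fun p : ℝ × ℝ × ℝ =>
            deriv U (Θ p.1 p.2.1 p.2.2) - deriv U p.2.2) (f := fun p : ℝ × ℝ × ℝ =>
            (τ - p.1, ν ε * p.2.1 + x₁, p.2.2)) hdiff (by fun_prop)
        exact continuous_HsNormTZ hlin s
      have hle := hHle ε _ h0 h1 le_rfl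
      by_cases hz : 0 < H ε (M * |Real.log ε|)
      · exact ⟨_, fun _ _ => ⟨hδM, le_rfl, hz, hle⟩⟩
      obtain ⟨T, hT, hTe⟩ := intermediate_value_Icc' hδM hcont.continuousOn
        (show min (b ε) (H ε (δ / 2)) ∈ Icc _ _ from
          ⟨(not_lt.1 hz).trans (lt_min hb0 hp).le, min_le_right _ _⟩)
      refine ⟨T, fun _ _ => ⟨hT.1, hT.2, ?_, ?_⟩⟩
      · rw [hTe]; exact lt_min hb0 hp
      · rw [hTe]; exact min_le_left _ _
    · exact ⟨0, fun h1 h2 => (hε ⟨h1, h2⟩).elim⟩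
  choose T hT using hT
  refine ⟨0, z₁, M, 1 / 4, hz₁, by linarith, by norm_num, fun ε => T ε / ν ε,
    fun ε t x z => deriv U (Θ (ν ε * t - T ε + τ) (ν ε * x + x₁) z), ?_, ?_⟩
  · rintro ε ⟨h0, h1⟩
    obtain ⟨hT1, hT2, -⟩ := hT ε h0 h1
    have hν0 : 0 < ν ε := by linarith [hν1 ε h0 h1]
    have hL := hlog1 ε h0 h1
    have hT0 : 0 < T ε := by linarith
    refine ⟨by positivity, ?_, h.isHydroSol hΘ hZΘ hΘZ (N := ⌈1 / ε⌉₊) rfl hν0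
      (by rw [mul_div_cancel₀ _ hν0.ne']) hτ⟩
    rw [div_le_iff₀ hν0]
    have h2 := (hνb ε h0 h1).1
    rw [div_le_iff₀ h0] at h2
    have h3 : 0 ≤ M * |Real.log ε| := by positivity
    nlinarith
  set ρ := δ / (8 * Real.pi) with hρ
  have hρ0 : 0 < ρ := by positivity
  have hρ1 : ρ ≤ 1 := by
    rw [hρ, div_le_one (by positivity)]; linarith
  have hρδ : ρ < δ := by
    rw [hρ, div_lt_iff₀ (by positivity)]; nlinarith
  set B : ℝ := (D * ((4 * Real.pi) ^ s * Real.exp (β * τ))) ^ α with hB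
  have hB0 : 0 < B := by positivity
  have hmain : ∀ ε ∈ Ioc (0 : ℝ) (1 / 4), 2 * c * ρ ^ 2 / B * ε⁻¹ ≤
      Real.sqrt (∫ p in (Set.Icc (0:ℝ) (T ε / ν ε)) ×ˢ
          ((Metric.ball 0 (ε ^ k)) ×ˢ (Metric.ball z₁ (ε ^ k))),
        (deriv U (Θ (ν ε * p.1 - T ε + τ) (ν ε * p.2.1 + x₁) p.2.2) - deriv U p.2.2) ^ 2)
      / (HsNormTZ s (fun x z => deriv U (Θ (ν ε * 0 - T ε + τ) (ν ε * x + x₁) z)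
        - deriv U z)) ^ α := by
    rintro ε ⟨h0, h1⟩
    obtain ⟨hT1, hT2, hHpos, hHle⟩ := hT ε h0 h1
    have hν0 : 0 < ν ε := by linarith [hν1 ε h0 h1]
    have hνu := (hνb ε h0 h1).2
    rw [le_div_iff₀ h0] at hνu
    set r := ρ * ε ^ (k + 1) with hr
    have hr0 : 0 < r := by positivity
    have hεk1 : ε ^ k ≤ 1 := pow_le_one₀ h0.le (by linarith)
    have hrε : r ≤ ρ * ε := by
      rw [hr, pow_succ]
      have : ε ^ k * ε ≤ 1 * ε := mul_le_mul_of_nonneg_right hεk1 h0.le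
      nlinarith
    have hr1 : r ≤ 1 := by nlinarith
    have hrk : r ≤ ε ^ k := by
      rw [hr, pow_succ]
      have : ε ^ k * ε ≤ ε ^ k * 1 := mul_le_mul_of_nonneg_left (by linarith) (by positivity)
      nlinarith [pow_pos h0 k]
    have hνr : ν ε * r ≤ δ / 2 := by
      calc ν ε * r ≤ ν ε * (ρ * ε) := mul_le_mul_of_nonneg_left hrε hν0.le
        _ = (ν ε * ε) * ρ := by ring
        _ ≤ (4 * Real.pi) * ρ := mul_le_mul_of_nonneg_right hνu hρ0.le
        _ = δ / 2 := by rw [hρ]; field_simp; norm_num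
    have hrt : r ≤ T ε / ν ε := by
      rw [le_div_iff₀ hν0]; nlinarith
    have hnum := le_sqrt_integral_box (F := fun p : ℝ × ℝ × ℝ =>
        deriv U (Θ (ν ε * p.1 - T ε + τ) (ν ε * p.2.1 + x₁) p.2.2) - deriv U p.2.2)
      (b := T ε / ν ε) (x₀ := 0) (z₀ := z₁) (r := r) (R := ε ^ k) (c := c)
      ((ContDiff.continuous hdiff).comp (g := fun p : ℝ × ℝ × ℝ =>
        deriv U (Θ p.1 p.2.1 p.2.2) - deriv U p.2.2) (f := fun p : ℝ × ℝ × ℝ =>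
          (ν ε * p.1 - T ε + τ, ν ε * p.2.1 + x₁, p.2.2)) (by fun_prop))
      hr0 hr1 hrt hrk hc.le (by
        rintro ⟨t, x, z⟩ ⟨ht, hx, hz⟩
        simp only [Metric.mem_ball, Real.dist_eq, sub_zero] at hx hz ht ⊢
        have hTν : ν ε * (T ε / ν ε) = T ε := mul_div_cancel₀ _ hν0.ne'
        refine hlow _ _ _ ?_ ?_ ?_
        · rw [add_sub_cancel_right, abs_lt]
          constructor <;> nlinarith [ht.1, ht.2]
        · rw [add_sub_cancel_right, abs_mul, abs_of_pos hν0]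
          nlinarith
        · nlinarith)
    have htime : ν ε * 0 - T ε + τ = τ - T ε := by ring
    rw [htime]
    change _ ≤ _ / H ε (T ε) ^ α
    have hHα : H ε (T ε) ^ α ≤ B * ε ^ (2 * k + 3) := by
      calc H ε (T ε) ^ α ≤ (D * ((4 * Real.pi) ^ s * Real.exp (β * τ)) * ε ^ (β * M - s)) ^ α :=
            Real.rpow_le_rpow hHpos.le hHle hα.1.le
        _ = B * ε ^ ((β * M - s) * α) := by
            rw [Real.mul_rpow (by positivity) (by positivity), ← Real.rpow_mul h0.le]
        _ ≤ B * ε ^ ((2 * k + 3 : ℕ) : ℝ) := by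
            refine mul_le_mul_of_nonneg_left ?_ hB0.le
            refine Real.rpow_le_rpow_of_exponent_ge h0 (by linarith) ?_
            push_cast; exact hM
        _ = _ := by rw [Real.rpow_natCast]
    have hHα0 : 0 < H ε (T ε) ^ α := Real.rpow_pos_of_pos hHpos α
    rw [le_div_iff₀ hHα0]
    refine le_trans ?_ hnum
    calc 2 * c * ρ ^ 2 / B * ε⁻¹ * H ε (T ε) ^ α ≤ 2 * c * ρ ^ 2 / B * ε⁻¹ * (B * ε ^ (2 * k + 3)) :=
          mul_le_mul_of_nonneg_left hHα (by positivity)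
      _ = 2 * c * r ^ 2 := by
          rw [hr]; field_simp; ring
  refine tendsto_atTop_mono' _ (eventually_of_mem self_mem_nhdsWithin hmain) ?_
  refine Tendsto.const_mul_atTop (by positivity) ?_
  exact tendsto_inv_nhdsGT_zero.mono_left (nhdsWithin_mono _ fun x hx => hx.1)

set_option linter.unusedSectionVars false

section Wiener

open scoped BoundedContinuousFunction

/-- Fourier coefficients, absolutely summable uniformly in time, of functions of time and of the
periodic variable with values in `V`. -/
noncomputable abbrev Wiener (V : Type*) [NormedAddCommGroup V] := lp (fun _ : ℤ => ℝ →ᵇ V) 1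

theorem lp_one_hasSum_norm {X : Type*} [NormedAddCommGroup X] (c : lp (fun _ : ℤ => X) 1) :
    HasSum (fun n => ‖c n‖) ‖c‖ := by
  simpa using lp.hasSum_norm (by simp) c

variable {V Y : Type*} [NormedCommRing V] [NormedAlgebra ℂ V]
  [NormedCommRing Y] [NormedAlgebra ℂ Y]

theorem wiener_norm_apply_le (c : Wiener V) (n : ℤ) (t : ℝ) : ‖c n t‖ ≤ ‖c n‖ :=
  (c n).norm_coe_le_norm t

/-- The elementary mode of frequency `n`, with its time weight. -/
noncomputable def mode (n : ℤ) (t x : ℝ) : ℂ :=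
  Complex.exp (|(n : ℝ)| * t / 2 + Complex.I * n * x)

theorem norm_mode (n : ℤ) (t x : ℝ) : ‖mode n t x‖ = Real.exp (|(n : ℝ)| * t / 2) := by
  rw [mode, Complex.norm_exp]
  congr 1
  simp [Complex.mul_re, Complex.mul_im]

theorem norm_mode_le_one (n : ℤ) {t : ℝ} (ht : t ≤ 0) (x : ℝ) : ‖mode n t x‖ ≤ 1 := by
  rw [norm_mode, Real.exp_le_one_iff]
  have := mul_nonneg (abs_nonneg (n : ℝ)) (neg_nonneg.2 ht)
  linarith

/-- The derivative of order `j` in `x` of the function with coefficients `c`. -/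
noncomputable def phys (j : ℕ) (c : Wiener V) (t x : ℝ) : V :=
  ∑' n : ℤ, ((Complex.I * n) ^ j * mode n t x) • c n t

theorem exists_pow_mul_exp_le (j : ℕ) {η : ℝ} (hη : 0 < η) :
    ∃ C, 0 ≤ C ∧ ∀ y : ℝ, 0 ≤ y → y ^ j * Real.exp (-(y * η)) ≤ C := by
  refine ⟨j.factorial / η ^ j, by positivity, fun y hy => ?_⟩
  rw [Real.exp_neg, ← div_eq_mul_inv, div_le_div_iff₀ (Real.exp_pos _) (by positivity),
    ← mul_pow]
  have := Real.pow_div_factorial_le_exp (y * η) (by positivity) j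
  rwa [div_le_iff₀ (by positivity), mul_comm (Real.exp _)] at this

/-- Uniform bound for the terms of `phys` and their derivatives. -/
theorem exists_norm_term_le (j : ℕ) {η : ℝ} (hη : 0 < η) :
    ∃ C, 0 ≤ C ∧ ∀ n : ℤ, ∀ t ≤ -η, ∀ x, ‖(Complex.I * n) ^ j * mode n t x‖ ≤ C := by
  obtain ⟨C, hC, h⟩ := exists_pow_mul_exp_le j (half_pos hη)
  refine ⟨C, hC, fun n t ht x => le_trans ?_ (h |(n : ℝ)| (abs_nonneg _))⟩
  rw [norm_mul, norm_mode, norm_pow, norm_mul, Complex.norm_I, one_mul, Complex.norm_intCast]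
  gcongr
  have := mul_le_mul_of_nonneg_left ht (abs_nonneg (n : ℝ))
  linarith

theorem exists_norm_phys_term_le (j : ℕ) {η : ℝ} (hη : 0 < η) :
    ∃ C, 0 ≤ C ∧ ∀ (c : Wiener V) (n : ℤ), ∀ t ≤ -η, ∀ x,
      ‖((Complex.I * n) ^ j * mode n t x) • c n t‖ ≤ C * ‖c n‖ := by
  obtain ⟨C, hC, h⟩ := exists_norm_term_le j hη
  refine ⟨C, hC, fun c n t ht x => ?_⟩
  rw [norm_smul]
  exact mul_le_mul (h n t ht x) (wiener_norm_apply_le c n t) (norm_nonneg _) hC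

variable [CompleteSpace V] [CompleteSpace Y]

theorem summable_phys (j : ℕ) (c : Wiener V) {t : ℝ} (ht : t < 0) (x : ℝ) :
    Summable fun n : ℤ => ((Complex.I * n) ^ j * mode n t x) • c n t := by
  obtain ⟨C, hC, h⟩ := exists_norm_phys_term_le (V := V) j (neg_pos.2 ht)
  exact Summable.of_norm_bounded ((lp_one_hasSum_norm c).summable.mul_left C)
    fun n => h c n t (by simp) x

theorem phys_add (j : ℕ) (a b : Wiener V) {t : ℝ} (ht : t < 0) (x : ℝ) :
    phys j (a + b) t x = phys j a t x + phys j b t x := by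
  simp only [phys, ← (summable_phys j a ht x).tsum_add (summable_phys j b ht x)]
  simp

theorem phys_smul (j : ℕ) (z : ℂ) (a : Wiener V) {t : ℝ} (ht : t < 0) (x : ℝ) :
    phys j (z • a) t x = z • phys j a t x := by
  simp only [phys, ← (summable_phys j a ht x).tsum_const_smul z]
  congr 1; ext n
  simp [smul_smul, mul_comm]

theorem phys_neg (j : ℕ) (a : Wiener V) {t : ℝ} (ht : t < 0) (x : ℝ) :
    phys j (-a) t x = -phys j a t x := by
  rw [← neg_one_smul ℂ a, phys_smul j _ a ht, neg_one_smul]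

theorem phys_sub (j : ℕ) (a b : Wiener V) {t : ℝ} (ht : t < 0) (x : ℝ) :
    phys j (a - b) t x = phys j a t x - phys j b t x := by
  rw [sub_eq_add_neg, phys_add j _ _ ht, phys_neg j _ ht, sub_eq_add_neg]

/-- Coefficientwise application of a continuous linear map. -/
noncomputable def wmap (L : V →L[ℂ] Y) : Wiener V →L[ℂ] Wiener Y :=
  lp.mapCLM 1 (fun _ => L.compLeftContinuousBounded ℝ) (norm_nonneg L)
    (fun _ => ContinuousLinearMap.opNorm_le_bound _ (norm_nonneg _) fun f =>
      (BoundedContinuousFunction.norm_le (by positivity)).2 fun t =>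
        (L.le_opNorm _).trans (mul_le_mul_of_nonneg_left (f.norm_coe_le_norm t) (norm_nonneg _)))

theorem wmap_apply (L : V →L[ℂ] Y) (c : Wiener V) (n : ℤ) (t : ℝ) :
    wmap L c n t = L (c n t) := rfl

theorem norm_wmap_le (L : V →L[ℂ] Y) (c : Wiener V) : ‖wmap L c‖ ≤ ‖L‖ * ‖c‖ :=
  ContinuousLinearMap.le_of_opNorm_le _ (lp.norm_mapCLM_le _ _ _ _) _

theorem phys_wmap (j : ℕ) (L : V →L[ℂ] Y) (c : Wiener V) {t : ℝ} (ht : t < 0) (x : ℝ) :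
    phys j (wmap L c) t x = L (phys j c t x) := by
  simp only [phys, wmap_apply, L.map_tsum (summable_phys j c ht x), map_smul]

/-- Decay of functions without mean. -/
theorem exists_norm_phys_le (j : ℕ) {η : ℝ} (hη : 0 < η) :
    ∃ C, 0 ≤ C ∧ ∀ (c : Wiener V), c 0 = 0 → ∀ t ≤ -η, ∀ x,
      ‖phys j c t x‖ ≤ C * ‖c‖ * Real.exp (1 / 4 * t) := by
  obtain ⟨C, hC, h⟩ := exists_pow_mul_exp_le j (half_pos (half_pos hη))
  refine ⟨C, hC, fun c hc t ht x => ?_⟩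
  have hs : HasSum (fun n => C * ‖c n‖ * Real.exp (1 / 4 * t)) (C * ‖c‖ * Real.exp (1 / 4 * t)) :=
    ((lp_one_hasSum_norm c).mul_left C).mul_right _
  refine tsum_of_norm_bounded hs fun n => ?_
  rcases eq_or_ne n 0 with rfl | hn
  · simp [hc]
  rw [norm_smul, norm_mul, norm_mode, norm_pow, norm_mul, Complex.norm_I, one_mul,
    Complex.norm_intCast]
  have h1 : (1 : ℝ) ≤ |(n : ℝ)| := by exact_mod_cast Int.one_le_abs hn
  have h2 := h |(n : ℝ)| (abs_nonneg _)
  have h3 : Real.exp (|(n : ℝ)| * t / 2) ≤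
      Real.exp (-(|(n : ℝ)| * (η / 2 / 2))) * Real.exp (1 / 4 * t) := by
    rw [← Real.exp_add]
    refine Real.exp_le_exp.2 ?_
    nlinarith
  calc |(n : ℝ)| ^ j * Real.exp (|(n : ℝ)| * t / 2) * ‖c n t‖
      ≤ |(n : ℝ)| ^ j * (Real.exp (-(|(n : ℝ)| * (η / 2 / 2))) * Real.exp (1 / 4 * t)) * ‖c n‖ := by
        gcongr
        exact wiener_norm_apply_le c n t
    _ = (|(n : ℝ)| ^ j * Real.exp (-(|(n : ℝ)| * (η / 2 / 2)))) * ‖c n‖ * Real.exp (1 / 4 * t) := by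
        ring
    _ ≤ _ := by gcongr

theorem norm_phys_zero_le (c : Wiener V) {t : ℝ} (ht : t ≤ 0) (x : ℝ) :
    ‖phys 0 c t x‖ ≤ ‖c‖ := by
  refine tsum_of_norm_bounded (lp_one_hasSum_norm c) fun n => ?_
  rw [pow_zero, one_mul, norm_smul]
  exact (mul_le_mul (norm_mode_le_one n ht x) (wiener_norm_apply_le c n t) (norm_nonneg _)
    zero_le_one).trans (one_mul _).le

theorem norm_phys_zero_le_exp (c : Wiener V) (hc : c 0 = 0) {t : ℝ} (ht : t ≤ 0) (x : ℝ) :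
    ‖phys 0 c t x‖ ≤ ‖c‖ * Real.exp (t / 2) := by
  refine tsum_of_norm_bounded ((lp_one_hasSum_norm c).mul_right (Real.exp (t / 2))) fun n => ?_
  rcases eq_or_ne n 0 with rfl | hn
  · simp [hc]
  have h1 : (1 : ℝ) ≤ |(n : ℝ)| := by exact_mod_cast Int.one_le_abs hn
  rw [pow_zero, one_mul, norm_smul, norm_mode, mul_comm]
  refine mul_le_mul (wiener_norm_apply_le c n t) (Real.exp_le_exp.2 ?_) (Real.exp_pos _).le (norm_nonneg _)
  nlinarith

theorem phys_periodic (j : ℕ) (c : Wiener V) (t x : ℝ) :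
    phys j c t (x + 2 * Real.pi) = phys j c t x := by
  unfold phys
  congr 1; ext n
  have : mode n t (x + 2 * Real.pi) = mode n t x := by
    unfold mode
    rw [show ((|(n : ℝ)| : ℝ) : ℂ) * t / 2 + Complex.I * n * ((x + 2 * Real.pi : ℝ) : ℂ)
      = (|(n : ℝ)| * t / 2 + Complex.I * n * x) + n * (2 * Real.pi * Complex.I) by
        push_cast; ring]
    exact Complex.exp_periodic.int_mul n _
  rw [this]

end Wiener

section PhysDerivatives

open scoped BoundedContinuousFunction

variable {V Y : Type*} [NormedCommRing V] [NormedAlgebra ℂ V] [CompleteSpace V]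

theorem hasDerivAt_mode_x (n : ℤ) (t x : ℝ) :
    HasDerivAt (fun x => mode n t x) (Complex.I * n * mode n t x) x := by
  have h1 : HasDerivAt (fun x : ℝ => ((|(n : ℝ)| : ℝ) : ℂ) * t / 2 + Complex.I * n * (x : ℂ))
      (Complex.I * n) x := by
    simpa using ((Complex.ofRealCLM.hasDerivAt (x := x)).const_mul (Complex.I * n)).const_add
      (((|(n : ℝ)| : ℝ) : ℂ) * t / 2)
  have := h1.cexp
  rwa [mul_comm (Complex.exp _)] at this

theorem hasDerivAt_mode_t (n : ℤ) (t x : ℝ) :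
    HasDerivAt (fun t => mode n t x) (((|(n : ℝ)| / 2 : ℝ) : ℂ) * mode n t x) t := by
  have h1 : HasDerivAt (fun t : ℝ => ((|(n : ℝ)| : ℝ) : ℂ) * (t : ℂ) / 2 + Complex.I * n * x)
      ((|(n : ℝ)| / 2 : ℝ) : ℂ) t := by
    have := (((Complex.ofRealCLM.hasDerivAt (x := t)).const_mul ((|(n : ℝ)| : ℝ) : ℂ)).div_const
      2).add_const (Complex.I * n * x)
    simpa using this
  have := h1.cexp
  rwa [mul_comm (Complex.exp _)] at this

theorem hasDerivAt_term_x (j : ℕ) (n : ℤ) (t x : ℝ) (v : V) :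
    HasDerivAt (fun x => ((Complex.I * n) ^ j * mode n t x) • v)
      (((Complex.I * n) ^ (j + 1) * mode n t x) • v) x := by
  have := ((hasDerivAt_mode_x n t x).const_mul ((Complex.I * n) ^ j)).smul_const v
  rwa [← mul_assoc, ← pow_succ] at this

theorem hasDerivAt_term_t (j : ℕ) (n : ℤ) (t x : ℝ) {y : ℝ → V} {v : V}
    (h : HasDerivAt y (-((|(n : ℝ)| / 2 : ℝ) : ℂ) • y t + (Complex.I * n) • v) t) :
    HasDerivAt (fun t => ((Complex.I * n) ^ j * mode n t x) • y t)
      (((Complex.I * n) ^ (j + 1) * mode n t x) • v) t := by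
  have := ((hasDerivAt_mode_t n t x).const_mul ((Complex.I * n) ^ j)).smul h
  convert! this using 1
  generalize y t = w
  generalize ((|(n : ℝ)| / 2 : ℝ) : ℂ) = q
  rw [pow_succ]
  module

theorem hasDerivAt_phys_x (j : ℕ) (c : Wiener V) {t : ℝ} (ht : t < 0) (x : ℝ) :
    HasDerivAt (fun x => phys j c t x) (phys (j + 1) c t x) x := by
  obtain ⟨C, hC, h⟩ := exists_norm_phys_term_le (V := V) (j + 1) (neg_pos.2 ht)
  exact hasDerivAt_tsum (g := fun n x => ((Complex.I * n) ^ j * mode n t x) • c n t)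
    (g' := fun n x => ((Complex.I * n) ^ (j + 1) * mode n t x) • c n t)
    ((lp_one_hasSum_norm c).summable.mul_left C) (fun n y => hasDerivAt_term_x j n t y (c n t))
    (fun n y => h c n t (by simp) y) (summable_phys j c ht 0) x

theorem hasDerivAt_phys_t (j : ℕ) {c d : Wiener V}
    (hcd : ∀ n : ℤ, ∀ t < 0, HasDerivAt (c n)
      (-((|(n : ℝ)| / 2 : ℝ) : ℂ) • c n t + (Complex.I * n) • d n t) t)
    {t : ℝ} (ht : t < 0) (x : ℝ) :
    HasDerivAt (fun t => phys j c t x) (phys (j + 1) d t x) t := by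
  have ht2 : 0 < -(t / 2) := by linarith
  obtain ⟨C, hC, h⟩ := exists_norm_phys_term_le (V := V) (j + 1) ht2
  refine hasDerivAt_tsum_of_isPreconnected
    (g := fun n t => ((Complex.I * n) ^ j * mode n t x) • c n t)
    (g' := fun n t => ((Complex.I * n) ^ (j + 1) * mode n t x) • d n t) (t := Iio (t / 2))
    ((lp_one_hasSum_norm d).summable.mul_left C) isOpen_Iio isPreconnected_Iio
    (fun n y hy => ?_) (fun n y hy => h d n y (by simpa using hy.le) x)
    (y₀ := t) (mem_Iio.2 (by linarith)) (summable_phys j c ht x) (mem_Iio.2 (by linarith))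
  have hy0 : y < 0 := (mem_Iio.1 hy).trans (by linarith)
  exact hasDerivAt_term_t j n y x (hcd n y hy0)

theorem continuousOn_phys (j : ℕ) (c : Wiener V) :
    ContinuousOn (fun p : ℝ × ℝ => phys j c p.1 p.2) (Iio 0 ×ˢ univ) := by
  rintro ⟨t, x⟩ ⟨ht, -⟩
  have ht2 : 0 < -(t / 2) := by have : t < 0 := ht; linarith
  obtain ⟨C, hC, h⟩ := exists_norm_phys_term_le (V := V) j ht2
  have : ContinuousOn (fun p : ℝ × ℝ => phys j c p.1 p.2) (Iio (t / 2) ×ˢ univ) := by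
    refine continuousOn_tsum (fun n => Continuous.continuousOn ?_)
      ((lp_one_hasSum_norm c).summable.mul_left C) (fun n p hp => h c n p.1 (by
        simpa using (mem_Iio.1 hp.1).le) p.2)
    unfold mode
    have := (c n).continuous
    fun_prop
  refine (this.continuousAt ?_).continuousWithinAt
  exact (isOpen_Iio.prod isOpen_univ).mem_nhds ⟨mem_Iio.2 (by linarith), mem_univ _⟩

/-- A function with continuously differentiable partial derivatives. -/
theorem contDiffOn_succ_of_partial {k : ℕ} {F F₁ F₂ : ℝ × ℝ → V}
    (h1 : ∀ t < 0, ∀ x, HasDerivAt (fun t => F (t, x)) (F₁ (t, x)) t)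
    (h2 : ∀ t < 0, ∀ x, HasDerivAt (fun x => F (t, x)) (F₂ (t, x)) x)
    (c1 : ContDiffOn ℝ k F₁ (Iio 0 ×ˢ univ)) (c2 : ContDiffOn ℝ k F₂ (Iio 0 ×ˢ univ)) :
    ContDiffOn ℝ (k + 1 : ℕ) F (Iio 0 ×ˢ univ) := by
  have ho : IsOpen (Iio (0 : ℝ) ×ˢ (univ : Set ℝ)) := isOpen_Iio.prod isOpen_univ
  set L₁ : V →L[ℝ] (ℝ →L[ℝ] V) := ContinuousLinearMap.smulRightL ℝ ℝ V 1
  have hL₁ : ∀ v s, L₁ v s = s • v := fun v s => by simp [L₁]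
  have hmain : ∀ p ∈ Iio (0 : ℝ) ×ˢ (univ : Set ℝ),
      HasFDerivAt F ((L₁ (F₁ p)).coprod (L₁ (F₂ p))) p := by
    rintro ⟨t, x⟩ hp
    have := hasStrictFDerivAt_uncurry_coprod (𝕜 := ℝ) (f := fun t x => F (t, x)) (u := (t, x))
      (f₁ := fun t x => L₁ (F₁ (t, x))) (f₂ := fun t x => L₁ (F₂ (t, x))) ?_ ?_ ?_ ?_
    · exact this.hasFDerivAt
    · filter_upwards [ho.mem_nhds hp] with q hq
      have := (h1 q.1 hq.1 q.2).hasFDerivAt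
      convert! this using 1
    · filter_upwards [ho.mem_nhds hp] with q hq
      have := (h2 q.1 hq.1 q.2).hasFDerivAt
      convert! this using 1
    · exact L₁.continuous.continuousAt.comp (c1.continuousOn.continuousAt (ho.mem_nhds hp))
    · exact L₁.continuous.continuousAt.comp (c2.continuousOn.continuousAt (ho.mem_nhds hp))
  push_cast
  rw [contDiffOn_succ_iff_hasFDerivWithinAt_of_uniqueDiffOn ho.uniqueDiffOn]
  refine ⟨by simp, fun p => (L₁ (F₁ p)).coprod (L₁ (F₂ p)), ?_,
    fun p hp => (hmain p hp).hasFDerivWithinAt⟩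
  have e : (fun p => (L₁ (F₁ p)).coprod (L₁ (F₂ p))) = fun p =>
      (L₁ (F₁ p)).comp (ContinuousLinearMap.fst ℝ ℝ ℝ) + (L₁ (F₂ p)).comp
        (ContinuousLinearMap.snd ℝ ℝ ℝ) := by
    funext p; ext <;> simp
  rw [e]
  have hc1 := L₁.contDiff.comp_contDiffOn c1
  have hc2 := L₁.contDiff.comp_contDiffOn c2
  exact (hc1.clm_comp contDiffOn_const).add (hc2.clm_comp contDiffOn_const)

end PhysDerivatives

section Green

open scoped BoundedContinuousFunction

variable {V : Type*} [NormedCommRing V] [NormedAlgebra ℂ V] [CompleteSpace V]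

theorem exp_smul_mul_exp_smul (a : V) (s t : ℝ) :
    NormedSpace.exp (s • a) * NormedSpace.exp (t • a) = NormedSpace.exp ((s + t) • a) := by
  let _ : NormedAlgebra ℚ V := NormedAlgebra.restrictScalars ℚ ℂ V
  rw [← NormedSpace.exp_add, add_smul]

theorem hasDerivAt_exp_smul (a : V) (t : ℝ) :
    HasDerivAt (fun s : ℝ => NormedSpace.exp (s • a)) (a * NormedSpace.exp (t • a)) t :=
  hasDerivAt_exp_smul_const' a t

theorem continuous_exp_smul (a : V) : Continuous fun s : ℝ => NormedSpace.exp (s • a) :=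
  continuous_iff_continuousAt.2 fun t => (hasDerivAt_exp_smul a t).continuousAt

theorem exp_zero_smul (a : V) : NormedSpace.exp ((0 : ℝ) • a) = 1 := by
  rw [zero_smul, NormedSpace.exp_zero]

variable {a : V} {δ : ℝ}

theorem integral_exp_decay (hδ : 0 < δ) (t : ℝ) :
    IntegrableOn (fun s => Real.exp (-(δ * (t - s)))) (Iic t) ∧
      ∫ s in Iic t, Real.exp (-(δ * (t - s))) = 1 / δ := by
  have h : (fun s => Real.exp (-(δ * (t - s)))) =
      fun s => Real.exp (-(δ * t)) * Real.exp (δ * s) := by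
    funext s; rw [← Real.exp_add]; congr 1; ring
  rw [h]
  refine ⟨(integrableOn_exp_mul_Iic hδ t).const_mul _, ?_⟩
  rw [integral_const_mul, integral_exp_mul_Iic hδ, ← mul_div_assoc, ← Real.exp_add]
  simp

theorem norm_duhamel_le (ha : ∀ s : ℝ, 0 ≤ s → ‖NormedSpace.exp (s • a)‖ ≤ Real.exp (-(δ * s)))
    (F : ℝ →ᵇ V) {s t : ℝ} (hs : s ≤ t) :
    ‖NormedSpace.exp (t • a) * (NormedSpace.exp ((-s) • a) * F s)‖ ≤
      Real.exp (-(δ * (t - s))) * ‖F‖ := by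
  rw [← mul_assoc, exp_smul_mul_exp_smul, ← sub_eq_add_neg]
  exact (norm_mul_le _ _).trans (mul_le_mul (ha _ (sub_nonneg.2 hs)) (F.norm_coe_le_norm s)
    (norm_nonneg _) (Real.exp_pos _).le)

theorem integrableOn_duhamel_aux (hδ : 0 < δ)
    (ha : ∀ s : ℝ, 0 ≤ s → ‖NormedSpace.exp (s • a)‖ ≤ Real.exp (-(δ * s)))
    (F : ℝ →ᵇ V) (t : ℝ) :
    IntegrableOn (fun s => NormedSpace.exp (t • a) * (NormedSpace.exp ((-s) • a) * F s))
      (Iic t) := by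
  have hc : Continuous fun s => NormedSpace.exp (t • a) * (NormedSpace.exp ((-s) • a) * F s) :=
    continuous_const.mul (((continuous_exp_smul a).comp continuous_neg).mul F.continuous)
  refine Integrable.mono' ((integral_exp_decay hδ t).1.mul_const ‖F‖)
    hc.aestronglyMeasurable ?_
  filter_upwards [ae_restrict_mem measurableSet_Iic] with s hs
  exact norm_duhamel_le ha F hs

theorem integrableOn_duhamel (hδ : 0 < δ)
    (ha : ∀ s : ℝ, 0 ≤ s → ‖NormedSpace.exp (s • a)‖ ≤ Real.exp (-(δ * s)))
    (F : ℝ →ᵇ V) (t : ℝ) :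
    IntegrableOn (fun s => NormedSpace.exp ((-s) • a) * F s) (Iic t) := by
  have := (integrableOn_duhamel_aux hδ ha F t).const_mul (NormedSpace.exp ((-t) • a))
  refine this.congr (Filter.Eventually.of_forall fun s => ?_)
  show NormedSpace.exp ((-t) • a) * (NormedSpace.exp (t • a) *
    (NormedSpace.exp ((-s) • a) * F s)) = _
  rw [← mul_assoc, exp_smul_mul_exp_smul]
  simp [NormedSpace.exp_zero]

/-- The bounded solution of `y' = a y + F` when `exp (s a)` decays. -/
noncomputable def duhamel (a : V) (F : ℝ →ᵇ V) (t : ℝ) : V :=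
  NormedSpace.exp (t • a) * ∫ s in Iic t, NormedSpace.exp ((-s) • a) * F s

theorem hasDerivAt_duhamel (hδ : 0 < δ)
    (ha : ∀ s : ℝ, 0 ≤ s → ‖NormedSpace.exp (s • a)‖ ≤ Real.exp (-(δ * s)))
    (F : ℝ →ᵇ V) (t : ℝ) : HasDerivAt (duhamel a F) (a * duhamel a F t + F t) t := by
  have hc : Continuous fun s => NormedSpace.exp ((-s) • a) * F s :=
    ((continuous_exp_smul a).comp continuous_neg).mul F.continuous
  have h1 : HasDerivAt (fun t => ∫ s in Iic t, NormedSpace.exp ((-s) • a) * F s)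
      (NormedSpace.exp ((-t) • a) * F t) t := by
    have e : (fun t => ∫ s in Iic t, NormedSpace.exp ((-s) • a) * F s) = fun t =>
        (∫ s in (0 : ℝ)..t, NormedSpace.exp ((-s) • a) * F s) +
          ∫ s in Iic 0, NormedSpace.exp ((-s) • a) * F s := by
      funext t
      rw [← intervalIntegral.integral_Iic_sub_Iic (integrableOn_duhamel hδ ha F 0)
        (integrableOn_duhamel hδ ha F t), sub_add_cancel]
    rw [e]
    exact (intervalIntegral.integral_hasDerivAt_right (hc.intervalIntegrable _ _)
      (hc.stronglyMeasurableAtFilter _ _) hc.continuousAt).add_const _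
  have := (hasDerivAt_exp_smul a t).mul h1
  convert! this using 1
  rw [← mul_assoc, exp_smul_mul_exp_smul, add_neg_cancel, exp_zero_smul, one_mul, duhamel,
    mul_assoc]

theorem norm_duhamel_le_div (hδ : 0 < δ)
    (ha : ∀ s : ℝ, 0 ≤ s → ‖NormedSpace.exp (s • a)‖ ≤ Real.exp (-(δ * s)))
    (F : ℝ →ᵇ V) (t : ℝ) : ‖duhamel a F t‖ ≤ 1 / δ * ‖F‖ := by
  have e : duhamel a F t =
      ∫ s in Iic t, NormedSpace.exp (t • a) * (NormedSpace.exp ((-s) • a) * F s) :=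
    ((ContinuousLinearMap.mul ℂ V (NormedSpace.exp (t • a))).integral_comp_comm
      (integrableOn_duhamel hδ ha F t)).symm
  rw [e, ← (integral_exp_decay hδ t).2, ← integral_mul_const]
  refine norm_integral_le_of_norm_le ((integral_exp_decay hδ t).1.mul_const _) ?_
  filter_upwards [ae_restrict_mem measurableSet_Iic] with s hs
  exact norm_duhamel_le ha F hs

/-- Solution operator for `y' = a y + F` in bounded functions, stable case. -/
theorem exists_green_of_decay (hδ : 0 < δ)
    (ha : ∀ s : ℝ, 0 ≤ s → ‖NormedSpace.exp (s • a)‖ ≤ Real.exp (-(δ * s))) :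
    ∃ G : (ℝ →ᵇ V) →L[ℂ] (ℝ →ᵇ V), ‖G‖ ≤ 1 / δ ∧
      ∀ F t, HasDerivAt (G F) (a * G F t + F t) t := by
  have hcont : ∀ F : ℝ →ᵇ V, Continuous (duhamel a F) := fun F =>
    continuous_iff_continuousAt.2 fun t => (hasDerivAt_duhamel hδ ha F t).continuousAt
  let y : (ℝ →ᵇ V) → (ℝ →ᵇ V) := fun F =>
    BoundedContinuousFunction.ofNormedAddCommGroup (duhamel a F) (hcont F) (1 / δ * ‖F‖)
      (norm_duhamel_le_div hδ ha F)
  let L : (ℝ →ᵇ V) →ₗ[ℂ] (ℝ →ᵇ V) :=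
    { toFun := y
      map_add' := fun F G => by
        ext t
        show duhamel a (F + G) t = duhamel a F t + duhamel a G t
        simp only [duhamel, BoundedContinuousFunction.coe_add, Pi.add_apply, mul_add]
        rw [integral_add (integrableOn_duhamel hδ ha F t) (integrableOn_duhamel hδ ha G t),
          mul_add]
      map_smul' := fun z F => by
        ext t
        show duhamel a (z • F) t = z • duhamel a F t
        simp only [duhamel, BoundedContinuousFunction.coe_smul, mul_smul_comm]
        rw [integral_smul, mul_smul_comm] }
  refine ⟨L.mkContinuous (1 / δ) fun F => ?_, L.mkContinuous_norm_le (by positivity) _,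
    fun F t => hasDerivAt_duhamel hδ ha F t⟩
  exact (BoundedContinuousFunction.norm_le (by positivity)).2 (norm_duhamel_le_div hδ ha F)

/-- Time reversal of bounded functions. -/
noncomputable def reverse : (ℝ →ᵇ V) →L[ℂ] (ℝ →ᵇ V) :=
  LinearMap.mkContinuous
    { toFun := fun F => F.compContinuous ⟨fun t => -t, continuous_neg⟩
      map_add' := fun F G => rfl
      map_smul' := fun z F => rfl } 1 fun F => by
    rw [one_mul]
    exact (BoundedContinuousFunction.norm_le (norm_nonneg _)).2 fun t => F.norm_coe_le_norm (-t)

theorem reverse_apply (F : ℝ →ᵇ V) (t : ℝ) : reverse F t = F (-t) := rfl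

/-- Solution operator for `y' = a y + F` in bounded functions, unstable case. -/
theorem exists_green_of_growth (hδ : 0 < δ)
    (ha : ∀ s : ℝ, 0 ≤ s → ‖NormedSpace.exp (s • (-a))‖ ≤ Real.exp (-(δ * s))) :
    ∃ G : (ℝ →ᵇ V) →L[ℂ] (ℝ →ᵇ V), ‖G‖ ≤ 1 / δ ∧
      ∀ F t, HasDerivAt (G F) (a * G F t + F t) t := by
  obtain ⟨G, hG, h⟩ := exists_green_of_decay hδ ha
  have hr : ‖reverse (V := V)‖ ≤ 1 := LinearMap.mkContinuous_norm_le _ zero_le_one _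
  refine ⟨-(reverse.comp (G.comp reverse)), ?_, fun F t => ?_⟩
  · rw [norm_neg]
    calc _ ≤ ‖reverse (V := V)‖ * (‖G‖ * ‖reverse (V := V)‖) :=
          (ContinuousLinearMap.opNorm_comp_le _ _).trans
            (mul_le_mul_of_nonneg_left (ContinuousLinearMap.opNorm_comp_le _ _) (norm_nonneg _))
      _ ≤ 1 * (1 / δ * 1) := by gcongr
      _ = 1 / δ := by ring
  · have h1 := ((h (reverse F) (-t)).scomp t (hasDerivAt_neg t)).neg
    rw [reverse_apply, neg_neg] at h1
    convert! h1 using 1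
    show a * -(G (reverse F) (-t)) + F t = _
    simp [add_comm]

/-- A bounded ancient solution of a stable homogeneous equation vanishes. -/
theorem eq_zero_of_bounded_ancient {lam : ℂ} (hl : lam.re < 0) {e : ℝ → ℂ} {T C : ℝ}
    (he : ∀ t < T, HasDerivAt e (lam * e t) t) (hC : ∀ t < T, ‖e t‖ ≤ C) :
    ∀ t < T, e t = 0 := by
  have hconst : ∀ s < T, ∀ t < T,
      Complex.exp (-(lam * s)) * e s = Complex.exp (-(lam * t)) * e t := by
    have hd : ∀ t ∈ Iio T, HasDerivAt (fun t : ℝ => Complex.exp (-(lam * t)) * e t) 0 t := by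
      intro t ht
      have h1 : HasDerivAt (fun t : ℝ => -(lam * (t : ℂ))) (-lam) t := by
        have := (Complex.ofRealCLM.hasDerivAt (x := t)).const_mul (-lam)
        simpa using this
      convert! h1.cexp.mul (he t ht) using 1
      ring
    intro s hs t ht
    exact (isOpen_Iio.is_const_of_deriv_eq_zero isPreconnected_Iio
      (fun x hx => (hd x hx).differentiableAt.differentiableWithinAt)
      (fun x hx => (hd x hx).deriv) hs ht)
  intro t ht
  have hlim : Tendsto (fun s : ℝ => Real.exp (lam.re * (t - s)) * C) atBot (nhds 0) := by
    have : Tendsto (fun s : ℝ => lam.re * (t - s)) atBot atBot := by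
      refine Tendsto.const_mul_atTop_of_neg hl ?_
      exact tendsto_atTop_add_const_left atBot t tendsto_neg_atBot_atTop
    simpa using (Real.tendsto_exp_atBot.comp this).mul_const C
  have hle : ‖e t‖ ≤ 0 := by
    refine ge_of_tendsto hlim ?_
    filter_upwards [eventually_lt_atBot T] with s hs
    have h1 : e t = Complex.exp (lam * (t - s)) * e s := by
      have := congrArg (fun z => Complex.exp (lam * t) * z) (hconst s hs t ht)
      simp only [← mul_assoc, ← Complex.exp_add] at this
      rw [add_neg_cancel, Complex.exp_zero, one_mul] at this
      rw [← this]; congr 2; ring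
    rw [h1, norm_mul, Complex.norm_exp]
    have h2 : (lam * ((t : ℂ) - s)).re = lam.re * (t - s) := by
      rw [← Complex.ofReal_sub, Complex.re_mul_ofReal]
    rw [h2]
    exact mul_le_mul_of_nonneg_left (hC s hs) (Real.exp_pos _).le
  exact norm_le_zero_iff.1 hle

theorem eq_zero_of_bounded_entire {lam : ℂ} (hl : lam.re ≠ 0) {e : ℝ → ℂ} {C : ℝ}
    (he : ∀ t, HasDerivAt e (lam * e t) t) (hC : ∀ t, ‖e t‖ ≤ C) (t : ℝ) : e t = 0 := by
  rcases hl.lt_or_gt with h | h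
  · exact eq_zero_of_bounded_ancient h (T := t + 1) (fun t _ => he t) (fun t _ => hC t) t
      (by linarith)
  · have := eq_zero_of_bounded_ancient (lam := -lam) (by simpa using h) (T := -t + 1)
      (e := fun t => e (-t)) (C := C) (fun t _ => ?_) (fun t _ => hC _) (-t) (by linarith)
    · simpa using this
    · have h1 := (he (-t)).scomp t (hasDerivAt_neg t)
      convert! h1 using 1
      simp

/-- Diagonal solution operators. -/
theorem exists_diagonal_green {κ : ℝ} (hκ : 0 < κ) (a : ℤ → V)
    (ha : ∀ n : ℤ, n ≠ 0 → (∀ s : ℝ, 0 ≤ s → ‖NormedSpace.exp (s • a n)‖ ≤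
        Real.exp (-(κ * |(n : ℝ)| * s))) ∨
      (∀ s : ℝ, 0 ≤ s → ‖NormedSpace.exp (s • (-a n))‖ ≤ Real.exp (-(κ * |(n : ℝ)| * s)))) :
    ∃ A : Wiener V →L[ℂ] Wiener V, ‖A‖ ≤ 1 / κ ∧ (∀ c, A c 0 = 0) ∧
      ∀ c n t, HasDerivAt (A c n) (a n * A c n t - (Complex.I * n) • c n t) t := by
  have key : ∀ n : ℤ, ∃ G : (ℝ →ᵇ V) →L[ℂ] (ℝ →ᵇ V), ‖G‖ ≤ 1 / κ ∧ (n = 0 → G = 0) ∧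
      ∀ F t, HasDerivAt (G F) (a n * G F t - (Complex.I * n) • F t) t := by
    intro n
    rcases eq_or_ne n 0 with rfl | hn
    · refine ⟨0, by simpa using hκ.le, fun _ => rfl, fun F t => ?_⟩
      simp
    have hn1 : 0 < |(n : ℝ)| := abs_pos.2 (by exact_mod_cast hn)
    have : ∃ G : (ℝ →ᵇ V) →L[ℂ] (ℝ →ᵇ V), ‖G‖ ≤ 1 / (κ * |(n : ℝ)|) ∧
        ∀ F t, HasDerivAt (G F) (a n * G F t + F t) t := by
      rcases ha n hn with h | h
      · exact exists_green_of_decay (by positivity) h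
      · exact exists_green_of_growth (by positivity) h
    obtain ⟨G, hG, h⟩ := this
    refine ⟨(-(Complex.I * n)) • G, ?_, fun h => absurd h hn, fun F t => ?_⟩
    · rw [norm_smul, norm_neg, norm_mul, Complex.norm_I, one_mul, Complex.norm_intCast]
      calc _ ≤ |(n : ℝ)| * (1 / (κ * |(n : ℝ)|)) := by gcongr
        _ = 1 / κ := by field_simp
    · have h1 := (h F t).const_smul (-(Complex.I * n))
      convert! h1 using 1
      show a n * ((-(Complex.I * n)) • G F t) - _ = _
      rw [mul_smul_comm, smul_add, neg_smul (_ * _) (F t), sub_eq_add_neg]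
  choose G hG h0 h using key
  refine ⟨lp.mapCLM 1 G (by positivity) hG, lp.norm_mapCLM_le _ _ _ _, fun c => ?_,
    fun c n t => h n (c n) t⟩
  show G 0 (c 0) = 0
  rw [h0 0 rfl]; rfl

end Green

section Convolution

open scoped BoundedContinuousFunction

variable {V Y : Type*} [NormedCommRing V] [NormedAlgebra ℂ V] [CompleteSpace V]
  [NormedCommRing Y] [NormedAlgebra ℂ Y] [CompleteSpace Y]

/-- The defect of multiplicativity of the time weights of two modes. -/
noncomputable def weightDefect (m k : ℤ) (t : ℝ) : ℝ :=
  Real.exp ((|(m : ℝ)| + |(k : ℝ)| - |((m + k : ℤ) : ℝ)|) * min t 0 / 2)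

theorem weightDefect_le_one (m k : ℤ) (t : ℝ) : weightDefect m k t ≤ 1 := by
  rw [weightDefect, Real.exp_le_one_iff]
  have h1 : |((m + k : ℤ) : ℝ)| ≤ |(m : ℝ)| + |(k : ℝ)| := by push_cast; exact abs_add_le _ _
  nlinarith [min_le_right t 0]

theorem weightDefect_nonneg (m k : ℤ) (t : ℝ) : 0 ≤ weightDefect m k t := (Real.exp_pos _).le

theorem weightDefect_neg (m k : ℤ) (t : ℝ) : weightDefect (-m) (-k) t = weightDefect m k t := by
  unfold weightDefect
  rw [← neg_add]
  push_cast
  rw [abs_neg, abs_neg, abs_neg]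

theorem mode_add_mul_weightDefect (m k : ℤ) {t : ℝ} (ht : t < 0) (x : ℝ) :
    mode (m + k) t x * (weightDefect m k t : ℂ) = mode m t x * mode k t x := by
  unfold mode weightDefect
  rw [min_eq_left ht.le, Complex.ofReal_exp, ← Complex.exp_add, ← Complex.exp_add]
  congr 1
  push_cast
  ring

/-- The product of two coefficients, with the correction of the time weights. -/
noncomputable def coeffMul (m k : ℤ) (F G : ℝ →ᵇ V) : ℝ →ᵇ V :=
  BoundedContinuousFunction.ofNormedAddCommGroup
    (fun t => (weightDefect m k t : ℂ) • (F t * G t))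
    (by
      have h1 := F.continuous
      have h2 := G.continuous
      unfold weightDefect
      fun_prop)
    (‖F‖ * ‖G‖)
    (fun t => by
      rw [norm_smul, Complex.norm_real, Real.norm_of_nonneg (weightDefect_nonneg m k t)]
      calc _ ≤ 1 * (‖F t‖ * ‖G t‖) := by
            gcongr
            · exact weightDefect_le_one m k t
            · exact norm_mul_le _ _
        _ ≤ ‖F‖ * ‖G‖ := by
            rw [one_mul]
            gcongr
            · exact F.norm_coe_le_norm t
            · exact G.norm_coe_le_norm t)

theorem coeffMul_apply (m k : ℤ) (F G : ℝ →ᵇ V) (t : ℝ) :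
    coeffMul m k F G t = (weightDefect m k t : ℂ) • (F t * G t) := rfl

theorem norm_coeffMul_le (m k : ℤ) (F G : ℝ →ᵇ V) : ‖coeffMul m k F G‖ ≤ ‖F‖ * ‖G‖ :=
  BoundedContinuousFunction.norm_ofNormedAddCommGroup_le _ (by positivity) _

/-- The coefficients of a function with a single frequency. -/
noncomputable def wsingle (n : ℤ) (F : ℝ →ᵇ V) : Wiener V :=
  lp.single (E := fun _ : ℤ => ℝ →ᵇ V) 1 n F

theorem wsingle_self (n : ℤ) (F : ℝ →ᵇ V) : wsingle n F n = F :=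
  lp.single_apply_self (E := fun _ : ℤ => ℝ →ᵇ V) 1 n F

theorem wsingle_ne {n k : ℤ} (F : ℝ →ᵇ V) (hk : k ≠ n) : wsingle n F k = 0 :=
  lp.single_apply_ne (E := fun _ : ℤ => ℝ →ᵇ V) 1 n F hk

theorem norm_wsingle (n : ℤ) (F : ℝ →ᵇ V) : ‖wsingle n F‖ = ‖F‖ :=
  lp.norm_single (E := fun _ : ℤ => ℝ →ᵇ V) (by simp) n F

/-- The contribution of a pair of modes to the product. -/
noncomputable def convTerm (a b : Wiener V) (p : ℤ × ℤ) : Wiener V :=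
  wsingle (p.1 + p.2) (coeffMul p.1 p.2 (a p.1) (b p.2))

theorem norm_convTerm_le (a b : Wiener V) (p : ℤ × ℤ) :
    ‖convTerm a b p‖ ≤ ‖a p.1‖ * ‖b p.2‖ := by
  rw [convTerm, norm_wsingle]
  exact norm_coeffMul_le _ _ _ _

theorem hasSum_mul_prod {f g : ℤ → ℝ} {s t : ℝ} (hf : HasSum f s) (hg : HasSum g t)
    (hf0 : ∀ n, 0 ≤ f n) (hg0 : ∀ n, 0 ≤ g n) :
    HasSum (fun p : ℤ × ℤ => f p.1 * g p.2) (s * t) :=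
  hf.mul hg (hf.summable.mul_of_nonneg hg.summable hf0 hg0)

theorem hasSum_norm_mul_norm (a b : Wiener V) :
    HasSum (fun p : ℤ × ℤ => ‖a p.1‖ * ‖b p.2‖) (‖a‖ * ‖b‖) := by
  have ha := lp_one_hasSum_norm a
  have hb := lp_one_hasSum_norm b
  generalize ‖a‖ = s at ha ⊢
  generalize ‖b‖ = t at hb ⊢
  have h := hasSum_mul_prod (f := fun n => ‖a n‖) (g := fun n => ‖b n‖) ha hb
    (fun n => norm_nonneg (a n)) (fun n => norm_nonneg (b n))
  exact h

theorem summable_convTerm (a b : Wiener V) : Summable (convTerm a b) :=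
  Summable.of_norm_bounded (hasSum_norm_mul_norm a b).summable (norm_convTerm_le a b)

theorem wsingle_add (n : ℤ) (F G : ℝ →ᵇ V) : wsingle n (F + G) = wsingle n F + wsingle n G :=
  lp.single_add (E := fun _ : ℤ => ℝ →ᵇ V) 1 n F G

theorem wsingle_smul (n : ℤ) (z : ℂ) (F : ℝ →ᵇ V) : wsingle n (z • F) = z • wsingle n F :=
  lp.single_smul (E := fun _ : ℤ => ℝ →ᵇ V) 1 n z F

theorem convTerm_add_left (a a' b : Wiener V) (p : ℤ × ℤ) :
    convTerm (a + a') b p = convTerm a b p + convTerm a' b p := by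
  rw [convTerm, convTerm, convTerm, ← wsingle_add]
  congr 1
  ext t
  show (weightDefect p.1 p.2 t : ℂ) • ((a p.1 t + a' p.1 t) * b p.2 t) =
    (weightDefect p.1 p.2 t : ℂ) • (a p.1 t * b p.2 t) +
      (weightDefect p.1 p.2 t : ℂ) • (a' p.1 t * b p.2 t)
  rw [add_mul, smul_add]

theorem convTerm_add_right (a b b' : Wiener V) (p : ℤ × ℤ) :
    convTerm a (b + b') p = convTerm a b p + convTerm a b' p := by
  rw [convTerm, convTerm, convTerm, ← wsingle_add]
  congr 1
  ext t
  show (weightDefect p.1 p.2 t : ℂ) • (a p.1 t * (b p.2 t + b' p.2 t)) =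
    (weightDefect p.1 p.2 t : ℂ) • (a p.1 t * b p.2 t) +
      (weightDefect p.1 p.2 t : ℂ) • (a p.1 t * b' p.2 t)
  rw [mul_add, smul_add]

theorem convTerm_smul_left (z : ℂ) (a b : Wiener V) (p : ℤ × ℤ) :
    convTerm (z • a) b p = z • convTerm a b p := by
  rw [convTerm, convTerm, ← wsingle_smul]
  congr 1
  ext t
  show (weightDefect p.1 p.2 t : ℂ) • ((z • a p.1 t) * b p.2 t) =
    z • (weightDefect p.1 p.2 t : ℂ) • (a p.1 t * b p.2 t)
  rw [smul_mul_assoc, smul_comm]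

theorem convTerm_smul_right (z : ℂ) (a b : Wiener V) (p : ℤ × ℤ) :
    convTerm a (z • b) p = z • convTerm a b p := by
  rw [convTerm, convTerm, ← wsingle_smul]
  congr 1
  ext t
  show (weightDefect p.1 p.2 t : ℂ) • (a p.1 t * (z • b p.2 t)) =
    z • (weightDefect p.1 p.2 t : ℂ) • (a p.1 t * b p.2 t)
  rw [mul_smul_comm, smul_comm]

/-- The product of functions, on the side of coefficients. -/
noncomputable def conv : Wiener V →L[ℂ] Wiener V →L[ℂ] Wiener V :=
  LinearMap.mkContinuous₂
    (LinearMap.mk₂ ℂ (fun a b : Wiener V => ∑' p, convTerm a b p)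
      (fun a a' b => by
        simp only [convTerm_add_left]
        exact (summable_convTerm a b).tsum_add (summable_convTerm a' b))
      (fun z a b => by
        simp only [convTerm_smul_left]
        exact (summable_convTerm a b).tsum_const_smul z)
      (fun a b b' => by
        simp only [convTerm_add_right]
        exact (summable_convTerm a b).tsum_add (summable_convTerm a b'))
      (fun z a b => by
        simp only [convTerm_smul_right]
        exact (summable_convTerm a b).tsum_const_smul z))
    1 (fun a b => by
      rw [one_mul]
      exact tsum_of_norm_bounded (hasSum_norm_mul_norm a b) (norm_convTerm_le a b))

theorem conv_apply (a b : Wiener V) : conv a b = ∑' p, convTerm a b p := rfl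

theorem norm_conv_le (a b : Wiener V) : ‖conv a b‖ ≤ ‖a‖ * ‖b‖ :=
  tsum_of_norm_bounded (hasSum_norm_mul_norm a b) (norm_convTerm_le a b)

/-- Evaluation of a function at a point, as a continuous linear map of its coefficients. -/
noncomputable def physCLM {t : ℝ} (ht : t < 0) (x : ℝ) : Wiener V →L[ℂ] V :=
  LinearMap.mkContinuous
    { toFun := fun c => phys 0 c t x
      map_add' := fun a b => phys_add 0 a b ht x
      map_smul' := fun z a => phys_smul 0 z a ht x } 1 fun c => by
    rw [one_mul]
    exact norm_phys_zero_le c ht.le x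

theorem phys_single (n : ℤ) (F : ℝ →ᵇ V) (t x : ℝ) :
    phys 0 (wsingle n F) t x = mode n t x • F t := by
  unfold phys
  rw [tsum_eq_single n]
  · rw [wsingle_self, pow_zero, one_mul]
  · intro k hk
    rw [wsingle_ne F hk]
    simp

theorem phys_conv (a b : Wiener V) {t : ℝ} (ht : t < 0) (x : ℝ) :
    phys 0 (conv a b) t x = phys 0 a t x * phys 0 b t x := by
  have h1 : phys 0 (conv a b) t x = ∑' p, phys 0 (convTerm a b p) t x :=
    (physCLM (V := V) ht x).map_tsum (summable_convTerm a b)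
  have hn : ∀ c : Wiener V, Summable fun n : ℤ => ‖((Complex.I * n) ^ 0 * mode n t x) • c n t‖ := by
    intro c
    refine Summable.of_nonneg_of_le (fun _ => norm_nonneg _) (fun n => ?_)
      (lp_one_hasSum_norm c).summable
    rw [pow_zero, one_mul, norm_smul]
    exact (mul_le_mul (norm_mode_le_one n ht.le x) (wiener_norm_apply_le c n t) (norm_nonneg _)
      zero_le_one).trans (one_mul _).le
  rw [h1, phys, phys, tsum_mul_tsum_of_summable_norm (hn a) (hn b)]
  congr 1
  funext p
  rw [convTerm, phys_single, coeffMul_apply, smul_smul, mode_add_mul_weightDefect _ _ ht,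
    pow_zero, pow_zero, one_mul, one_mul, smul_mul_smul_comm]

theorem wmap_conv (L : V →L[ℂ] Y) (hL : ∀ a b, L (a * b) = L a * L b) (a b : Wiener V) :
    wmap L (conv a b) = conv (wmap L a) (wmap L b) := by
  rw [conv_apply, conv_apply, (wmap L).map_tsum (summable_convTerm a b)]
  congr 1
  funext p
  refine lp.ext (funext fun n => ?_)
  ext t
  rw [wmap_apply]
  unfold convTerm
  rcases eq_or_ne n (p.1 + p.2) with rfl | hn
  · rw [wsingle_self, wsingle_self, coeffMul_apply, coeffMul_apply, map_smul, hL]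
    rfl
  · rw [wsingle_ne _ hn, wsingle_ne _ hn]
    simp

theorem conv_apply_apply (a b : Wiener V) (n : ℤ) (t : ℝ) :
    conv a b n t = ∑' p : ℤ × ℤ, if n = p.1 + p.2 then
      (weightDefect p.1 p.2 t : ℂ) • (a p.1 t * b p.2 t) else 0 := by
  have h := ((BoundedContinuousFunction.evalCLM ℂ t).comp
    (lp.evalCLM ℂ (fun _ : ℤ => ℝ →ᵇ V) 1 n)).map_tsum (summable_convTerm a b)
  refine Eq.trans h ?_
  congr 1
  funext p
  show (convTerm a b p) n t = _
  unfold convTerm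
  split_ifs with hn
  · subst hn
    rw [wsingle_self, coeffMul_apply]
  · rw [wsingle_ne _ hn]
    rfl

/-- Two families of coefficients that represent complex conjugate functions. -/
def Conjugate (c d : Wiener ℂ) : Prop := ∀ n t, d (-n) t = starRingEnd ℂ (c n t)

theorem Conjugate.conv {a b c d : Wiener ℂ} (h : Conjugate a b) (h' : Conjugate c d) :
    Conjugate (conv a c) (conv b d) := by
  intro n t
  rw [conv_apply_apply, conv_apply_apply, Complex.conj_tsum, ← (Equiv.neg (ℤ × ℤ)).tsum_eq]
  congr 1
  funext p
  have e : (-n = -p.1 + -p.2) = (n = p.1 + p.2) := by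
    rw [← neg_add, neg_inj]
  simp only [Equiv.neg_apply, Prod.fst_neg, Prod.snd_neg, e, weightDefect_neg, h p.1 t, h' p.2 t]
  split_ifs <;> simp

theorem Conjugate.add {a b c d : Wiener ℂ} (h : Conjugate a b) (h' : Conjugate c d) :
    Conjugate (a + c) (b + d) := fun n t => by
  show b (-n) t + d (-n) t = starRingEnd ℂ (a n t + c n t)
  rw [h n t, h' n t, map_add]

theorem Conjugate.smul {a b : Wiener ℂ} (h : Conjugate a b) (z : ℂ) :
    Conjugate (z • a) (starRingEnd ℂ z • b) := fun n t => by
  show starRingEnd ℂ z * b (-n) t = starRingEnd ℂ (z * a n t)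
  rw [h n t, map_mul]

theorem Conjugate.sub {a b c d : Wiener ℂ} (h : Conjugate a b) (h' : Conjugate c d) :
    Conjugate (a - c) (b - d) := fun n t => by
  show b (-n) t - d (-n) t = starRingEnd ℂ (a n t - c n t)
  rw [h n t, h' n t, map_sub]

theorem Conjugate.symm {a b : Wiener ℂ} (h : Conjugate a b) : Conjugate b a := fun n t => by
  have := congrArg (starRingEnd ℂ) (h (-n) t)
  rw [neg_neg, Complex.conj_conj] at this
  exact this.symm

end Convolution

section SmoothCoefficients

open scoped BoundedContinuousFunction

variable {V Y : Type*} [NormedCommRing V] [NormedAlgebra ℂ V] [CompleteSpace V]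
  [NormedCommRing Y] [NormedAlgebra ℂ Y] [CompleteSpace Y]

theorem iteratedDeriv_phys (c : Wiener V) {t : ℝ} (ht : t < 0) (j : ℕ) :
    iteratedDeriv j (fun x => phys 0 c t x) = fun x => phys j c t x := by
  induction j with
  | zero => simp
  | succ j ih =>
    rw [iteratedDeriv_succ, ih]
    funext x
    exact (hasDerivAt_phys_x j c ht x).deriv

theorem contDiff_phys (c : Wiener V) {t : ℝ} (ht : t < 0) (n : ℕ) :
    ∀ j, ContDiff ℝ n (fun x => phys j c t x) := by
  induction n with
  | zero =>
    intro j
    exact contDiff_zero.2 (continuous_iff_continuousAt.2 fun x =>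
      (hasDerivAt_phys_x j c ht x).continuousAt)
  | succ n ih =>
    intro j
    push_cast
    refine contDiff_succ_iff_deriv.2 ⟨fun x => (hasDerivAt_phys_x j c ht x).differentiableAt,
      by simp, ?_⟩
    rw [show deriv (fun x => phys j c t x) = fun x => phys (j + 1) c t x from
      funext fun x => (hasDerivAt_phys_x j c ht x).deriv]
    exact ih (j + 1)

theorem phys_conv_leibniz (a b : Wiener V) {t : ℝ} (ht : t < 0) (x : ℝ) (j : ℕ) :
    phys j (conv a b) t x =
      ∑ i ∈ Finset.range (j + 1), (j.choose i : V) * phys i a t x * phys (j - i) b t x := by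
  have h := iteratedDeriv_fun_mul (n := j) (x := x) (contDiff_phys a ht j 0).contDiffAt
    (contDiff_phys b ht j 0).contDiffAt
  have e : (fun x => phys 0 a t x * phys 0 b t x) = fun x => phys 0 (conv a b) t x :=
    funext fun x => (phys_conv a b ht x).symm
  rw [e] at h
  simpa only [iteratedDeriv_phys _ ht] using h

/-- All the derivatives in `x` of the function with coefficients `c` are of class `C^k`. -/
def SmoothCoeff (k : ℕ) (c : Wiener V) : Prop :=
  ∀ j, ContDiffOn ℝ k (fun p : ℝ × ℝ => phys j c p.1 p.2) (Iio 0 ×ˢ univ)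

theorem SmoothCoeff.zero (c : Wiener V) : SmoothCoeff 0 c := fun j =>
  contDiffOn_zero.2 (continuousOn_phys j c)

theorem SmoothCoeff.add {k : ℕ} {a b : Wiener V} (ha : SmoothCoeff k a) (hb : SmoothCoeff k b) :
    SmoothCoeff k (a + b) := fun j =>
  ((ha j).add (hb j)).congr fun p hp => phys_add j a b hp.1 p.2

theorem SmoothCoeff.smul {k : ℕ} {a : Wiener V} (ha : SmoothCoeff k a) (z : ℂ) :
    SmoothCoeff k (z • a) := fun j =>
  ((ha j).const_smul z).congr fun p hp => phys_smul j z a hp.1 p.2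

theorem SmoothCoeff.wmap {k : ℕ} {a : Wiener V} (ha : SmoothCoeff k a) (L : V →L[ℂ] Y) :
    SmoothCoeff k (wmap L a) := fun j =>
  ((L.restrictScalars ℝ).contDiff.comp_contDiffOn (ha j)).congr fun p hp =>
    phys_wmap j L a hp.1 p.2

theorem SmoothCoeff.conv {k : ℕ} {a b : Wiener V} (ha : SmoothCoeff k a) (hb : SmoothCoeff k b) :
    SmoothCoeff k (conv a b) := fun j =>
  (ContDiffOn.sum fun i _ => (contDiffOn_const.mul (ha i)).mul (hb (j - i))).congr fun p hp =>
    phys_conv_leibniz a b hp.1 p.2 j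

theorem SmoothCoeff.succ {k : ℕ} {c d : Wiener V} (hc : SmoothCoeff k c) (hd : SmoothCoeff k d)
    (hcd : ∀ n : ℤ, ∀ t < 0, HasDerivAt (c n)
      (-((|(n : ℝ)| / 2 : ℝ) : ℂ) • c n t + (Complex.I * n) • d n t) t) :
    SmoothCoeff (k + 1) c := fun j =>
  contDiffOn_succ_of_partial (F₁ := fun p => phys (j + 1) d p.1 p.2)
    (F₂ := fun p => phys (j + 1) c p.1 p.2) (fun _ ht x => hasDerivAt_phys_t j hcd ht x)
    (fun _ ht x => hasDerivAt_phys_x j c ht x) (hd (j + 1)) (hc (j + 1))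

end SmoothCoefficients

section Characters

/-- The rectangle on which velocity profiles are extended holomorphically. -/
def velRect : Set ℂ := {z | |z.re| < 2 ∧ |z.im| < 1 / 4}

theorem isOpen_velRect : IsOpen velRect :=
  (isOpen_lt Complex.continuous_re.abs continuous_const).inter
    (isOpen_lt Complex.continuous_im.abs continuous_const)

theorem ofReal_mem_velRect {v : ℝ} (hv : |v| < 2) : (v : ℂ) ∈ velRect := by
  simpa [velRect] using hv

variable {V : Type*} [NormedCommRing V] [NormedAlgebra ℂ V] [CompleteSpace V]

/-- A Banach algebra of holomorphic functions on the rectangle: `E z` is the evaluation at `z`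
and `υ` the coordinate function. -/
structure HolomorphicAlgebra (E : ℂ → V →L[ℂ] ℂ) (υ : V) : Prop where
  differentiableOn : DifferentiableOn ℂ E velRect
  norm_eval_le : ∀ z ∈ velRect, ‖E z‖ ≤ 1
  eval_mul : ∀ z ∈ velRect, ∀ a b, E z (a * b) = E z a * E z b
  eval_one : ∀ z ∈ velRect, E z 1 = 1
  eval_coord : ∀ z ∈ velRect, E z υ = z
  norm_le : ∀ (a : V) (C : ℝ), (∀ z ∈ velRect, ‖E z a‖ ≤ C) → ‖a‖ ≤ C

namespace HolomorphicAlgebra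

variable {E : ℂ → V →L[ℂ] ℂ} {υ : V} (hE : HolomorphicAlgebra E υ)
include hE

theorem eval_exp {z : ℂ} (hz : z ∈ velRect) (a : V) :
    E z (NormedSpace.exp a) = Complex.exp (E z a) := by
  let _ : NormedAlgebra ℚ V := NormedAlgebra.restrictScalars ℚ ℂ V
  let φ : V →+* ℂ :=
    { toFun := E z
      map_one' := hE.eval_one z hz
      map_mul' := hE.eval_mul z hz
      map_zero' := map_zero _
      map_add' := map_add _ }
  rw [Complex.exp_eq_exp_ℂ]
  exact NormedSpace.map_exp φ (E z).continuous a

/-- Decay of the free transport semigroup. -/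
theorem norm_exp_transport_le (n : ℤ) (s : ℝ) (hs : 0 ≤ s) :
    ‖NormedSpace.exp (s • (-((Complex.I * n) • υ + ((|(n : ℝ)| / 2 : ℝ) : ℂ) • (1 : V))))‖ ≤
      Real.exp (-(1 / 4 * |(n : ℝ)| * s)) := by
  refine hE.norm_le _ _ fun z hz => ?_
  rw [hE.eval_exp hz, Complex.norm_exp, Real.exp_le_exp, ← Complex.coe_smul, map_smul, map_neg,
    map_add, map_smul, map_smul, hE.eval_one z hz, hE.eval_coord z hz]
  have h1 : ((s : ℂ) • -((Complex.I * n) • z + ((|(n : ℝ)| / 2 : ℝ) : ℂ) • (1 : ℂ))).re =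
      s * (n * z.im - |(n : ℝ)| / 2) := by
    simp only [smul_eq_mul, mul_one, Complex.ofReal_im, Complex.neg_re, Complex.add_re,
      Complex.ofReal_re, Complex.mul_re, Complex.mul_im, Complex.I_re, Complex.I_im,
      Complex.intCast_re, Complex.intCast_im]
    ring
  rw [h1]
  have h2 : (n : ℝ) * z.im ≤ |(n : ℝ)| * (1 / 4) :=
    (le_abs_self _).trans (by rw [abs_mul]; gcongr; exact hz.2.le)
  nlinarith [abs_nonneg (n : ℝ)]

theorem hasDerivAt_eval {z : ℂ} (hz : z ∈ velRect) : HasDerivAt E (deriv E z) z :=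
  (hE.differentiableOn.differentiableAt (isOpen_velRect.mem_nhds hz)).hasDerivAt

theorem hasDerivAt_eval_real {v : ℝ} (hv : |v| < 2) :
    HasDerivAt (fun v : ℝ => E (v : ℂ)) (deriv E (v : ℂ)) v := by
  have := (hE.hasDerivAt_eval (ofReal_mem_velRect hv)).scomp v
    (Complex.ofRealCLM.hasDerivAt (x := v))
  rwa [Complex.ofRealCLM_apply, Complex.ofReal_one, one_smul] at this

theorem hasDerivAt_eval_apply {v : ℝ} (hv : |v| < 2) (a : V) :
    HasDerivAt (fun v : ℝ => E (v : ℂ) a) (deriv E (v : ℂ) a) v :=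
  (((ContinuousLinearMap.apply ℂ ℂ a).restrictScalars ℝ).hasFDerivAt.comp_hasDerivAt v
    (hE.hasDerivAt_eval_real hv) :)

theorem norm_deriv_eval_le {v : ℝ} (hv : |v| ≤ 1) : ‖deriv E (v : ℂ)‖ ≤ 5 := by
  have hsub : Metric.closedBall (v : ℂ) (1 / 5) ⊆ velRect := by
    intro z hz
    rw [Metric.mem_closedBall, dist_eq_norm] at hz
    have h1 := (Complex.abs_re_le_norm (z - v)).trans hz
    have h2 := (Complex.abs_im_le_norm (z - v)).trans hz
    simp only [Complex.sub_re, Complex.sub_im, Complex.ofReal_re, Complex.ofReal_im,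
      sub_zero] at h1 h2
    refine ⟨?_, by linarith⟩
    calc |z.re| = |(z.re - v) + v| := by ring_nf
      _ ≤ |z.re - v| + |v| := abs_add_le _ _
      _ < 2 := by linarith
  have := Complex.norm_deriv_le_of_forall_mem_sphere_norm_le (f := E) (c := (v : ℂ)) (R := 1 / 5)
    (C := 1) (by norm_num) ((hE.differentiableOn.mono hsub).diffContOnCl_ball subset_rfl)
    (fun z hz => hE.norm_eval_le z (hsub (Metric.sphere_subset_closedBall hz)))
  linarith

theorem deriv_eval_mul {v : ℝ} (hv : |v| < 2) (a b : V) :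
    deriv E (v : ℂ) (a * b) = deriv E (v : ℂ) a * E v b + E v a * deriv E (v : ℂ) b := by
  have h1 := (hE.hasDerivAt_eval_apply hv a).mul (hE.hasDerivAt_eval_apply hv b)
  refine (hE.hasDerivAt_eval_apply hv (a * b)).unique (h1.congr_of_eventuallyEq ?_)
  filter_upwards [(isOpen_lt continuous_abs continuous_const).mem_nhds hv] with y hy
  exact hE.eval_mul _ (ofReal_mem_velRect hy) a b

theorem deriv_eval_one {v : ℝ} (hv : |v| < 2) : deriv E (v : ℂ) 1 = 0 := by
  refine (hE.hasDerivAt_eval_apply hv 1).unique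
    ((hasDerivAt_const v (1 : ℂ)).congr_of_eventuallyEq ?_)
  filter_upwards [(isOpen_lt continuous_abs continuous_const).mem_nhds hv] with y hy
  exact hE.eval_one _ (ofReal_mem_velRect hy)

theorem deriv_eval_coord {v : ℝ} (hv : |v| < 2) : deriv E (v : ℂ) υ = 1 := by
  refine (hE.hasDerivAt_eval_apply hv υ).unique
    ((Complex.ofRealCLM.hasDerivAt (x := v)).congr_of_eventuallyEq ?_)
  filter_upwards [(isOpen_lt continuous_abs continuous_const).mem_nhds hv] with y hy
  exact hE.eval_coord _ (ofReal_mem_velRect hy)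

/-- Conjugate profiles have conjugate derivatives. -/
theorem deriv_eval_conj {a b : V} (hab : ∀ v : ℝ, |v| < 2 → E v b = starRingEnd ℂ (E v a))
    {v : ℝ} (hv : |v| < 2) : deriv E (v : ℂ) b = starRingEnd ℂ (deriv E (v : ℂ) a) := by
  have h1 := Complex.conjCLE.toContinuousLinearMap.hasFDerivAt.comp_hasDerivAt v
    (hE.hasDerivAt_eval_apply hv a)
  refine (hE.hasDerivAt_eval_apply hv b).unique (h1.congr_of_eventuallyEq ?_)
  filter_upwards [(isOpen_lt continuous_abs continuous_const).mem_nhds hv] with y hy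
  exact hab y hy

theorem contDiffOn_eval : ContDiffOn ℝ (⊤ : ℕ∞) (fun v : ℝ => E (v : ℂ)) {v | |v| < 2} := by
  have h : ContDiffOn ℝ (⊤ : ℕ∞) E velRect :=
    (hE.differentiableOn.contDiffOn isOpen_velRect).restrict_scalars ℝ
  exact h.comp Complex.ofRealCLM.contDiff.contDiffOn fun v hv => ofReal_mem_velRect hv

theorem contDiffOn_deriv_eval :
    ContDiffOn ℝ (⊤ : ℕ∞) (fun v : ℝ => deriv E (v : ℂ)) {v | |v| < 2} := by
  have h : ContDiffOn ℝ (⊤ : ℕ∞) (deriv E) velRect :=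
    ((hE.differentiableOn.deriv isOpen_velRect).contDiffOn isOpen_velRect).restrict_scalars ℝ
  exact h.comp Complex.ofRealCLM.contDiff.contDiffOn fun v hv => ofReal_mem_velRect hv

end HolomorphicAlgebra

end Characters

section Moments

variable {V : Type*} [NormedCommRing V] [NormedAlgebra ℂ V] [CompleteSpace V]

/-- The moment of a velocity profile along the shear `U`. -/
noncomputable def moment (E : ℂ → V →L[ℂ] ℂ) (U κ : ℝ → ℝ) : V →L[ℂ] ℂ :=
  ∫ θ in (-1 : ℝ)..1, (κ θ : ℂ) • E (U θ)

/-- The moment of the derivative of a velocity profile along the shear `U`. -/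
noncomputable def dmoment (E : ℂ → V →L[ℂ] ℂ) (U κ : ℝ → ℝ) : V →L[ℂ] ℂ :=
  ∫ θ in (-1 : ℝ)..1, (κ θ : ℂ) • deriv E (U θ)

namespace HolomorphicAlgebra

variable {E : ℂ → V →L[ℂ] ℂ} {υ : V} (hE : HolomorphicAlgebra E υ) {U κ κ' : ℝ → ℝ}
  (hU : Continuous U) (hU1 : ∀ θ, |U θ| < 1) (hκ : Continuous κ) (hκ' : Continuous κ')
include hE hU hU1

theorem continuous_eval_shear : Continuous fun θ => E (U θ) :=
  hE.contDiffOn_eval.continuousOn.comp_continuous hU fun θ => (hU1 θ).trans one_lt_two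

theorem continuous_deriv_eval_shear : Continuous fun θ => deriv E (U θ : ℂ) :=
  hE.contDiffOn_deriv_eval.continuousOn.comp_continuous hU fun θ => (hU1 θ).trans one_lt_two

omit hE hU hU1 in
theorem abs_lt_two_of_lt_one {v : ℝ} (hv : |v| < 1) : |v| < 2 := hv.trans one_lt_two

include hκ

theorem moment_apply (a : V) : moment E U κ a = ∫ θ in (-1 : ℝ)..1, (κ θ : ℂ) * E (U θ) a := by
  have hc : Continuous fun θ => (κ θ : ℂ) • E (U θ) :=
    (Complex.continuous_ofReal.comp hκ).smul (hE.continuous_eval_shear hU hU1)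
  exact ContinuousLinearMap.intervalIntegral_apply (hc.intervalIntegrable _ _) a

theorem dmoment_apply (a : V) :
    dmoment E U κ a = ∫ θ in (-1 : ℝ)..1, (κ θ : ℂ) * deriv E (U θ) a := by
  have hc : Continuous fun θ => (κ θ : ℂ) • deriv E (U θ) :=
    (Complex.continuous_ofReal.comp hκ).smul (hE.continuous_deriv_eval_shear hU hU1)
  exact ContinuousLinearMap.intervalIntegral_apply (hc.intervalIntegrable _ _) a

theorem continuous_eval_apply (a : V) : Continuous fun θ => (κ θ : ℂ) * E (U θ) a :=
  (Complex.continuous_ofReal.comp hκ).mul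
    ((hE.continuous_eval_shear hU hU1).clm_apply continuous_const)

theorem continuous_deriv_eval_apply (a : V) : Continuous fun θ => (κ θ : ℂ) * deriv E (U θ) a :=
  (Complex.continuous_ofReal.comp hκ).mul
    ((hE.continuous_deriv_eval_shear hU hU1).clm_apply continuous_const)

theorem norm_moment_le : ‖moment E U κ‖ ≤ ∫ θ in (-1 : ℝ)..1, |κ θ| := by
  refine intervalIntegral.norm_integral_le_of_norm_le (by norm_num)
    (Eventually.of_forall fun θ _ => ?_) (hκ.abs.intervalIntegrable _ _)
  rw [norm_smul, Complex.norm_real, Real.norm_eq_abs]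
  exact (mul_le_mul_of_nonneg_left (hE.norm_eval_le _
    (ofReal_mem_velRect (abs_lt_two_of_lt_one (hU1 θ)))) (abs_nonneg _)).trans (mul_one _).le

theorem norm_dmoment_le : ‖dmoment E U κ‖ ≤ 5 * ∫ θ in (-1 : ℝ)..1, |κ θ| := by
  rw [← intervalIntegral.integral_const_mul]
  refine intervalIntegral.norm_integral_le_of_norm_le (by norm_num)
    (Eventually.of_forall fun θ _ => ?_) ((hκ.abs.const_mul 5).intervalIntegrable _ _)
  rw [norm_smul, Complex.norm_real, Real.norm_eq_abs, mul_comm]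
  exact mul_le_mul_of_nonneg_right (hE.norm_deriv_eval_le (hU1 θ).le) (abs_nonneg _)

omit hE hU hU1 in
theorem integral_abs_le_two (h1 : ∀ θ, |κ θ| ≤ 1) : ∫ θ in (-1 : ℝ)..1, |κ θ| ≤ 2 := by
  calc ∫ θ in (-1 : ℝ)..1, |κ θ| ≤ ∫ _ in (-1 : ℝ)..1, (1 : ℝ) :=
        intervalIntegral.integral_mono_on (by norm_num) (hκ.abs.intervalIntegrable _ _)
          (by simp) fun θ _ => h1 θ
    _ = 2 := by norm_num

theorem moment_coord_mul (a : V) : moment E U κ (υ * a) = moment E U (κ * U) a := by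
  rw [hE.moment_apply hU hU1 hκ, hE.moment_apply hU hU1 (hκ.mul hU)]
  congr 1; funext θ
  rw [hE.eval_mul _ (ofReal_mem_velRect (abs_lt_two_of_lt_one (hU1 θ))),
    hE.eval_coord _ (ofReal_mem_velRect (abs_lt_two_of_lt_one (hU1 θ)))]
  simp only [Pi.mul_apply]
  push_cast; ring

theorem dmoment_coord_mul (a : V) :
    dmoment E U κ (υ * a) = moment E U κ a + dmoment E U (κ * U) a := by
  rw [hE.moment_apply hU hU1 hκ, hE.dmoment_apply hU hU1 hκ, hE.dmoment_apply hU hU1 (hκ.mul hU),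
    ← intervalIntegral.integral_add
      ((hE.continuous_eval_apply hU hU1 hκ a).intervalIntegrable _ _)
      ((hE.continuous_deriv_eval_apply hU hU1 (hκ.mul hU) a).intervalIntegrable _ _)]
  congr 1; funext θ
  rw [hE.deriv_eval_mul (abs_lt_two_of_lt_one (hU1 θ)),
    hE.deriv_eval_coord (abs_lt_two_of_lt_one (hU1 θ)),
    hE.eval_coord _ (ofReal_mem_velRect (abs_lt_two_of_lt_one (hU1 θ)))]
  simp only [Pi.mul_apply]
  push_cast; ring

theorem moment_one : moment E U κ 1 = ((∫ θ in (-1 : ℝ)..1, κ θ : ℝ) : ℂ) := by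
  rw [hE.moment_apply hU hU1 hκ, ← intervalIntegral.integral_ofReal]
  congr 1; funext θ
  rw [hE.eval_one _ (ofReal_mem_velRect (abs_lt_two_of_lt_one (hU1 θ))), mul_one]

theorem dmoment_one : dmoment E U κ 1 = 0 := by
  rw [hE.dmoment_apply hU hU1 hκ]
  simp [fun θ => hE.deriv_eval_one (abs_lt_two_of_lt_one (hU1 θ))]

theorem moment_conj {a b : V} (hab : ∀ v : ℝ, |v| < 2 → E v b = starRingEnd ℂ (E v a)) :
    moment E U κ b = starRingEnd ℂ (moment E U κ a) := by
  rw [hE.moment_apply hU hU1 hκ, hE.moment_apply hU hU1 hκ,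
    ← intervalIntegral.intervalIntegral_conj]
  congr 1; funext θ
  rw [hab _ (abs_lt_two_of_lt_one (hU1 θ))]
  simp

theorem dmoment_conj {a b : V} (hab : ∀ v : ℝ, |v| < 2 → E v b = starRingEnd ℂ (E v a)) :
    dmoment E U κ b = starRingEnd ℂ (dmoment E U κ a) := by
  rw [hE.dmoment_apply hU hU1 hκ, hE.dmoment_apply hU hU1 hκ,
    ← intervalIntegral.intervalIntegral_conj]
  congr 1; funext θ
  rw [hE.deriv_eval_conj hab (abs_lt_two_of_lt_one (hU1 θ))]
  simp

include hκ'

theorem moment_sub : moment E U (κ - κ') = moment E U κ - moment E U κ' := by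
  ext a
  rw [_root_.sub_apply, hE.moment_apply hU hU1 hκ, hE.moment_apply hU hU1 hκ',
    hE.moment_apply hU hU1 (hκ.sub hκ'), ← intervalIntegral.integral_sub
      ((hE.continuous_eval_apply hU hU1 hκ a).intervalIntegrable _ _)
      ((hE.continuous_eval_apply hU hU1 hκ' a).intervalIntegrable _ _)]
  congr 1; funext θ
  simp only [Pi.sub_apply]
  push_cast; ring

theorem dmoment_sub : dmoment E U (κ - κ') = dmoment E U κ - dmoment E U κ' := by
  ext a
  rw [_root_.sub_apply, hE.dmoment_apply hU hU1 hκ, hE.dmoment_apply hU hU1 hκ',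
    hE.dmoment_apply hU hU1 (hκ.sub hκ'), ← intervalIntegral.integral_sub
      ((hE.continuous_deriv_eval_apply hU hU1 hκ a).intervalIntegrable _ _)
      ((hE.continuous_deriv_eval_apply hU hU1 hκ' a).intervalIntegrable _ _)]
  congr 1; funext θ
  simp only [Pi.sub_apply]
  push_cast; ring

end HolomorphicAlgebra

end Moments

section FixedPoint

open scoped BoundedContinuousFunction

variable {V : Type*} [NormedCommRing V] [NormedAlgebra ℂ V] [CompleteSpace V]

/-- The first three powers of a function, on the side of coefficients. -/
noncomputable def powers (w : Wiener V) : Wiener V × Wiener V × Wiener V :=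
  (w, conv w w, conv w (conv w w))

theorem norm_sq_sub_le {r : ℝ} {w w' : Wiener V} (h : ‖w‖ ≤ r) (h' : ‖w'‖ ≤ r) :
    ‖conv w w - conv w' w'‖ ≤ 2 * r * ‖w - w'‖ := by
  have e : conv w w - conv w' w' = conv w (w - w') + conv (w - w') w' := by
    rw [map_sub (conv w), map_sub conv, _root_.sub_apply]; abel
  rw [e]
  have h1 := norm_conv_le w (w - w')
  have h2 := norm_conv_le (w - w') w'
  have h3 := norm_add_le (conv w (w - w')) (conv (w - w') w')
  have := norm_nonneg (w - w')
  nlinarith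

theorem norm_cube_sub_le {r : ℝ} {w w' : Wiener V} (h : ‖w‖ ≤ r) (h' : ‖w'‖ ≤ r) :
    ‖conv w (conv w w) - conv w' (conv w' w')‖ ≤ 3 * r ^ 2 * ‖w - w'‖ := by
  have e : conv w (conv w w) - conv w' (conv w' w') =
      conv w (conv w w - conv w' w') + conv (w - w') (conv w' w') := by
    rw [map_sub (conv w), map_sub conv, _root_.sub_apply]; abel
  rw [e]
  have h1 := norm_conv_le w (conv w w - conv w' w')
  have h2 := norm_conv_le (w - w') (conv w' w')
  have h3 := norm_add_le (conv w (conv w w - conv w' w')) (conv (w - w') (conv w' w'))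
  have h4 := norm_sq_sub_le h h'
  have h5 := norm_conv_le w' w'
  have h0 := norm_nonneg (w - w')
  have hr := (norm_nonneg w).trans h
  have h6 : ‖w‖ * ‖conv w w - conv w' w'‖ ≤ r * (2 * r * ‖w - w'‖) := by gcongr
  have h7 : ‖w - w'‖ * ‖conv w' w'‖ ≤ ‖w - w'‖ * (r * r) := by
    gcongr; exact h5.trans (by gcongr)
  nlinarith

theorem exists_cubic_fixedPoint {F : Wiener V × Wiener V × Wiener V → Wiener V} {S : Wiener V}
    {r l₁ l₂ l₃ : ℝ} (hl₂ : 0 ≤ l₂) (hl₃ : 0 ≤ l₃)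
    (hsub : ∀ x y, F x - F y = F (x - y))
    (hF : ∀ x, ‖F x‖ ≤ l₁ * ‖x.1‖ + l₂ * ‖x.2.1‖ + l₃ * ‖x.2.2‖) (hr : 0 ≤ r)
    (hS : ‖S‖ ≤ r / 2) (hl : l₁ + 2 * r * l₂ + 3 * r ^ 2 * l₃ ≤ 1 / 2) {K : Set (Wiener V)}
    (hK : IsClosed K) (h0 : (0 : Wiener V) ∈ K) (hKF : ∀ w ∈ K, S + F (powers w) ∈ K) :
    ∃ w ∈ K, ‖w‖ ≤ r ∧ S + F (powers w) = w := by
  have key : ∀ w w' : Wiener V, ‖w‖ ≤ r → ‖w'‖ ≤ r →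
      ‖F (powers w) - F (powers w')‖ ≤ 1 / 2 * ‖w - w'‖ := by
    intro w w' h h'
    rw [hsub]
    refine (hF _).trans ?_
    have h2 := norm_sq_sub_le h h'
    have h3 := norm_cube_sub_le h h'
    calc l₁ * ‖w - w'‖ + l₂ * ‖conv w w - conv w' w'‖ +
          l₃ * ‖conv w (conv w w) - conv w' (conv w' w')‖
        ≤ l₁ * ‖w - w'‖ + l₂ * (2 * r * ‖w - w'‖) + l₃ * (3 * r ^ 2 * ‖w - w'‖) := by gcongr
      _ = (l₁ + 2 * r * l₂ + 3 * r ^ 2 * l₃) * ‖w - w'‖ := by ring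
      _ ≤ _ := by gcongr
  have hp0 : F (powers 0) = 0 := by
    have : powers (0 : Wiener V) = 0 := by simp [powers]
    rw [this]
    have := hsub 0 0
    simpa using this.symm
  have hmaps : MapsTo (fun w => S + F (powers w)) (K ∩ Metric.closedBall 0 r)
      (K ∩ Metric.closedBall 0 r) := by
    rintro w ⟨hw, hwr⟩
    rw [mem_closedBall_zero_iff] at hwr
    refine ⟨hKF w hw, ?_⟩
    have := key w 0 hwr (by simpa using hr)
    rw [hp0, sub_zero, sub_zero] at this
    rw [mem_closedBall_zero_iff]
    have h3 := norm_add_le S (F (powers w))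
    linarith
  have hcontr : ContractingWith (1 / 2 : NNReal)
      (hmaps.restrict (fun w => S + F (powers w)) _ _) := by
    refine ⟨by rw [← NNReal.coe_lt_coe]; norm_num, LipschitzWith.of_dist_le_mul ?_⟩
    rintro ⟨w, hw⟩ ⟨w', hw'⟩
    rw [Subtype.dist_eq, Subtype.dist_eq, dist_eq_norm, dist_eq_norm]
    have := key w w' (mem_closedBall_zero_iff.1 hw.2) (mem_closedBall_zero_iff.1 hw'.2)
    simpa using this
  obtain ⟨w, hw, hfix, -⟩ := hcontr.exists_fixedPoint'
    (hK.inter Metric.isClosed_closedBall).isComplete hmaps (x := 0)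
    ⟨h0, by simpa using hr⟩ (edist_ne_top _ _)
  exact ⟨w, hw.1, mem_closedBall_zero_iff.1 hw.2, hfix⟩

theorem conjugate_of_ode {b b' c d : Wiener ℂ} {lam : ℤ → ℂ} (hlam : ∀ n ≠ 0, (lam n).re ≠ 0)
    (hb0 : b 0 = 0) (hb0' : b' 0 = 0)
    (hb : ∀ n t, HasDerivAt (b n) (lam n * b n t - (Complex.I * n) • c n t) t)
    (hb' : ∀ n t, HasDerivAt (b' n)
      (starRingEnd ℂ (lam (-n)) * b' n t - (Complex.I * n) • d n t) t)
    (hcd : Conjugate c d) : Conjugate b b' := by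
  intro n t
  rcases eq_or_ne n 0 with rfl | hn
  · rw [neg_zero, hb0, hb0']; simp
  rw [← sub_eq_zero]
  refine eq_zero_of_bounded_entire (lam := starRingEnd ℂ (lam n))
    (e := fun t => b' (-n) t - starRingEnd ℂ (b n t)) (C := ‖b' (-n)‖ + ‖b n‖)
    (by simpa using hlam n hn) (fun t => ?_) (fun t => ?_) t
  · have h1 := hb' (-n) t
    have h2 := (hb n t).star
    refine (h1.sub h2).congr_deriv ?_
    rw [neg_neg, hcd n t]
    simp only [RCLike.star_def, map_sub, map_mul, smul_eq_mul, Complex.conj_I, Int.cast_neg,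
      map_intCast]
    ring
  · refine (norm_sub_le _ _).trans ?_
    rw [RCLike.norm_conj]
    exact add_le_add (wiener_norm_apply_le b' (-n) t) (wiener_norm_apply_le b n t)

/-- The family of coefficients of a function whose values are real on the real axis. -/
def RealProfile (E : ℂ → V →L[ℂ] ℂ) (w : Wiener V) : Prop :=
  ∀ (n : ℤ) (t : ℝ), ∀ v : ℝ, |v| < 2 → E v (w (-n) t) = starRingEnd ℂ (E v (w n t))

theorem isClosed_realProfile (E : ℂ → V →L[ℂ] ℂ) : IsClosed {w : Wiener V | RealProfile E w} := by
  have hc : ∀ (n : ℤ) (t v : ℝ), Continuous fun w : Wiener V => E v (w n t) := fun n t v =>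
    ((E v).comp ((BoundedContinuousFunction.evalCLM ℂ t).comp
      (lp.evalCLM ℂ (fun _ : ℤ => ℝ →ᵇ V) 1 n))).continuous
  simp only [RealProfile, Set.ofPred_forall]
  exact isClosed_iInter fun n => isClosed_iInter fun t => isClosed_iInter fun v =>
    isClosed_iInter fun _ => isClosed_eq (hc _ _ _) (Complex.continuous_conj.comp (hc _ _ _))

theorem RealProfile.zero (E : ℂ → V →L[ℂ] ℂ) : RealProfile E 0 := fun n t v _ => by
  show E v 0 = starRingEnd ℂ (E v 0)
  simp

theorem RealProfile.add {E : ℂ → V →L[ℂ] ℂ} {w w' : Wiener V} (h : RealProfile E w)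
    (h' : RealProfile E w') : RealProfile E (w + w') := fun n t v hv => by
  show E v (w (-n) t + w' (-n) t) = starRingEnd ℂ (E v (w n t + w' n t))
  rw [map_add, map_add, map_add, h n t v hv, h' n t v hv]

theorem RealProfile.smul {E : ℂ → V →L[ℂ] ℂ} {w : Wiener V} (h : RealProfile E w) (z : ℝ) :
    RealProfile E ((z : ℂ) • w) := fun n t v hv => by
  show E v ((z : ℂ) • w (-n) t) = starRingEnd ℂ (E v ((z : ℂ) • w n t))
  rw [map_smul, map_smul, smul_eq_mul, smul_eq_mul, map_mul, h n t v hv, Complex.conj_ofReal]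

namespace HolomorphicAlgebra

variable {E : ℂ → V →L[ℂ] ℂ} {υ : V} (hE : HolomorphicAlgebra E υ) {U κ : ℝ → ℝ}
include hE

theorem realProfile_conv {w w' : Wiener V} (h : RealProfile E w) (h' : RealProfile E w') :
    RealProfile E (conv w w') := fun n t v hv => by
  have e := wmap_conv (E v) (hE.eval_mul v (ofReal_mem_velRect hv)) w w'
  have hc : Conjugate (wmap (E v) (conv w w')) (wmap (E v) (conv w w')) := by
    rw [e]
    exact Conjugate.conv (fun n t => h n t v hv) (fun n t => h' n t v hv)
  exact hc n t

theorem realProfile_const {c : Wiener ℂ} (hc : Conjugate c c) :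
    RealProfile E (wmap ((ContinuousLinearMap.id ℂ ℂ).smulRight (1 : V)) c) := fun n t v hv => by
  show E v (c (-n) t • (1 : V)) = starRingEnd ℂ (E v (c n t • (1 : V)))
  rw [map_smul, map_smul, hE.eval_one _ (ofReal_mem_velRect hv), hc n t]
  simp

theorem norm_one_le : ‖(1 : V)‖ ≤ 1 := hE.norm_le _ _ fun z hz => by simp [hE.eval_one z hz]

theorem norm_const_le (c : Wiener ℂ) :
    ‖wmap ((ContinuousLinearMap.id ℂ ℂ).smulRight (1 : V)) c‖ ≤ ‖c‖ := by
  refine (norm_wmap_le _ _).trans ?_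
  have h1 : ‖(ContinuousLinearMap.id ℂ ℂ).smulRight (1 : V)‖ ≤ 1 := by
    refine ContinuousLinearMap.opNorm_le_bound _ zero_le_one fun z => ?_
    rw [ContinuousLinearMap.smulRight_apply, norm_smul, one_mul, ContinuousLinearMap.id_apply]
    exact mul_le_of_le_one_right (norm_nonneg _) hE.norm_one_le
  exact mul_le_of_le_one_left (norm_nonneg _) h1

variable (hU : Continuous U) (hU1 : ∀ θ, |U θ| < 1) (hκ : Continuous κ)
include hU hU1 hκ

theorem conjugate_moment {w : Wiener V} (h : RealProfile E w) :
    Conjugate (wmap (moment E U κ) w) (wmap (moment E U κ) w) := fun n t =>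
  hE.moment_conj hU hU1 hκ fun v hv => h n t v hv

theorem conjugate_dmoment {w : Wiener V} (h : RealProfile E w) :
    Conjugate (wmap (dmoment E U κ) w) (wmap (dmoment E U κ) w) := fun n t =>
  hE.dmoment_conj hU hU1 hκ fun v hv => h n t v hv

theorem norm_wmap_moment_le (w : Wiener V) {η : ℝ} (hη : ∫ θ in (-1 : ℝ)..1, |κ θ| ≤ η) :
    ‖wmap (moment E U κ) w‖ ≤ η * ‖w‖ :=
  (norm_wmap_le _ _).trans (mul_le_mul_of_nonneg_right
    ((hE.norm_moment_le hU hU1 hκ).trans hη) (norm_nonneg _))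

theorem norm_wmap_dmoment_le (w : Wiener V) {η : ℝ} (hη : ∫ θ in (-1 : ℝ)..1, |κ θ| ≤ η) :
    ‖wmap (dmoment E U κ) w‖ ≤ 5 * η * ‖w‖ :=
  (norm_wmap_le _ _).trans (mul_le_mul_of_nonneg_right
    ((hE.norm_dmoment_le hU hU1 hκ).trans (by gcongr)) (norm_nonneg _))

end HolomorphicAlgebra

end FixedPoint

section Wave

open scoped BoundedContinuousFunction

variable {V : Type*} [NormedCommRing V] [NormedAlgebra ℂ V] [CompleteSpace V]

/-- The embedding of scalar functions into functions with values in `V`. -/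
noncomputable def wconst : Wiener ℂ →L[ℂ] Wiener V :=
  wmap ((ContinuousLinearMap.id ℂ ℂ).smulRight (1 : V))

/-- The part of the pressure that is small on small profiles. -/
noncomputable def pressureRem (E : ℂ → V →L[ℂ] ℂ) (U : ℝ → ℝ)
    (x : Wiener V × Wiener V × Wiener V) : Wiener ℂ :=
  -((1 / 2 : ℝ) : ℂ) • wmap (dmoment E U (U * U - 1)) x.1
    - ((1 / 2 : ℝ) : ℂ) • wmap (moment E U 1) x.2.1
    - ((1 / 2 : ℝ) : ℂ) • wmap (dmoment E U U) x.2.1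
    - ((1 / 6 : ℝ) : ℂ) • wmap (dmoment E U 1) x.2.2

/-- The remainder in the evolution of the mean velocity. -/
noncomputable def massRem (E : ℂ → V →L[ℂ] ℂ) (U : ℝ → ℝ)
    (x : Wiener V × Wiener V × Wiener V) : Wiener ℂ :=
  ((2 : ℝ) : ℂ) • pressureRem E U x + ((1 / 2 : ℝ) : ℂ) • wmap (moment E U 1) x.2.1

/-- The remainder in the evolution of the flux. -/
noncomputable def fluxRem (E : ℂ → V →L[ℂ] ℂ) (U : ℝ → ℝ)
    (x : Wiener V × Wiener V × Wiener V) : Wiener ℂ :=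
  wmap (moment E U (U * U - 1)) x.1 + ((1 / 2 : ℝ) : ℂ) • wmap (moment E U U) x.2.1

theorem pressureRem_sub (E : ℂ → V →L[ℂ] ℂ) (U : ℝ → ℝ) (x y : Wiener V × Wiener V × Wiener V) :
    pressureRem E U x - pressureRem E U y = pressureRem E U (x - y) := by
  simp only [pressureRem, Prod.fst_sub, Prod.snd_sub, map_sub, smul_sub]
  abel

theorem massRem_sub (E : ℂ → V →L[ℂ] ℂ) (U : ℝ → ℝ) (x y : Wiener V × Wiener V × Wiener V) :
    massRem E U x - massRem E U y = massRem E U (x - y) := by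
  simp only [massRem, ← pressureRem_sub, Prod.fst_sub, Prod.snd_sub, map_sub, smul_sub]
  abel

theorem fluxRem_sub (E : ℂ → V →L[ℂ] ℂ) (U : ℝ → ℝ) (x y : Wiener V × Wiener V × Wiener V) :
    fluxRem E U x - fluxRem E U y = fluxRem E U (x - y) := by
  simp only [fluxRem, Prod.fst_sub, Prod.snd_sub, map_sub, smul_sub]
  abel

/-- The amplitude of the growing mode. -/
noncomputable def seed (a : ℝ) : ℝ →ᵇ ℂ :=
  BoundedContinuousFunction.ofNormedAddCommGroup
    (fun t => ((a * Real.exp (min t 0 / 2) : ℝ) : ℂ)) (by fun_prop) |a| fun t => by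
      rw [Complex.norm_real, norm_mul, Real.norm_eq_abs, Real.norm_of_nonneg (Real.exp_pos _).le]
      refine mul_le_of_le_one_right (abs_nonneg _) (Real.exp_le_one_iff.2 ?_)
      linarith [min_le_right t 0]

theorem seed_apply (a t : ℝ) : seed a t = ((a * Real.exp (min t 0 / 2) : ℝ) : ℂ) := rfl

theorem norm_seed_le {a : ℝ} (ha : 0 ≤ a) : ‖seed a‖ ≤ a :=
  (BoundedContinuousFunction.norm_ofNormedAddCommGroup_le _ (abs_nonneg _) _).trans
    (abs_of_nonneg ha).le

theorem hasDerivAt_seed (a : ℝ) {t : ℝ} (ht : t < 0) :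
    HasDerivAt (seed a) ((1 / 2 : ℂ) * seed a t) t := by
  have h1 : HasDerivAt (fun t : ℝ => a * Real.exp (t / 2)) (a * (Real.exp (t / 2) * (1 / 2))) t :=
    (((hasDerivAt_id t).div_const 2).exp.const_mul a)
  have h2 := h1.ofReal_comp
  have h3 : (seed a : ℝ → ℂ) =ᶠ[nhds t] fun t => ((a * Real.exp (t / 2) : ℝ) : ℂ) := by
    filter_upwards [Iio_mem_nhds ht] with s hs
    rw [seed_apply, min_eq_left (le_of_lt hs)]
  refine (h2.congr_of_eventuallyEq h3).congr_deriv ?_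
  rw [seed_apply, min_eq_left ht.le]
  push_cast
  ring

/-- Coefficients `w` of a velocity perturbation, `p` of the pressure and `f`, `g` of the
diagonalised mean velocity and flux, which solve the evolution equations for negative times. -/
structure Wave (E : ℂ → V →L[ℂ] ℂ) (υ : V) (U : ℝ → ℝ) (a : ℝ) (w : Wiener V)
    (f g p : Wiener ℂ) : Prop where
  zero_w : w 0 = 0
  zero_f : f 0 = 0
  zero_g : g 0 = 0
  ode_w : ∀ (n : ℤ) (t : ℝ), HasDerivAt (w n)
    (-((Complex.I * n) • υ + ((|(n : ℝ)| / 2 : ℝ) : ℂ) • (1 : V)) * w n t -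
      (Complex.I * n) • (wconst p + ((1 / 2 : ℝ) : ℂ) • conv w w : Wiener V) n t) t
  ode_f : ∀ (n : ℤ), ∀ t < 0, HasDerivAt (f n) (((n - |(n : ℝ)| / 2 : ℝ) : ℂ) * f n t -
      (Complex.I * n) • (massRem E U (powers w) + Complex.I • fluxRem E U (powers w)) n t) t
  ode_g : ∀ (n : ℤ), ∀ t < 0, HasDerivAt (g n) (((-n - |(n : ℝ)| / 2 : ℝ) : ℂ) * g n t -
      (Complex.I * n) • (massRem E U (powers w) - Complex.I • fluxRem E U (powers w)) n t) t
  pressure : p = (Complex.I * ((1 / 2 : ℝ) : ℂ)) • (f - g) + pressureRem E U (powers w)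
  real_w : RealProfile E w
  conj_fg : Conjugate f g
  norm_w : ‖w‖ ≤ 8 * a
  lead : ∃ h : Wiener ℂ, h 0 = 0 ∧ ‖h‖ ≤ a / 10 ∧ f = wsingle 1 (seed a) + h

theorem norm_exp_real_le {lam κ s : ℝ} (n : ℤ) (hs : 0 ≤ s) (h : lam ≤ -(κ * |(n : ℝ)|)) :
    ‖NormedSpace.exp (s • (lam : ℂ))‖ ≤ Real.exp (-(κ * |(n : ℝ)| * s)) := by
  rw [← Complex.exp_eq_exp_ℂ, Complex.norm_exp, Real.exp_le_exp]
  simp only [Complex.real_smul, Complex.mul_re, Complex.ofReal_re, Complex.ofReal_im]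
  nlinarith

theorem exists_scalar_green (σ : ℝ) (hσ : |σ| = 1) :
    ∃ B : Wiener ℂ →L[ℂ] Wiener ℂ, ‖B‖ ≤ 2 ∧ (∀ c, B c 0 = 0) ∧
      ∀ c n t, HasDerivAt (B c n)
        (((σ * n - |(n : ℝ)| / 2 : ℝ) : ℂ) * B c n t - (Complex.I * n) • c n t) t := by
  obtain ⟨B, h1, h2, h3⟩ := exists_diagonal_green (V := ℂ) (κ := 1 / 2) (by norm_num)
    (fun n : ℤ => ((σ * n - |(n : ℝ)| / 2 : ℝ) : ℂ)) (fun n _ => by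
      have habs : |σ * n| = |(n : ℝ)| := by rw [abs_mul, hσ, one_mul]
      rcases le_total 0 (σ * n) with h | h
      · refine Or.inr fun s hs => ?_
        rw [← Complex.ofReal_neg]
        refine norm_exp_real_le n hs ?_
        rw [abs_of_nonneg h] at habs
        linarith
      · refine Or.inl fun s hs => norm_exp_real_le n hs ?_
        rw [abs_of_nonpos h] at habs
        linarith)
  exact ⟨B, h1.trans (by norm_num), h2, h3⟩

namespace HolomorphicAlgebra

variable {E : ℂ → V →L[ℂ] ℂ} {υ : V} (hE : HolomorphicAlgebra E υ) {U : ℝ → ℝ}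
  (hU : Continuous U) (hU1 : ∀ θ, |U θ| < 1)
include hE

theorem exists_transport_green : ∃ A : Wiener V →L[ℂ] Wiener V, ‖A‖ ≤ 4 ∧ (∀ c, A c 0 = 0) ∧
    ∀ c n t, HasDerivAt (A c n)
      (-((Complex.I * n) • υ + ((|(n : ℝ)| / 2 : ℝ) : ℂ) • (1 : V)) * A c n t -
        (Complex.I * n) • c n t) t := by
  obtain ⟨A, h1, h2, h3⟩ := exists_diagonal_green (V := V) (κ := 1 / 4) (by norm_num)
    (fun n : ℤ => -((Complex.I * n) • υ + ((|(n : ℝ)| / 2 : ℝ) : ℂ) • (1 : V)))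
    (fun n _ => Or.inl fun s hs => hE.norm_exp_transport_le n s hs)
  exact ⟨A, h1.trans (by norm_num), h2, h3⟩

theorem hasDerivAt_eval_transport {b c : Wiener V} (hb : ∀ n t, HasDerivAt (b n)
      (-((Complex.I * n) • υ + ((|(n : ℝ)| / 2 : ℝ) : ℂ) • (1 : V)) * b n t -
        (Complex.I * n) • c n t) t) {v : ℝ} (hv : |v| < 2) (n : ℤ) (t : ℝ) :
    HasDerivAt (wmap (E v) b n) (-(Complex.I * n * v + ((|(n : ℝ)| / 2 : ℝ) : ℂ)) *
      wmap (E v) b n t - (Complex.I * n) • wmap (E v) c n t) t := by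
  have h := ((E v).restrictScalars ℝ).hasFDerivAt.comp_hasDerivAt t (hb n t)
  have hr := ofReal_mem_velRect hv
  refine h.congr_deriv ?_
  show E v _ = _
  rw [map_sub, hE.eval_mul _ hr, map_neg, map_add, map_smul, map_smul, map_smul, hE.eval_coord _ hr,
    hE.eval_one _ hr, wmap_apply, wmap_apply, smul_eq_mul, smul_eq_mul, mul_one]

theorem realProfile_of_transport {b c : Wiener V} (hb0 : b 0 = 0) (hb : ∀ n t, HasDerivAt (b n)
      (-((Complex.I * n) • υ + ((|(n : ℝ)| / 2 : ℝ) : ℂ) • (1 : V)) * b n t -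
        (Complex.I * n) • c n t) t) (hc : RealProfile E c) : RealProfile E b := by
  intro n t v hv
  have hz : wmap (E v) b 0 = 0 := by
    ext t
    rw [wmap_apply, hb0]
    exact map_zero _
  have hlam : ∀ n : ℤ, n ≠ 0 → (-(Complex.I * n * v + ((|(n : ℝ)| / 2 : ℝ) : ℂ))).re ≠ 0 := by
    intro n hn
    have : (0 : ℝ) < |(n : ℝ)| := abs_pos.2 (Int.cast_ne_zero.2 hn)
    simp [Complex.mul_re]
    exact hn
  have := conjugate_of_ode (b := wmap (E v) b) (b' := wmap (E v) b) (c := wmap (E v) c)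
    (d := wmap (E v) c) (lam := fun n => -(Complex.I * n * v + ((|(n : ℝ)| / 2 : ℝ) : ℂ)))
    hlam hz hz
    (hE.hasDerivAt_eval_transport hb hv) (fun n t => by
      refine (hE.hasDerivAt_eval_transport hb hv n t).congr_deriv ?_
      congr 2
      simp only [map_neg, map_add, map_mul, Complex.conj_I, map_intCast, Complex.conj_ofReal,
        Int.cast_neg, abs_neg]
      ring) (fun n t => hc n t v hv)
  exact this n t

include hU hU1

theorem norm_pressureRem_le {η : ℝ} (hη : ∫ θ in (-1 : ℝ)..1, |(U * U - 1) θ| ≤ η)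
    (x : Wiener V × Wiener V × Wiener V) :
    ‖pressureRem E U x‖ ≤ 5 / 2 * η * ‖x.1‖ + 6 * ‖x.2.1‖ + 5 / 3 * ‖x.2.2‖ := by
  have c1 : Continuous (1 : ℝ → ℝ) := continuous_const
  have b1 : ∫ θ in (-1 : ℝ)..1, |(1 : ℝ → ℝ) θ| ≤ 2 := integral_abs_le_two c1 (by simp)
  have bU : ∫ θ in (-1 : ℝ)..1, |U θ| ≤ 2 := integral_abs_le_two hU fun θ => (hU1 θ).le
  have e1 := hE.norm_wmap_dmoment_le hU hU1 ((hU.mul hU).sub c1) x.1 hη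
  have e2 := hE.norm_wmap_moment_le hU hU1 c1 x.2.1 b1
  have e3 := hE.norm_wmap_dmoment_le hU hU1 hU x.2.1 bU
  have e4 := hE.norm_wmap_dmoment_le hU hU1 c1 x.2.2 b1
  have n1 := norm_smul (-((1 / 2 : ℝ) : ℂ)) (wmap (dmoment E U (U * U - 1)) x.1)
  have n2 := norm_smul ((1 / 2 : ℝ) : ℂ) (wmap (moment E U 1) x.2.1)
  have n3 := norm_smul ((1 / 2 : ℝ) : ℂ) (wmap (dmoment E U U) x.2.1)
  have n4 := norm_smul ((1 / 6 : ℝ) : ℂ) (wmap (dmoment E U 1) x.2.2)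
  rw [norm_neg] at n1
  rw [Complex.norm_real, Real.norm_of_nonneg (by norm_num)] at n1 n2 n3 n4
  have t1 := norm_sub_le (-((1 / 2 : ℝ) : ℂ) • wmap (dmoment E U (U * U - 1)) x.1)
    (((1 / 2 : ℝ) : ℂ) • wmap (moment E U 1) x.2.1)
  have t2 := norm_sub_le (-((1 / 2 : ℝ) : ℂ) • wmap (dmoment E U (U * U - 1)) x.1 -
    ((1 / 2 : ℝ) : ℂ) • wmap (moment E U 1) x.2.1) (((1 / 2 : ℝ) : ℂ) • wmap (dmoment E U U) x.2.1)
  have t3 := norm_sub_le (-((1 / 2 : ℝ) : ℂ) • wmap (dmoment E U (U * U - 1)) x.1 -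
    ((1 / 2 : ℝ) : ℂ) • wmap (moment E U 1) x.2.1 - ((1 / 2 : ℝ) : ℂ) • wmap (dmoment E U U) x.2.1)
    (((1 / 6 : ℝ) : ℂ) • wmap (dmoment E U 1) x.2.2)
  rw [pressureRem]
  linarith

theorem norm_massRem_le {η : ℝ} (hη : ∫ θ in (-1 : ℝ)..1, |(U * U - 1) θ| ≤ η)
    (x : Wiener V × Wiener V × Wiener V) :
    ‖massRem E U x‖ ≤ 5 * η * ‖x.1‖ + 13 * ‖x.2.1‖ + 10 / 3 * ‖x.2.2‖ := by
  have c1 : Continuous (1 : ℝ → ℝ) := continuous_const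
  have b1 : ∫ θ in (-1 : ℝ)..1, |(1 : ℝ → ℝ) θ| ≤ 2 := integral_abs_le_two c1 (by simp)
  have e1 := hE.norm_pressureRem_le hU hU1 hη x
  have e2 := hE.norm_wmap_moment_le hU hU1 c1 x.2.1 b1
  have n1 := norm_smul ((2 : ℝ) : ℂ) (pressureRem E U x)
  have n2 := norm_smul ((1 / 2 : ℝ) : ℂ) (wmap (moment E U 1) x.2.1)
  rw [Complex.norm_real, Real.norm_of_nonneg (by norm_num)] at n1 n2
  have t1 := norm_add_le (((2 : ℝ) : ℂ) • pressureRem E U x)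
    (((1 / 2 : ℝ) : ℂ) • wmap (moment E U 1) x.2.1)
  rw [massRem]
  linarith

theorem norm_fluxRem_le {η : ℝ} (hη : ∫ θ in (-1 : ℝ)..1, |(U * U - 1) θ| ≤ η)
    (x : Wiener V × Wiener V × Wiener V) :
    ‖fluxRem E U x‖ ≤ η * ‖x.1‖ + ‖x.2.1‖ := by
  have c1 : Continuous (1 : ℝ → ℝ) := continuous_const
  have bU : ∫ θ in (-1 : ℝ)..1, |U θ| ≤ 2 := integral_abs_le_two hU fun θ => (hU1 θ).le
  have e1 := hE.norm_wmap_moment_le hU hU1 ((hU.mul hU).sub c1) x.1 hη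
  have e2 := hE.norm_wmap_moment_le hU hU1 hU x.2.1 bU
  have n2 := norm_smul ((1 / 2 : ℝ) : ℂ) (wmap (moment E U U) x.2.1)
  rw [Complex.norm_real, Real.norm_of_nonneg (by norm_num)] at n2
  have t1 := norm_add_le (wmap (moment E U (U * U - 1)) x.1)
    (((1 / 2 : ℝ) : ℂ) • wmap (moment E U U) x.2.1)
  rw [fluxRem]
  linarith

theorem conjugate_pressureRem {w : Wiener V} (h : RealProfile E w) :
    Conjugate (pressureRem E U (powers w)) (pressureRem E U (powers w)) := by
  have c1 : Continuous (1 : ℝ → ℝ) := continuous_const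
  have h2 := hE.realProfile_conv h h
  have h3 := hE.realProfile_conv h h2
  have e1 := (hE.conjugate_dmoment hU hU1 ((hU.mul hU).sub c1) h).smul (-((1 / 2 : ℝ) : ℂ))
  have e2 := (hE.conjugate_moment hU hU1 c1 h2).smul ((1 / 2 : ℝ) : ℂ)
  have e3 := (hE.conjugate_dmoment hU hU1 hU h2).smul ((1 / 2 : ℝ) : ℂ)
  have e4 := (hE.conjugate_dmoment hU hU1 c1 h3).smul ((1 / 6 : ℝ) : ℂ)
  rw [map_neg] at e1
  rw [Complex.conj_ofReal] at e1 e2 e3 e4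
  exact ((e1.sub e2).sub e3).sub e4

theorem conjugate_massRem {w : Wiener V} (h : RealProfile E w) :
    Conjugate (massRem E U (powers w)) (massRem E U (powers w)) := by
  have c1 : Continuous (1 : ℝ → ℝ) := continuous_const
  have e1 := (hE.conjugate_pressureRem hU hU1 h).smul ((2 : ℝ) : ℂ)
  have e2 := (hE.conjugate_moment hU hU1 c1 (hE.realProfile_conv h h)).smul ((1 / 2 : ℝ) : ℂ)
  rw [Complex.conj_ofReal] at e1 e2
  exact e1.add e2

theorem conjugate_fluxRem {w : Wiener V} (h : RealProfile E w) :
    Conjugate (fluxRem E U (powers w)) (fluxRem E U (powers w)) := by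
  have c1 : Continuous (1 : ℝ → ℝ) := continuous_const
  have e1 := hE.conjugate_moment hU hU1 ((hU.mul hU).sub c1) h
  have e2 := (hE.conjugate_moment hU hU1 hU (hE.realProfile_conv h h)).smul ((1 / 2 : ℝ) : ℂ)
  rw [Complex.conj_ofReal] at e2
  exact e1.add e2

end HolomorphicAlgebra

end Wave

section WaveExistence

open scoped BoundedContinuousFunction

variable {V : Type*} [NormedCommRing V] [NormedAlgebra ℂ V] [CompleteSpace V]

theorem Conjugate.rotate {f g : Wiener ℂ} (h : Conjugate f g) :
    Conjugate ((Complex.I * ((1 / 2 : ℝ) : ℂ)) • (f - g))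
      ((Complex.I * ((1 / 2 : ℝ) : ℂ)) • (f - g)) := by
  have h1 := (h.sub h.symm).smul (Complex.I * ((1 / 2 : ℝ) : ℂ))
  have e : starRingEnd ℂ (Complex.I * ((1 / 2 : ℝ) : ℂ)) • (g - f) =
      (Complex.I * ((1 / 2 : ℝ) : ℂ)) • (f - g) := by
    rw [map_mul, Complex.conj_I, Complex.conj_ofReal, neg_mul, neg_smul, ← smul_neg, neg_sub]
  rwa [e] at h1

theorem Conjugate.add_I_smul {b c : Wiener ℂ} (hb : Conjugate b b) (hc : Conjugate c c) :
    Conjugate (b + Complex.I • c) (b - Complex.I • c) := by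
  have h1 := hb.add (hc.smul Complex.I)
  rwa [Complex.conj_I, neg_smul, ← sub_eq_add_neg] at h1

theorem conjugate_seed (a : ℝ) : Conjugate (wsingle 1 (seed a)) (wsingle (-1) (seed a)) := by
  intro n t
  rcases eq_or_ne n 1 with rfl | hn
  · rw [wsingle_self, wsingle_self, seed_apply, Complex.conj_ofReal]
  · rw [wsingle_ne _ hn, wsingle_ne _ (fun h => hn (neg_injective h))]
    simp

theorem hasDerivAt_wsingle_seed (a : ℝ) {σ : ℤ} (hσ : |(σ : ℝ)| = 1) (n : ℤ) {t : ℝ} (ht : t < 0) :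
    HasDerivAt (wsingle σ (seed a) n)
      (((σ * n - |(n : ℝ)| / 2 : ℝ) : ℂ) * wsingle σ (seed a) n t) t := by
  rcases eq_or_ne n σ with rfl | hn
  · rw [wsingle_self]
    refine (hasDerivAt_seed a ht).congr_deriv ?_
    have h : (n : ℝ) * n = 1 := by rw [← abs_mul_abs_self, hσ, one_mul]
    rw [hσ, h]
    norm_num
  · rw [wsingle_ne _ hn]
    simp

/-- The coefficients of the pressure produced by given diagonal unknowns. -/
noncomputable def pressureOf (E : ℂ → V →L[ℂ] ℂ) (U : ℝ → ℝ) (B B' : Wiener ℂ →L[ℂ] Wiener ℂ)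
    (x : Wiener V × Wiener V × Wiener V) : Wiener ℂ :=
  (Complex.I * ((1 / 2 : ℝ) : ℂ)) • (B (massRem E U x + Complex.I • fluxRem E U x) -
    B' (massRem E U x - Complex.I • fluxRem E U x)) + pressureRem E U x

theorem pressureOf_sub (E : ℂ → V →L[ℂ] ℂ) (U : ℝ → ℝ) (B B' : Wiener ℂ →L[ℂ] Wiener ℂ)
    (x y : Wiener V × Wiener V × Wiener V) :
    pressureOf E U B B' x - pressureOf E U B B' y = pressureOf E U B B' (x - y) := by
  simp only [pressureOf, ← pressureRem_sub, ← massRem_sub, ← fluxRem_sub, map_sub, map_add,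
    smul_sub, smul_add]
  abel

theorem norm_rotate_le (b c : Wiener ℂ) :
    ‖(Complex.I * ((1 / 2 : ℝ) : ℂ)) • (b - c)‖ ≤ 1 / 2 * (‖b‖ + ‖c‖) := by
  rw [norm_smul, norm_mul, Complex.norm_I, Complex.norm_real, Real.norm_of_nonneg (by norm_num),
    one_mul]
  exact mul_le_mul_of_nonneg_left (norm_sub_le _ _) (by norm_num)

theorem lead_estimate {a η x y z : ℝ} (ha : 0 < a) (ha' : a ≤ 1 / 10 ^ 6) (hη : 0 ≤ η)
    (hη' : η ≤ 1 / 5000) (hx : x ≤ 8 * a) (hy : y ≤ 8 * a * (8 * a))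
    (hz : z ≤ 8 * a * (8 * a * (8 * a))) : 12 * η * x + 28 * y + 20 / 3 * z ≤ a / 10 := by
  have h1 : 12 * η * x ≤ 12 * (1 / 5000) * (8 * a) :=
    (mul_le_mul_of_nonneg_left hx (by positivity)).trans (by gcongr)
  have h2 : (8 * a) * (8 * a) ≤ 64 / 10 ^ 6 * a := by nlinarith
  have h4 : (8 * a) * ((8 * a) * (8 * a)) ≤ 1 / 10 ^ 4 * a := by
    have : (8 * a) * (8 * a) ≤ 64 / 10 ^ 6 * (1 / 10 ^ 6) := by nlinarith
    nlinarith
  linarith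

namespace HolomorphicAlgebra

variable {E : ℂ → V →L[ℂ] ℂ} {υ : V} (hE : HolomorphicAlgebra E υ) {U : ℝ → ℝ}
  (hU : Continuous U) (hU1 : ∀ θ, |U θ| < 1)
include hE hU hU1

theorem norm_green_rem_le {η : ℝ} (hη : ∫ θ in (-1 : ℝ)..1, |(U * U - 1) θ| ≤ η)
    {B : Wiener ℂ →L[ℂ] Wiener ℂ} (hB : ‖B‖ ≤ 2)
    (x : Wiener V × Wiener V × Wiener V) {z : ℂ} (hz : ‖z‖ = 1) :
    ‖B (massRem E U x + z • fluxRem E U x)‖ ≤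
      12 * η * ‖x.1‖ + 28 * ‖x.2.1‖ + 20 / 3 * ‖x.2.2‖ := by
  have h1 := hE.norm_massRem_le hU hU1 hη x
  have h2 := hE.norm_fluxRem_le hU hU1 hη x
  have h3 := B.le_of_opNorm_le hB (massRem E U x + z • fluxRem E U x)
  have h4 := norm_add_le (massRem E U x) (z • fluxRem E U x)
  rw [norm_smul, hz, one_mul] at h4
  linarith

theorem norm_pressureOf_le {η : ℝ} (hη : ∫ θ in (-1 : ℝ)..1, |(U * U - 1) θ| ≤ η)
    {B B' : Wiener ℂ →L[ℂ] Wiener ℂ} (hB : ‖B‖ ≤ 2) (hB' : ‖B'‖ ≤ 2)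
    (x : Wiener V × Wiener V × Wiener V) :
    ‖pressureOf E U B B' x‖ ≤ 29 / 2 * η * ‖x.1‖ + 34 * ‖x.2.1‖ + 25 / 3 * ‖x.2.2‖ := by
  have h1 := hE.norm_green_rem_le hU hU1 hη hB x (z := Complex.I) (by simp)
  have h2 := hE.norm_green_rem_le hU hU1 hη hB' x (z := -Complex.I) (by simp)
  rw [neg_smul, ← sub_eq_add_neg] at h2
  have h3 := hE.norm_pressureRem_le hU hU1 hη x
  have h4 := norm_rotate_le (B (massRem E U x + Complex.I • fluxRem E U x))
    (B' (massRem E U x - Complex.I • fluxRem E U x))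
  refine (norm_add_le _ _).trans ?_
  linarith

theorem exists_wave {a η : ℝ} (ha : 0 < a) (ha' : a ≤ 1 / 10 ^ 6) (hη' : η ≤ 1 / 5000)
    (hη : ∫ θ in (-1 : ℝ)..1, |(U * U - 1) θ| ≤ η) : ∃ w f g p, Wave E υ U a w f g p := by
  obtain ⟨A, hA, hA0, hAd⟩ := hE.exists_transport_green
  obtain ⟨B, hB, hB0, hBd⟩ := exists_scalar_green 1 (by simp)
  obtain ⟨B', hB', hB0', hBd'⟩ := exists_scalar_green (-1) (by simp)
  have hη0 : 0 ≤ η := le_trans (intervalIntegral.integral_nonneg (by norm_num)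
    fun θ _ => abs_nonneg _) hη
  have hBB : ∀ w : Wiener V, RealProfile E w →
      Conjugate (B (massRem E U (powers w) + Complex.I • fluxRem E U (powers w)))
        (B' (massRem E U (powers w) - Complex.I • fluxRem E U (powers w))) := by
    intro w hw
    refine conjugate_of_ode (lam := fun n : ℤ => ((1 * n - |(n : ℝ)| / 2 : ℝ) : ℂ))
      (fun n hn => ?_) (hB0 _) (hB0' _) (hBd _) (fun n t => ?_)
      ((hE.conjugate_massRem hU hU1 hw).add_I_smul (hE.conjugate_fluxRem hU hU1 hw))
    · rw [Complex.ofReal_re, one_mul]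
      have hn' : (n : ℝ) ≠ 0 := Int.cast_ne_zero.2 hn
      rcases abs_cases (n : ℝ) with h | h <;> rw [h.1] <;> intro h' <;> apply hn' <;> linarith
    · refine (hBd' _ n t).congr_deriv ?_
      congr 2
      rw [Complex.conj_ofReal]
      congr 1
      push_cast
      rw [abs_neg]
      ring
  set Sf : Wiener ℂ := wsingle 1 (seed a) with hSf
  set Sg : Wiener ℂ := wsingle (-1) (seed a) with hSg
  have nSf : ‖Sf‖ ≤ a := (norm_wsingle _ _).le.trans (norm_seed_le ha.le)
  have nSg : ‖Sg‖ ≤ a := (norm_wsingle _ _).le.trans (norm_seed_le ha.le)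
  have hS : ‖A (wconst ((Complex.I * ((1 / 2 : ℝ) : ℂ)) • (Sf - Sg)))‖ ≤ 8 * a / 2 := by
    have h1 := A.le_of_opNorm_le hA (wconst ((Complex.I * ((1 / 2 : ℝ) : ℂ)) • (Sf - Sg)))
    have h2 := hE.norm_const_le ((Complex.I * ((1 / 2 : ℝ) : ℂ)) • (Sf - Sg))
    have h3 := norm_rotate_le Sf Sg
    change ‖(wconst ((Complex.I * ((1 / 2 : ℝ) : ℂ)) • (Sf - Sg)) : Wiener V)‖ ≤ _ at h2
    linarith
  obtain ⟨w, hw, hwr, hfix⟩ := exists_cubic_fixedPoint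
    (F := fun x => A (wconst (pressureOf E U B B' x) + ((1 / 2 : ℝ) : ℂ) • x.2.1))
    (S := A (wconst ((Complex.I * ((1 / 2 : ℝ) : ℂ)) • (Sf - Sg))))
    (r := 8 * a) (l₁ := 58 * η) (l₂ := 138) (l₃ := 100 / 3) (by norm_num) (by norm_num)
    (fun x y => by
      simp only [← pressureOf_sub, Prod.fst_sub, Prod.snd_sub, map_sub, map_add, smul_sub]
      abel)
    (fun x => by
      have h1 := A.le_of_opNorm_le hA
        (wconst (pressureOf E U B B' x) + ((1 / 2 : ℝ) : ℂ) • x.2.1)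
      have h2 := hE.norm_const_le (pressureOf E U B B' x)
      have h3 := hE.norm_pressureOf_le hU hU1 hη hB hB' x
      have h4 := norm_add_le (wconst (pressureOf E U B B' x)) (((1 / 2 : ℝ) : ℂ) • x.2.1)
      rw [norm_smul, Complex.norm_real, Real.norm_of_nonneg (by norm_num)] at h4
      change ‖(wconst (pressureOf E U B B' x) : Wiener V)‖ ≤ _ at h2
      linarith)
    (by positivity) hS (by nlinarith) (isClosed_realProfile E) (RealProfile.zero E)
    (fun w hw => by
      rw [← map_add, ← add_assoc, ← map_add wconst]
      refine hE.realProfile_of_transport (hA0 _) (hAd _) (RealProfile.add ?_ ?_)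
      · exact hE.realProfile_const ((conjugate_seed a).rotate.add
          ((hBB w hw).rotate.add (hE.conjugate_pressureRem hU hU1 hw)))
      · exact (hE.realProfile_conv hw hw).smul (1 / 2))
  set f := Sf + B (massRem E U (powers w) + Complex.I • fluxRem E U (powers w)) with hf
  set g := Sg + B' (massRem E U (powers w) - Complex.I • fluxRem E U (powers w)) with hg
  set p := (Complex.I * ((1 / 2 : ℝ) : ℂ)) • (f - g) + pressureRem E U (powers w) with hp
  have hwA : A (wconst p + ((1 / 2 : ℝ) : ℂ) • conv w w) = w := by
    refine Eq.trans ?_ hfix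
    rw [← map_add, ← add_assoc, ← map_add wconst]
    congr 3
    rw [hp, hf, hg, pressureOf, ← add_assoc, ← smul_add]
    congr 2
    abel
  have hpow : ‖w‖ ≤ 8 * a ∧ ‖conv w w‖ ≤ (8 * a) * (8 * a) ∧
      ‖conv w (conv w w)‖ ≤ 8 * a * ((8 * a) * (8 * a)) := by
    have h2 : ‖conv w w‖ ≤ (8 * a) * (8 * a) := (norm_conv_le w w).trans (by gcongr)
    exact ⟨hwr, h2, (norm_conv_le w (conv w w)).trans (by gcongr)⟩
  refine ⟨w, f, g, p, ⟨?_, ?_, ?_, ?_, ?_, ?_, rfl, hw, ?_, hwr, ?_⟩⟩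
  · rw [← hwA]; exact hA0 _
  · show Sf 0 + B _ 0 = 0
    rw [hB0, hSf, wsingle_ne _ (by norm_num), add_zero]
  · show Sg 0 + B' _ 0 = 0
    rw [hB0', hSg, wsingle_ne _ (by norm_num), add_zero]
  · intro n t
    have := hAd (wconst p + ((1 / 2 : ℝ) : ℂ) • conv w w) n t
    rwa [hwA] at this
  · intro n t ht
    have h1 := hasDerivAt_wsingle_seed a (σ := 1) (by simp) n ht
    have h2 := hBd (massRem E U (powers w) + Complex.I • fluxRem E U (powers w)) n t
    refine (h1.add h2).congr_deriv ?_
    show _ = _ * (Sf n t + B (massRem E U (powers w) + Complex.I • fluxRem E U (powers w)) n t) - _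
    push_cast
    ring
  · intro n t ht
    have h1 := hasDerivAt_wsingle_seed a (σ := -1) (by simp) n ht
    have h2 := hBd' (massRem E U (powers w) - Complex.I • fluxRem E U (powers w)) n t
    refine (h1.add h2).congr_deriv ?_
    show _ = _ * (Sg n t + B' (massRem E U (powers w) - Complex.I • fluxRem E U (powers w)) n t) - _
    push_cast
    ring
  · exact (conjugate_seed a).add (hBB w hw)
  · refine ⟨B (massRem E U (powers w) + Complex.I • fluxRem E U (powers w)), hB0 _, ?_, rfl⟩
    refine (hE.norm_green_rem_le hU hU1 hη hB (powers w) (by simp)).trans ?_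
    show 12 * η * ‖w‖ + 28 * ‖conv w w‖ + 20 / 3 * ‖conv w (conv w w)‖ ≤ a / 10
    exact lead_estimate ha ha' hη0 hη' hpow.1 hpow.2.1 hpow.2.2

end HolomorphicAlgebra

end WaveExistence

section Consistency

open scoped BoundedContinuousFunction

variable {V : Type*} [NormedCommRing V] [NormedAlgebra ℂ V] [CompleteSpace V]

/-- The coefficients of the pressure of a velocity perturbation. -/
noncomputable def pressureCoeff (E : ℂ → V →L[ℂ] ℂ) (U : ℝ → ℝ) (w : Wiener V) : Wiener ℂ :=
  pressureRem E U (powers w) - wmap (moment E U U) w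

/-- The coefficients of the momentum flux of a velocity perturbation. -/
noncomputable def momentumFlux (E : ℂ → V →L[ℂ] ℂ) (υ : V) (U : ℝ → ℝ) (w : Wiener V) :
    Wiener V :=
  (-1 : ℂ) • (wmap (ContinuousLinearMap.mul ℂ V υ) w + wconst (pressureCoeff E U w) +
    ((1 / 2 : ℝ) : ℂ) • conv w w)

theorem hasDerivAt_coupled_modes {n : ℤ} (hn : n ≠ 0) {mm qq f g : ℝ → ℂ} {R₁ R₂ : ℝ → ℂ}
    (hmm : ∀ t < 0, HasDerivAt mm (-((|(n : ℝ)| / 2 : ℝ) : ℂ) * mm t -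
      Complex.I * n * (qq t + Complex.I * (f t - g t) + R₁ t)) t)
    (hqq : ∀ t < 0, HasDerivAt qq (-((|(n : ℝ)| / 2 : ℝ) : ℂ) * qq t -
      Complex.I * n * (mm t + R₂ t)) t)
    (hf : ∀ t < 0, HasDerivAt f (((n - |(n : ℝ)| / 2 : ℝ) : ℂ) * f t -
      Complex.I * n * (R₁ t + Complex.I * R₂ t)) t)
    (hg : ∀ t < 0, HasDerivAt g (((-n - |(n : ℝ)| / 2 : ℝ) : ℂ) * g t -
      Complex.I * n * (R₁ t - Complex.I * R₂ t)) t)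
    {C : ℝ} (bmm : ∀ t, ‖mm t‖ ≤ C) (bqq : ∀ t, ‖qq t‖ ≤ C) (bf : ∀ t, ‖f t‖ ≤ C)
    (bg : ∀ t, ‖g t‖ ≤ C) {t : ℝ} (ht : t < 0) :
    mm t = 1 / 2 * (f t + g t) ∧ qq t = -(Complex.I / 2) * (f t - g t) := by
  have hI : Complex.I * Complex.I = -1 := Complex.I_mul_I
  have hn' : (0 : ℝ) < |(n : ℝ)| := abs_pos.2 (Int.cast_ne_zero.2 hn)
  have key : ∀ σ : ℂ, ‖σ‖ = 1 → σ * σ = 1 → (Complex.I * n * σ).re = 0 →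
      mm t - 1 / 2 * (f t + g t) + σ * (qq t + Complex.I / 2 * (f t - g t)) = 0 := by
    intro σ hσ1 hσ hσr
    refine eq_zero_of_bounded_ancient (lam := -((|(n : ℝ)| / 2 : ℝ) : ℂ) - Complex.I * n * σ)
      (e := fun t => mm t - 1 / 2 * (f t + g t) + σ * (qq t + Complex.I / 2 * (f t - g t)))
      (T := 0) (C := 4 * C) ?_ (fun t ht => ?_) (fun t ht => ?_) t ht
    · rw [Complex.sub_re, hσr, sub_zero, Complex.neg_re, Complex.ofReal_re]
      linarith
    · refine (((hmm t ht).sub (((hf t ht).add (hg t ht)).const_mul (1 / 2))).add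
        (((hqq t ht).add (((hf t ht).sub (hg t ht)).const_mul (Complex.I / 2))).const_mul
          σ)).congr_deriv ?_
      push_cast
      linear_combination (Complex.I * n * (qq t + Complex.I / 2 * (f t - g t))) * hσ +
        (-(n * σ * Complex.I * R₂ t) - n * (f t - g t) / 2) * hI
    · have h1 := norm_sub_le (mm t) (1 / 2 * (f t + g t))
      have h2 := norm_add_le (f t) (g t)
      have h3 := norm_sub_le (f t) (g t)
      have h4 := norm_add_le (qq t) (Complex.I / 2 * (f t - g t))
      have h5 := norm_add_le (mm t - 1 / 2 * (f t + g t))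
        (σ * (qq t + Complex.I / 2 * (f t - g t)))
      rw [norm_mul] at h1 h4 h5
      have n1 : ‖(1 / 2 : ℂ)‖ = 1 / 2 := by norm_num
      have n2 : ‖(Complex.I / 2 : ℂ)‖ = 1 / 2 := by simp
      rw [n1] at h1
      rw [n2] at h4
      rw [hσ1] at h5
      linarith [bmm t, bqq t, bf t, bg t]
  have k1 := key 1 (by simp) (by ring) (by simp)
  have k2 := key (-1) (by simp) (by ring) (by simp)
  constructor
  · linear_combination (k1 + k2) / 2
  · linear_combination (k1 - k2) / 2

namespace Wave

variable {E : ℂ → V →L[ℂ] ℂ} {υ : V} (hE : HolomorphicAlgebra E υ) {U : ℝ → ℝ}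
  (hU : Continuous U) (hU1 : ∀ θ, |U θ| < 1) {a : ℝ} {w : Wiener V} {f g p : Wiener ℂ}
  (h : Wave E υ U a w f g p)
include hE hU hU1 h

theorem hasDerivAt_moment {κ : ℝ → ℝ} (hκ : Continuous κ) (n : ℤ) (t : ℝ) :
    HasDerivAt (wmap (moment E U κ) w n) (-((|(n : ℝ)| / 2 : ℝ) : ℂ) * moment E U κ (w n t) -
      Complex.I * n * (moment E U (κ * U) (w n t) + ((∫ θ in (-1 : ℝ)..1, κ θ : ℝ) : ℂ) * p n t +
        1 / 2 * moment E U κ (conv w w n t))) t := by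
  have h1 := ((moment E U κ).restrictScalars ℝ).hasFDerivAt.comp_hasDerivAt t (h.ode_w n t)
  refine h1.congr_deriv ?_
  show moment E U κ (-((Complex.I * n) • υ + ((|(n : ℝ)| / 2 : ℝ) : ℂ) • (1 : V)) * w n t -
    (Complex.I * n) • (p n t • (1 : V) + ((1 / 2 : ℝ) : ℂ) • conv w w n t)) = _
  rw [neg_mul, add_mul, smul_mul_assoc, smul_mul_assoc, one_mul, map_sub, map_neg, map_add,
    map_smul, map_smul, map_smul, map_add, map_smul, map_smul,
    hE.moment_coord_mul hU hU1 hκ, hE.moment_one hU hU1 hκ]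
  simp only [smul_eq_mul]
  push_cast
  ring

theorem consistent (hU0 : ∫ θ in (-1 : ℝ)..1, U θ = 0) (n : ℤ) {t : ℝ} (ht : t < 0) :
    moment E U 1 (w n t) = 1 / 2 * (f n t + g n t) ∧
      moment E U U (w n t) = -(Complex.I / 2) * (f n t - g n t) := by
  have c1 : Continuous (1 : ℝ → ℝ) := continuous_const
  rcases eq_or_ne n 0 with rfl | hn
  · rw [h.zero_w, h.zero_f, h.zero_g]
    simp
  have hUU : ∀ v : V, moment E U (U * U) v = moment E U (U * U - 1) v + moment E U 1 v := by
    intro v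
    rw [hE.moment_sub hU hU1 (hU.mul hU) c1, _root_.sub_apply, sub_add_cancel]
  have i1 : ∫ θ in (-1 : ℝ)..1, (1 : ℝ → ℝ) θ = 2 := by simp; norm_num
  have hp : ∀ t, p n t = Complex.I * (1 / 2) * (f n t - g n t) +
      pressureRem E U (powers w) n t := by
    intro t
    have e : p n t = Complex.I * ((1 / 2 : ℝ) : ℂ) * (f n t - g n t) +
        pressureRem E U (powers w) n t := by
      conv_lhs => rw [h.pressure]
      rfl
    rw [e]
    push_cast
    rfl
  refine hasDerivAt_coupled_modes hn (mm := fun t => wmap (moment E U 1) w n t)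
    (qq := fun t => wmap (moment E U U) w n t) (f := f n) (g := g n)
    (R₁ := massRem E U (powers w) n) (R₂ := fluxRem E U (powers w) n)
    (C := max (max ‖wmap (moment E U 1) w n‖ ‖wmap (moment E U U) w n‖) (max ‖f n‖ ‖g n‖))
    (fun t ht => ?_) (fun t ht => ?_) (fun t ht => h.ode_f n t ht) (fun t ht => h.ode_g n t ht)
    (fun t => (wiener_norm_apply_le (wmap (moment E U 1) w) n t).trans (by simp))
    (fun t => (wiener_norm_apply_le (wmap (moment E U U) w) n t).trans (by simp))
    (fun t => (wiener_norm_apply_le f n t).trans (by simp))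
    (fun t => (wiener_norm_apply_le g n t).trans (by simp)) ht
  · refine (h.hasDerivAt_moment hE hU hU1 c1 n t).congr_deriv ?_
    have e : massRem E U (powers w) n t = ((2 : ℝ) : ℂ) * pressureRem E U (powers w) n t +
      ((1 / 2 : ℝ) : ℂ) * moment E U 1 (conv w w n t) := rfl
    rw [i1, one_mul, hp, e, wmap_apply, wmap_apply]
    push_cast
    ring
  · refine (h.hasDerivAt_moment hE hU hU1 hU n t).congr_deriv ?_
    have e : fluxRem E U (powers w) n t = moment E U (U * U - 1) (w n t) +
      ((1 / 2 : ℝ) : ℂ) * moment E U U (conv w w n t) := rfl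
    rw [hU0, hUU, e, wmap_apply, wmap_apply]
    push_cast
    ring

theorem ode_momentum (hU0 : ∫ θ in (-1 : ℝ)..1, U θ = 0) (n : ℤ) (t : ℝ) (ht : t < 0) :
    HasDerivAt (w n) (-((|(n : ℝ)| / 2 : ℝ) : ℂ) • w n t +
      (Complex.I * n) • momentumFlux E υ U w n t) t := by
  refine (h.ode_w n t).congr_deriv ?_
  have e1 : momentumFlux E υ U w n t = (-1 : ℂ) • (υ * w n t +
      (pressureRem E U (powers w) n t - moment E U U (w n t)) • (1 : V) +
      ((1 / 2 : ℝ) : ℂ) • conv w w n t) := rfl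
  have e2 : p n t = Complex.I * ((1 / 2 : ℝ) : ℂ) * (f n t - g n t) +
      pressureRem E U (powers w) n t := by
    conv_lhs => rw [h.pressure]
    rfl
  have e3 : (wconst p + ((1 / 2 : ℝ) : ℂ) • conv w w : Wiener V) n t =
    p n t • (1 : V) + ((1 / 2 : ℝ) : ℂ) • conv w w n t := rfl
  have e4 : p n t = pressureRem E U (powers w) n t - moment E U U (w n t) := by
    rw [e2, (h.consistent hE hU hU1 hU0 n ht).2]
    push_cast
    ring
  rw [e1, e3, e4, neg_mul, add_mul, smul_mul_assoc, smul_mul_assoc, one_mul]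
  generalize υ * w n t = y₁
  generalize w n t = y₂
  generalize conv w w n t = y₃
  module

theorem smoothCoeff (hU0 : ∫ θ in (-1 : ℝ)..1, U θ = 0) (k : ℕ) : SmoothCoeff k w := by
  induction k with
  | zero => exact SmoothCoeff.zero w
  | succ k ih =>
    have h2 := ih.conv ih
    have h3 := ih.conv h2
    have hrem : SmoothCoeff k (pressureCoeff E U w) := by
      have e : pressureCoeff E U w = -((1 / 2 : ℝ) : ℂ) • wmap (dmoment E U (U * U - 1)) w
          + (-((1 / 2 : ℝ) : ℂ)) • wmap (moment E U 1) (conv w w)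
          + (-((1 / 2 : ℝ) : ℂ)) • wmap (dmoment E U U) (conv w w)
          + (-((1 / 6 : ℝ) : ℂ)) • wmap (dmoment E U 1) (conv w (conv w w))
          + (-1 : ℂ) • wmap (moment E U U) w := by
        simp only [pressureCoeff, pressureRem, powers]
        module
      rw [e]
      exact (((((ih.wmap _).smul _).add ((h2.wmap _).smul _)).add ((h2.wmap _).smul _)).add
        ((h3.wmap _).smul _)).add ((ih.wmap _).smul _)
    refine ih.succ ?_ (h.ode_momentum hE hU hU1 hU0)
    exact (((ih.wmap _).add (hrem.wmap _)).add (h2.smul _)).smul _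

end Wave

end Consistency

section Constraints

variable {V : Type*} [NormedCommRing V] [NormedAlgebra ℂ V] [CompleteSpace V]

theorem phys_wconst (j : ℕ) (c : Wiener ℂ) {t : ℝ} (ht : t < 0) (x : ℝ) :
    phys j (wconst c : Wiener V) t x = phys j c t x • (1 : V) :=
  phys_wmap j ((ContinuousLinearMap.id ℂ ℂ).smulRight (1 : V)) c ht x

theorem hasDerivAt_phys_sq (w : Wiener V) {t : ℝ} (ht : t < 0) (x : ℝ) :
    HasDerivAt (fun x => phys 0 w t x * phys 0 w t x) ((2 : ℂ) • (phys 0 w t x * phys 1 w t x)) x := by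
  have h := hasDerivAt_phys_x 0 w ht x
  refine (h.mul h).congr_deriv ?_
  rw [two_smul, zero_add, mul_comm (phys 1 w t x)]

theorem hasDerivAt_phys_cube (w : Wiener V) {t : ℝ} (ht : t < 0) (x : ℝ) :
    HasDerivAt (fun x => phys 0 w t x * (phys 0 w t x * phys 0 w t x))
      ((3 : ℂ) • (phys 0 w t x * phys 0 w t x * phys 1 w t x)) x := by
  have h := hasDerivAt_phys_x 0 w ht x
  refine (h.mul (hasDerivAt_phys_sq w ht x)).congr_deriv ?_
  rw [zero_add, mul_smul_comm, show (3 : ℂ) = 1 + 2 by norm_num, add_smul, one_smul]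
  congr 1
  · ring
  · congr 1; ring

theorem phys_zero_momentumFlux (E : ℂ → V →L[ℂ] ℂ) (υ : V) (U : ℝ → ℝ) (w : Wiener V) {t : ℝ}
    (ht : t < 0) (x : ℝ) : phys 0 (momentumFlux E υ U w) t x =
      -(υ * phys 0 w t x + phys 0 (pressureCoeff E U w) t x • (1 : V) +
        (1 / 2 : ℂ) • (phys 0 w t x * phys 0 w t x)) := by
  rw [momentumFlux, phys_smul 0 _ _ ht, phys_add 0 _ _ ht, phys_add 0 _ _ ht, phys_wconst 0 _ ht,
    phys_smul 0 _ _ ht, phys_conv _ _ ht, phys_wmap 0 _ _ ht, neg_one_smul]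
  push_cast
  rfl

theorem phys_one_momentumFlux (E : ℂ → V →L[ℂ] ℂ) (υ : V) (U : ℝ → ℝ) (w : Wiener V) {t : ℝ}
    (ht : t < 0) (x : ℝ) : phys 1 (momentumFlux E υ U w) t x =
      -(υ * phys 1 w t x + phys 1 (pressureCoeff E U w) t x • (1 : V) +
        phys 0 w t x * phys 1 w t x) := by
  have h1 := hasDerivAt_phys_x 0 (momentumFlux E υ U w) ht x
  have h2 := ((((hasDerivAt_phys_x 0 w ht x).const_mul υ).add
    ((hasDerivAt_phys_x 0 (pressureCoeff E U w) ht x).smul_const (1 : V))).add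
      ((hasDerivAt_phys_sq w ht x).const_smul (1 / 2 : ℂ))).neg
  have e : (fun x => phys 0 (momentumFlux E υ U w) t x) = fun x =>
      -(υ * phys 0 w t x + phys 0 (pressureCoeff E U w) t x • (1 : V) +
        (1 / 2 : ℂ) • (phys 0 w t x * phys 0 w t x)) :=
    funext fun x => phys_zero_momentumFlux E υ U w ht x
  rw [e] at h1
  refine (h1.unique h2).trans ?_
  rw [smul_smul]
  norm_num

namespace HolomorphicAlgebra

variable {E : ℂ → V →L[ℂ] ℂ} {υ : V} (hE : HolomorphicAlgebra E υ) {U : ℝ → ℝ}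
  (hU : Continuous U) (hU1 : ∀ θ, |U θ| < 1)
include hE hU hU1

theorem dmoment_one_coord : dmoment E U 1 υ = 2 := by
  have c1 : Continuous (1 : ℝ → ℝ) := continuous_const
  rw [hE.dmoment_apply hU hU1 c1]
  simp only [fun θ => hE.deriv_eval_coord (abs_lt_two_of_lt_one (hU1 θ))]
  simp
  norm_num

theorem dmoment_one_coord_mul (v : V) :
    dmoment E U 1 (υ * v) = moment E U 1 v + dmoment E U U v := by
  have c1 : Continuous (1 : ℝ → ℝ) := continuous_const
  rw [hE.dmoment_coord_mul hU hU1 c1, one_mul]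

theorem dmoment_one_coord_sq_mul (v : V) : dmoment E U 1 (υ * (υ * v)) =
    2 * moment E U U v + dmoment E U (U * U - 1) v + dmoment E U 1 v := by
  have c1 : Continuous (1 : ℝ → ℝ) := continuous_const
  rw [hE.dmoment_one_coord_mul hU hU1, hE.moment_coord_mul hU hU1 c1, one_mul,
    hE.dmoment_coord_mul hU hU1 hU, hE.dmoment_sub hU hU1 (hU.mul hU) c1, _root_.sub_apply]
  ring

theorem phys_zero_pressureCoeff (w : Wiener V) {t : ℝ} (ht : t < 0) (x : ℝ) :
    phys 0 (pressureCoeff E U w) t x = 1 / 2 * dmoment E U 1 (phys 0 w t x) -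
      1 / 2 * dmoment E U 1 (υ * (υ * phys 0 w t x) + υ * (phys 0 w t x * phys 0 w t x) +
        (1 / 3 : ℂ) • (phys 0 w t x * (phys 0 w t x * phys 0 w t x))) := by
  simp only [pressureCoeff, pressureRem, powers]
  rw [phys_sub 0 _ _ ht, phys_sub 0 _ _ ht, phys_sub 0 _ _ ht, phys_sub 0 _ _ ht,
    phys_smul 0 _ _ ht, phys_smul 0 _ _ ht, phys_smul 0 _ _ ht, phys_smul 0 _ _ ht,
    phys_wmap 0 _ _ ht, phys_wmap 0 _ _ ht, phys_wmap 0 _ _ ht, phys_wmap 0 _ _ ht,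
    phys_wmap 0 _ _ ht, phys_conv _ _ ht, phys_conv _ _ ht, phys_conv _ _ ht, map_add, map_add,
    map_smul, hE.dmoment_one_coord_sq_mul hU hU1, hE.dmoment_one_coord_mul hU hU1]
  simp only [smul_eq_mul]
  push_cast
  ring

theorem phys_one_pressureCoeff (w : Wiener V) {t : ℝ} (ht : t < 0) (x : ℝ) :
    phys 1 (pressureCoeff E U w) t x = 1 / 2 * dmoment E U 1 (phys 1 w t x) -
      1 / 2 * dmoment E U 1 (υ * (υ * phys 1 w t x) + (2 : ℂ) • (υ * (phys 0 w t x * phys 1 w t x)) +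
        phys 0 w t x * phys 0 w t x * phys 1 w t x) := by
  have h1 := hasDerivAt_phys_x 0 (pressureCoeff E U w) ht x
  have hx := hasDerivAt_phys_x 0 w ht x
  have hJ : ∀ {y : ℝ → V} {y' : V}, HasDerivAt y y' x →
      HasDerivAt (fun x => dmoment E U 1 (y x)) (dmoment E U 1 y') x := fun hy =>
    ((dmoment E U 1).restrictScalars ℝ).hasFDerivAt.comp_hasDerivAt x hy
  have h2 := ((hJ hx).const_mul (1 / 2 : ℂ)).sub
    ((hJ ((((hx.const_mul υ).const_mul υ).add ((hasDerivAt_phys_sq w ht x).const_mul υ)).add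
      ((hasDerivAt_phys_cube w ht x).const_smul (1 / 3 : ℂ)))).const_mul (1 / 2 : ℂ))
  have e : (fun x => phys 0 (pressureCoeff E U w) t x) = _ :=
    funext fun x => hE.phys_zero_pressureCoeff hU hU1 w ht x
  rw [e] at h1
  refine (h1.unique h2).trans ?_
  rw [smul_smul, mul_smul_comm]
  norm_num

end HolomorphicAlgebra

end Constraints

section Characteristics

/-- A function decaying in the past whose derivative is dominated by that of an increasing positive
barrier is dominated by the barrier. -/
theorem norm_le_of_ancient_barrier {T t : ℝ} (ht : t ≤ T) {f f' : ℝ → ℂ} {b b' : ℝ → ℝ}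
    (hf : ∀ s ≤ T, HasDerivAt f (f' s) s) (hb : ∀ s, HasDerivAt b (b' s) s)
    (hb0 : ∀ s, 0 ≤ b s) (hle : ∀ s ≤ T, ‖f' s‖ ≤ b' s) (hlim : Tendsto f atBot (nhds 0)) :
    ‖f t‖ ≤ b t := by
  have key : ∀ s ≤ t, ‖f t - f s‖ ≤ b t := fun s hs => by
    have h := image_norm_le_of_norm_deriv_right_le_deriv_boundary (f := fun r => f r - f s)
      (f' := f') (a := s) (b := t) (B := fun r => b r - b s) (B' := b')
      (fun r hr => ((hf r (hr.2.trans ht)).continuousAt.sub continuousAt_const).continuousWithinAt)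
      (fun r hr => ((hf r (hr.2.le.trans ht)).sub_const (f s)).hasDerivWithinAt)
      (by simp) (fun r => (hb r).sub_const _) (fun r hr => hle r (hr.2.le.trans ht))
      (right_mem_Icc.2 hs)
    have := hb0 s
    linarith
  have hl : Tendsto (fun s => ‖f t - f s‖) atBot (nhds ‖f t - 0‖) :=
    (tendsto_const_nhds.sub hlim).norm
  rw [sub_zero] at hl
  exact le_of_tendsto hl ((eventually_le_atBot t).mono key)

theorem eq_zero_of_forall_le_div_pow {y D : ℝ} (h : ∀ n : ℕ, y ≤ D / 2 ^ n) : y ≤ 0 := by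
  have h2 : Tendsto (fun n : ℕ => D / 2 ^ n) atTop (nhds 0) := by
    simpa [div_eq_mul_inv] using
      (tendsto_pow_atTop_nhds_zero_of_lt_one (r := (2 : ℝ)⁻¹) (by norm_num) (by norm_num)).const_mul D
  exact ge_of_tendsto' h2 h

/-- Uniqueness of the zero ancient solution of two transport equations coupled by an integrable
potential. -/
theorem eq_zero_of_ancient_transport {A B q : ℝ → ℝ → ℂ} {C D T : ℝ} (hC : 0 ≤ C) (hD : 0 ≤ D)
    (hT : T ≤ 0)
    (hA : ∀ y, ∀ s ≤ T, HasDerivAt (fun s => A s (y + s))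
      (-(q s (y + s) * ((A s (y + s) - B s (y + s)) / 2))) s)
    (hB : ∀ y, ∀ s ≤ T, HasDerivAt (fun s => B s (y - s))
      (-(q s (y - s) * ((A s (y - s) - B s (y - s)) / 2))) s)
    (hq : ∀ s ≤ T, ∀ x, ‖q s x‖ ≤ C * Real.exp (1 / 4 * s))
    (hAD : ∀ s ≤ T, ∀ x, ‖A s x‖ ≤ D * Real.exp (s / 2))
    (hBD : ∀ s ≤ T, ∀ x, ‖B s x‖ ≤ D * Real.exp (s / 2)) {t : ℝ} (ht : t ≤ T) (x : ℝ) :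
    A t x = 0 ∧ B t x = 0 := by
  let φ : ℝ → ℝ := fun s => Real.exp (8 * C * Real.exp (1 / 4 * s))
  have hφ : ∀ s, HasDerivAt φ (2 * C * Real.exp (1 / 4 * s) * φ s) s := fun s => by
    have := ((((hasDerivAt_id s).const_mul (1 / 4 : ℝ)).exp.const_mul (8 * C))).exp
    refine this.congr_deriv ?_
    simp only [φ, id]
    ring
  have hφ1 : ∀ s, 1 ≤ φ s := fun s => Real.one_le_exp (by positivity)
  have lim0 : Tendsto (fun s : ℝ => D * Real.exp (s / 2)) atBot (nhds 0) := by
    simpa using (Real.tendsto_exp_atBot.comp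
      (tendsto_id.atBot_div_const (r := (2 : ℝ)) (by norm_num))).const_mul D
  have limit : ∀ {F : ℝ → ℝ → ℂ}, (∀ s ≤ T, ∀ x, ‖F s x‖ ≤ D * Real.exp (s / 2)) →
      ∀ z : ℝ → ℝ, Tendsto (fun s => F s (z s)) atBot (nhds 0) := fun hF z =>
    squeeze_zero_norm' ((eventually_le_atBot T).mono fun s hs => hF s hs (z s)) lim0
  have key : ∀ n : ℕ, ∀ t ≤ T, ∀ x, ‖A t x‖ ≤ D / 2 ^ n * φ t ∧ ‖B t x‖ ≤ D / 2 ^ n * φ t := by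
    intro n
    induction n with
    | zero =>
      intro t ht x
      have h1 : Real.exp (t / 2) ≤ φ t := (Real.exp_le_one_iff.2 (by linarith)).trans (hφ1 t)
      have h2 := mul_le_mul_of_nonneg_left h1 hD
      simp only [pow_zero, div_one]
      exact ⟨(hAD t ht x).trans h2, (hBD t ht x).trans h2⟩
    | succ n ih =>
      intro t ht x
      have hb : ∀ s, HasDerivAt (fun s => D / 2 ^ (n + 1) * φ s)
          (D / 2 ^ (n + 1) * (2 * C * Real.exp (1 / 4 * s) * φ s)) s := fun s => (hφ s).const_mul _
      have hb0 : ∀ s, 0 ≤ D / 2 ^ (n + 1) * φ s := fun s => by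
        have := hφ1 s
        positivity
      have hle : ∀ s ≤ T, ∀ x, ‖-(q s x * ((A s x - B s x) / 2))‖ ≤
          D / 2 ^ (n + 1) * (2 * C * Real.exp (1 / 4 * s) * φ s) := fun s hs x => by
        obtain ⟨h1, h2⟩ := ih s hs x
        have h3 : ‖(A s x - B s x) / 2‖ ≤ D / 2 ^ n * φ s := by
          rw [norm_div]
          have := norm_sub_le (A s x) (B s x)
          norm_num
          linarith
        rw [norm_neg, norm_mul]
        refine (mul_le_mul (hq s hs x) h3 (norm_nonneg _) (by positivity)).trans_eq ?_
        rw [pow_succ]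
        field_simp
      constructor
      · have := norm_le_of_ancient_barrier (f := fun s => A s (x - t + s)) ht (hA (x - t)) hb hb0
          (fun s hs => hle s hs _) (limit hAD _)
        simpa using this
      · have := norm_le_of_ancient_barrier (f := fun s => B s (x + t - s)) ht (hB (x + t)) hb hb0
          (fun s hs => hle s hs _) (limit hBD _)
        simpa using this
  have fin : ∀ {y : ℂ}, (∀ n : ℕ, ‖y‖ ≤ D / 2 ^ n * φ t) → y = 0 := fun {y} h => by
    refine norm_le_zero_iff.1 (eq_zero_of_forall_le_div_pow (D := D * φ t) fun n => (h n).trans_eq ?_)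
    ring
  exact ⟨fin fun n => (key n t ht x).1, fin fun n => (key n t ht x).2⟩

end Characteristics

section VanishingConstraints

variable {V : Type*} [NormedCommRing V] [NormedAlgebra ℂ V] [CompleteSpace V]

theorem SmoothCoeff.hasDerivAt_line {w d : Wiener V} (hw : SmoothCoeff 1 w)
    (hcd : ∀ n t, t < 0 → HasDerivAt (w n)
      (-((|(n : ℝ)| / 2 : ℝ) : ℂ) • w n t + (Complex.I * n) • d n t) t) {s : ℝ} (hs : s < 0)
    (y σ : ℝ) : HasDerivAt (fun s => phys 0 w s (y + σ * s))
      (phys 1 d s (y + σ * s) + σ • phys 1 w s (y + σ * s)) s := by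
  have hd : DifferentiableAt ℝ (fun p : ℝ × ℝ => phys 0 w p.1 p.2) (s, y + σ * s) :=
    ((hw 0).differentiableOn (by simp)).differentiableAt
      ((isOpen_Iio.prod isOpen_univ).mem_nhds ⟨hs, mem_univ _⟩)
  have hf := hd.hasFDerivAt
  have h1 : HasDerivAt (fun r => phys 0 w r (y + σ * s)) _ s :=
    hf.comp_hasDerivAt_of_eq (f := fun r : ℝ => (r, y + σ * s)) s
      ((hasDerivAt_id s).prodMk (hasDerivAt_const s _)) rfl
  have h2 : HasDerivAt (fun r => phys 0 w s r) _ (y + σ * s) :=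
    hf.comp_hasDerivAt_of_eq (f := fun r : ℝ => (s, r)) (y + σ * s)
      ((hasDerivAt_const _ s).prodMk (hasDerivAt_id _)) rfl
  have h3 : HasDerivAt (fun r => phys 0 w r (y + σ * r)) _ s :=
    hf.comp_hasDerivAt_of_eq (f := fun r : ℝ => (r, y + σ * r)) s
      ((hasDerivAt_id s).prodMk (((hasDerivAt_id s).const_mul σ).const_add y)) rfl
  have e1 := h1.unique (hasDerivAt_phys_t 0 hcd hs _)
  have e2 := h2.unique (hasDerivAt_phys_x 0 w hs _)
  refine h3.congr_deriv ?_
  rw [← e1, ← e2, ← map_smul, ← map_add]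
  simp

namespace Wave

variable {E : ℂ → V →L[ℂ] ℂ} {υ : V} {U : ℝ → ℝ} {a : ℝ} {w : Wiener V} {f g p : Wiener ℂ}
  (h : Wave E υ U a w f g p) (hE : HolomorphicAlgebra E υ)
  (hU : Continuous U) (hU1 : ∀ θ, |U θ| < 1) (hU0 : ∫ θ in (-1 : ℝ)..1, U θ = 0)
include h hE hU hU1 hU0

/-- Transport of a characteristic combination of the two boundary constraints. -/
theorem hasDerivAt_constraint {σ : ℝ} (hσ : σ * σ = 1) {s : ℝ} (hs : s < 0) (y : ℝ) :
    HasDerivAt (fun s => dmoment E U 1 (υ * phys 0 w s (y + σ * s) +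
        (1 / 2 : ℂ) • (phys 0 w s (y + σ * s) * phys 0 w s (y + σ * s)) +
        σ • phys 0 w s (y + σ * s)))
      (-(phys 1 (pressureCoeff E U w) s (y + σ * s) * dmoment E U 1 (phys 0 w s (y + σ * s)))) s := by
  have hl := (h.smoothCoeff hE hU hU1 hU0 1).hasDerivAt_line (h.ode_momentum hE hU hU1 hU0) hs y σ
  have h2 := ((hl.const_mul υ).add ((hl.mul hl).const_smul (1 / 2 : ℂ))).add (hl.const_smul σ)
  refine (((dmoment E U 1).restrictScalars ℝ).hasFDerivAt.comp_hasDerivAt s h2).congr_deriv ?_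
  have c1 : Continuous (1 : ℝ → ℝ) := continuous_const
  have hP := hE.phys_one_pressureCoeff hU hU1 w hs (y + σ * s)
  have hJυ := hE.dmoment_one_coord hU hU1
  have hJ1 := hE.dmoment_one hU hU1 c1
  rw [phys_one_momentumFlux E υ U w hs]
  generalize phys 0 w s (y + σ * s) = W at *
  generalize phys 1 w s (y + σ * s) = X at *
  generalize phys 1 (pressureCoeff E U w) s (y + σ * s) = P at *
  show dmoment E U 1 _ = _
  have e : υ * (-(υ * X + P • (1 : V) + W * X) + σ • X) +
        (1 / 2 : ℂ) • ((-(υ * X + P • (1 : V) + W * X) + σ • X) * W +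
          W * (-(υ * X + P • (1 : V) + W * X) + σ • X)) +
        σ • (-(υ * X + P • (1 : V) + W * X) + σ • X) =
      X - (υ * (υ * X) + (2 : ℂ) • (υ * (W * X)) + W * W * X) - P • υ - P • W
        - ((σ : ℂ) * P) • (1 : V) := by
    have hσX : σ • σ • X = X := by rw [smul_smul, hσ, one_smul]
    have e1 : (1 / 2 : ℂ) • ((-(υ * X + P • (1 : V) + W * X) + σ • X) * W +
          W * (-(υ * X + P • (1 : V) + W * X) + σ • X)) =
        W * (-(υ * X + P • (1 : V) + W * X) + σ • X) := by
      rw [mul_comm _ W, ← two_smul ℂ, smul_smul]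
      norm_num
    rw [e1, smul_add, hσX]
    simp only [Algebra.smul_def, map_mul, IsScalarTower.algebraMap_apply ℝ ℂ V,
      Complex.coe_algebraMap, map_ofNat]
    ring
  refine (congrArg (dmoment E U 1) e).trans ?_
  rw [map_sub, map_sub, map_sub, map_sub, map_smul, map_smul, map_smul, hJυ, hJ1]
  simp only [smul_eq_mul]
  linear_combination -2 * hP

theorem constraints {t : ℝ} (ht : t ≤ -(1 / 4)) (x : ℝ) : dmoment E U 1 (phys 0 w t x) = 0 ∧
    dmoment E U 1 (υ * phys 0 w t x + (1 / 2 : ℂ) • (phys 0 w t x * phys 0 w t x)) = 0 := by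
  obtain ⟨C, hC, hCb⟩ := exists_norm_phys_le (V := V) 1 (show (0 : ℝ) < 1 / 4 by norm_num)
  set J := dmoment E U 1 with hJ
  let S : ℝ → ℝ → ℝ → ℂ := fun σ t x => J (υ * phys 0 w t x +
        (1 / 2 : ℂ) • (phys 0 w t x * phys 0 w t x) + σ • phys 0 w t x)
  have hW : ∀ s ≤ -(1 / 4 : ℝ), ∀ x, ‖phys 0 w s x‖ ≤ ‖w‖ * Real.exp (s / 2) := fun s hs x =>
    norm_phys_zero_le_exp w h.zero_w (by linarith) x
  have hW' : ∀ s ≤ -(1 / 4 : ℝ), ∀ x, ‖phys 0 w s x‖ ≤ ‖w‖ := fun s hs x =>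
    norm_phys_zero_le w (by linarith) x
  let D := ‖J‖ * ((‖υ‖ + 1 / 2 * ‖w‖ + 1) * ‖w‖)
  have hD : ∀ σ : ℝ, |σ| = 1 → ∀ s ≤ -(1 / 4 : ℝ), ∀ x, ‖S σ s x‖ ≤ D * Real.exp (s / 2) := by
    intro σ hσ s hs x
    have a1 := hW s hs x
    have a2 := hW' s hs x
    have n1 := norm_mul_le υ (phys 0 w s x)
    have n2 := norm_mul_le (phys 0 w s x) (phys 0 w s x)
    have n3 := norm_add₃_le (a := υ * phys 0 w s x) (b := (1 / 2 : ℂ) • (phys 0 w s x * phys 0 w s x))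
      (c := σ • phys 0 w s x)
    rw [norm_smul, norm_smul, Real.norm_eq_abs, hσ, one_mul] at n3
    have n4 : ‖(1 / 2 : ℂ)‖ = 1 / 2 := by norm_num
    rw [n4] at n3
    refine (J.le_opNorm _).trans ?_
    rw [mul_assoc]
    refine mul_le_mul_of_nonneg_left (n3.trans ?_) (norm_nonneg _)
    have m1 := mul_le_mul_of_nonneg_left a1 (norm_nonneg υ)
    have m2 := mul_le_mul a2 a1 (norm_nonneg _) (norm_nonneg _)
    nlinarith
  let Cq := 1 / 2 * (‖J‖ * (1 + ‖υ‖ * ‖υ‖ + 2 * (‖υ‖ * ‖w‖) + ‖w‖ * ‖w‖) * (C * ‖w‖))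
  have hq : ∀ s ≤ -(1 / 4 : ℝ), ∀ x, ‖phys 1 (pressureCoeff E U w) s x‖ ≤
      Cq * Real.exp (1 / 4 * s) := by
    intro s hs x
    have hs0 : s < 0 := by linarith
    rw [hE.phys_one_pressureCoeff hU hU1 w hs0, ← hJ]
    have a1 := hCb w h.zero_w s hs x
    have a2 := hW' s hs x
    generalize phys 0 w s x = W at *
    generalize phys 1 w s x = X at *
    rw [← mul_sub, ← map_sub, norm_mul]
    have n0 : ‖(1 / 2 : ℂ)‖ = 1 / 2 := by norm_num
    rw [n0]
    have e : Cq * Real.exp (1 / 4 * s) = 1 / 2 * (‖J‖ * ((1 + ‖υ‖ * ‖υ‖ + 2 * (‖υ‖ * ‖w‖) +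
        ‖w‖ * ‖w‖) * (C * ‖w‖ * Real.exp (1 / 4 * s)))) := by simp only [Cq]; ring
    rw [e]
    refine mul_le_mul_of_nonneg_left ((J.le_opNorm _).trans ?_) (by norm_num)
    refine mul_le_mul_of_nonneg_left ?_ (norm_nonneg _)
    refine le_trans ?_ (mul_le_mul_of_nonneg_left a1
      (show 0 ≤ 1 + ‖υ‖ * ‖υ‖ + 2 * (‖υ‖ * ‖w‖) + ‖w‖ * ‖w‖ by positivity))
    have b1 : ‖υ * (υ * X)‖ ≤ ‖υ‖ * ‖υ‖ * ‖X‖ := by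
      rw [← mul_assoc]
      exact (norm_mul_le _ _).trans (mul_le_mul_of_nonneg_right (norm_mul_le _ _) (norm_nonneg _))
    have b2 : ‖(2 : ℂ) • (υ * (W * X))‖ ≤ 2 * (‖υ‖ * ‖w‖) * ‖X‖ := by
      rw [norm_smul, ← mul_assoc, mul_assoc (2 : ℝ)]
      have : ‖(2 : ℂ)‖ = 2 := by norm_num
      rw [this]
      refine mul_le_mul_of_nonneg_left ((norm_mul_le _ _).trans ?_) (by norm_num)
      refine mul_le_mul_of_nonneg_right ((norm_mul_le _ _).trans ?_) (norm_nonneg _)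
      exact mul_le_mul_of_nonneg_left a2 (norm_nonneg _)
    have b3 : ‖W * W * X‖ ≤ ‖w‖ * ‖w‖ * ‖X‖ :=
      (norm_mul_le _ _).trans (mul_le_mul_of_nonneg_right ((norm_mul_le _ _).trans
        (mul_le_mul a2 a2 (norm_nonneg _) (norm_nonneg _))) (norm_nonneg _))
    have b4 := norm_sub_le X (υ * (υ * X) + (2 : ℂ) • (υ * (W * X)) + W * W * X)
    have b5 := norm_add₃_le (a := υ * (υ * X)) (b := (2 : ℂ) • (υ * (W * X))) (c := W * W * X)
    linarith
  have hp : ∀ {r : ℝ}, r ≤ -(1 / 4) → r < 0 := fun hr => by linarith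
  have hdiff : ∀ s x, (S 1 s x - S (-1) s x) / 2 = J (phys 0 w s x) := fun s x => by
    simp only [S, map_add, one_smul, neg_smul, map_neg]
    ring
  obtain ⟨hA, hB⟩ := eq_zero_of_ancient_transport (A := S 1) (B := S (-1))
    (q := phys 1 (pressureCoeff E U w)) (C := Cq) (D := D) (T := -(1 / 4)) (by positivity)
    (by positivity) (by norm_num)
    (fun y s hs => by
      rw [hdiff]
      simpa only [one_mul] using h.hasDerivAt_constraint hE hU hU1 hU0 (σ := 1) (by norm_num) (hp hs) y)
    (fun y s hs => by
      rw [hdiff]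
      simpa only [neg_mul, one_mul, ← sub_eq_add_neg] using
        h.hasDerivAt_constraint hE hU hU1 hU0 (σ := -1) (by norm_num) (hp hs) y)
    hq (hD 1 (by norm_num)) (hD (-1) (by norm_num)) ht x
  have h0 := hdiff t x
  rw [hA, hB] at h0
  have h1 : J (phys 0 w t x) = 0 := by simpa using h0.symm
  refine ⟨h1, ?_⟩
  simp only [S] at hA
  rw [map_add, one_smul, h1, add_zero] at hA
  exact hA

end Wave

end VanishingConstraints

section Cutoff

/-- A smooth function equal to the identity in the past and bounded away from zero. -/
theorem exists_time_cutoff : ∃ χ : ℝ → ℝ, ContDiff ℝ (⊤ : ℕ∞) χ ∧ (∀ t ≤ -(3 / 4 : ℝ), χ t = t) ∧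
    ∀ t, χ t ≤ -(1 / 2 : ℝ) := by
  let ρ : ℝ → ℝ := fun t => Real.smoothTransition (4 * (t + 3 / 4))
  have hρ : ContDiff ℝ (⊤ : ℕ∞) ρ := Real.smoothTransition.contDiff.comp (by fun_prop)
  refine ⟨fun t => (1 - ρ t) * t + ρ t * -(1 / 2 : ℝ), by fun_prop, fun t ht => ?_, fun t => ?_⟩
  · have : ρ t = 0 := Real.smoothTransition.zero_of_nonpos (by linarith)
    simp [this]
  · have h0 : 0 ≤ ρ t := Real.smoothTransition.nonneg _
    have h1 : ρ t ≤ 1 := Real.smoothTransition.le_one _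
    rcases le_total t (-(1 / 2)) with ht | ht
    · show (1 - ρ t) * t + ρ t * -(1 / 2 : ℝ) ≤ -(1 / 2 : ℝ)
      nlinarith
    · have : ρ t = 1 := Real.smoothTransition.one_of_one_le (by linarith)
      simp [this]

end Cutoff

section Readout

variable {V : Type*} [NormedCommRing V] [NormedAlgebra ℂ V] [CompleteSpace V]

/-- The real part of a family of functionals evaluated along a space-time profile. -/
noncomputable def readout (Λ : ℝ → V →L[ℂ] ℂ) (Y : ℝ → ℝ → V) (t x θ : ℝ) : ℝ := (Λ θ (Y t x)).re

theorem smooth3_readout {Λ : ℝ → V →L[ℂ] ℂ} {Y : ℝ → ℝ → V} (hΛ : ContDiff ℝ (⊤ : ℕ∞) Λ)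
    (hY : ContDiff ℝ (⊤ : ℕ∞) fun p : ℝ × ℝ => Y p.1 p.2) : Smooth3 (readout Λ Y) := by
  have h1 : ContDiff ℝ (⊤ : ℕ∞) fun p : ℝ × ℝ × ℝ => (Λ p.2.2).restrictScalars ℝ :=
    (ContinuousLinearMap.restrictScalarsL ℂ V ℂ ℝ ℝ).contDiff.comp (hΛ.comp contDiff_snd.snd)
  have h2 : ContDiff ℝ (⊤ : ℕ∞) fun p : ℝ × ℝ × ℝ => Y p.1 p.2.1 :=
    hY.comp (contDiff_fst.prodMk contDiff_snd.fst)
  exact Complex.reCLM.contDiff.comp (h1.clm_apply h2)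

theorem hasDerivAt_re {y : ℝ → ℂ} {y' : ℂ} {s : ℝ} (h : HasDerivAt y y' s) :
    HasDerivAt (fun s => (y s).re) y'.re s := (Complex.reCLM.hasFDerivAt.comp_hasDerivAt s h :)

theorem hasDerivAt_re_apply (L : V →L[ℂ] ℂ) {y : ℝ → V} {y' : V} {s : ℝ} (h : HasDerivAt y y' s) :
    HasDerivAt (fun s => (L (y s)).re) (L y').re s :=
  hasDerivAt_re ((L.restrictScalars ℝ).hasFDerivAt.comp_hasDerivAt s h)

theorem hasDerivAt_readout {Λ : ℝ → V →L[ℂ] ℂ} {Λ' : V →L[ℂ] ℂ} {θ : ℝ} (h : HasDerivAt Λ Λ' θ)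
    (y : V) : HasDerivAt (fun θ => (Λ θ y).re) (Λ' y).re θ :=
  hasDerivAt_re (((ContinuousLinearMap.apply ℂ ℂ y).restrictScalars ℝ).hasFDerivAt.comp_hasDerivAt θ h :)

theorem d3_readout {Λ : ℝ → V →L[ℂ] ℂ} (hΛ : ContDiff ℝ (⊤ : ℕ∞) Λ) (Y : ℝ → ℝ → V) :
    d3 (readout Λ Y) = readout (deriv Λ) Y := by
  funext t x θ
  exact (hasDerivAt_readout ((hΛ.differentiable (by simp)) θ).hasDerivAt (Y t x)).deriv

theorem d2_readout (Λ : ℝ → V →L[ℂ] ℂ) {Y Y' : ℝ → ℝ → V}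
    (hY : ∀ t x, HasDerivAt (Y t) (Y' t x) x) : d2 (readout Λ Y) = readout Λ Y' := by
  funext t x θ
  exact (hasDerivAt_re_apply (Λ θ) (hY t x)).deriv

theorem boundedDerivs_readout {χ : ℝ → ℝ} (hχ : ∀ t ≤ -(3 / 4 : ℝ), χ t = t)
    (hχ0 : ∀ t, χ t ≤ -(1 / 2 : ℝ)) {w : Wiener V} (hw : w 0 = 0) (n : ℕ) :
    ∀ (j : ℕ) (Λ : ℝ → V →L[ℂ] ℂ), ContDiff ℝ (⊤ : ℕ∞) Λ → BoundedDerivs (-1)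
      (fun t => Real.exp (1 / 4 * t)) n (readout Λ fun t x => phys j w (χ t) x) := by
  have base : ∀ (j : ℕ) (Λ : ℝ → V →L[ℂ] ℂ), ContDiff ℝ (⊤ : ℕ∞) Λ → ∃ C, ∀ t ≤ (-1 : ℝ), ∀ x,
      ∀ θ ∈ Icc (-1 : ℝ) 1, |readout Λ (fun t x => phys j w (χ t) x) t x θ| ≤
        C * Real.exp (1 / 4 * t) := by
    intro j Λ hΛ
    obtain ⟨C, hC, hCb⟩ := exists_norm_phys_le (V := V) j (show (0 : ℝ) < 1 by norm_num)
    obtain ⟨M, hM⟩ := (isCompact_Icc (a := (-1 : ℝ)) (b := 1)).exists_bound_of_continuousOn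
      hΛ.continuous.continuousOn
    refine ⟨M * (C * ‖w‖), fun t ht x θ hθ => ?_⟩
    have h1 := hCb w hw t ht x
    have h2 := hM θ hθ
    have h3 := (Λ θ).le_opNorm (phys j w (χ t) x)
    rw [hχ t (by linarith)] at h3
    simp only [readout]
    rw [hχ t (by linarith)]
    refine (Complex.abs_re_le_norm _).trans (h3.trans ?_)
    rw [mul_assoc]
    exact mul_le_mul h2 h1 (norm_nonneg _) ((norm_nonneg _).trans h2)
  induction n with
  | zero => exact base
  | succ n ih =>
    intro j Λ hΛ
    refine ⟨base j Λ hΛ, ?_, ?_⟩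
    · rw [d2_readout Λ (Y' := fun t x => phys (j + 1) w (χ t) x) fun t x =>
        hasDerivAt_phys_x j w (by linarith [hχ0 t]) x]
      exact ih (j + 1) Λ hΛ
    · rw [d3_readout hΛ]
      exact ih j _ (contDiff_infty_iff_deriv.1 hΛ).2

/-- The primitive of the derivative functionals along the shear. -/
noncomputable def heightFunctional (E : ℂ → V →L[ℂ] ℂ) (U : ℝ → ℝ) (θ : ℝ) : V →L[ℂ] ℂ :=
  ∫ s in (-1 : ℝ)..θ, deriv E (U s : ℂ)

namespace HolomorphicAlgebra

variable {E : ℂ → V →L[ℂ] ℂ} {υ : V} (hE : HolomorphicAlgebra E υ) {U : ℝ → ℝ}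
  (hU : ContDiff ℝ (⊤ : ℕ∞) U) (hU1 : ∀ θ, |U θ| < 1)
include hE hU hU1

theorem hasDerivAt_heightFunctional (θ : ℝ) :
    HasDerivAt (heightFunctional E U) (deriv E (U θ : ℂ)) θ := by
  have hc := hE.continuous_deriv_eval_shear hU.continuous hU1
  exact intervalIntegral.integral_hasDerivAt_right (hc.intervalIntegrable _ _)
    (hc.stronglyMeasurableAtFilter _ _) hc.continuousAt

theorem contDiff_deriv_eval_shear : ContDiff ℝ (⊤ : ℕ∞) fun θ => deriv E (U θ : ℂ) :=
  hE.contDiffOn_deriv_eval.comp_contDiff hU fun θ => abs_lt_two_of_lt_one (hU1 θ)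

theorem contDiff_heightFunctional : ContDiff ℝ (⊤ : ℕ∞) (heightFunctional E U) := by
  refine contDiff_infty_iff_deriv.2
    ⟨fun θ => (hE.hasDerivAt_heightFunctional hU hU1 θ).differentiableAt, ?_⟩
  rw [show deriv (heightFunctional E U) = fun θ => deriv E (U θ : ℂ) from
    funext fun θ => (hE.hasDerivAt_heightFunctional hU hU1 θ).deriv]
  exact hE.contDiff_deriv_eval_shear hU hU1

theorem heightFunctional_one_apply (θ : ℝ) : heightFunctional E U θ 1 = 0 := by
  have hc := hE.continuous_deriv_eval_shear hU.continuous hU1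
  rw [heightFunctional, ContinuousLinearMap.intervalIntegral_apply (hc.intervalIntegrable _ _)]
  simp only [fun s => hE.deriv_eval_one (abs_lt_two_of_lt_one (hU1 s)),
    intervalIntegral.integral_zero]

theorem heightFunctional_top : heightFunctional E U 1 = dmoment E U 1 := by
  simp [heightFunctional, dmoment]

end HolomorphicAlgebra

end Readout

section RealPart

variable {V : Type*} [NormedCommRing V] [NormedAlgebra ℂ V] [CompleteSpace V]

theorem mode_neg (n : ℤ) (t x : ℝ) : mode (-n) t x = starRingEnd ℂ (mode n t x) := by
  rw [mode, mode, ← Complex.exp_conj]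
  simp [Complex.conj_ofNat]

theorem Conjugate.phys {c d : Wiener ℂ} (h : Conjugate c d) (t x : ℝ) :
    phys 0 d t x = starRingEnd ℂ (phys 0 c t x) := by
  simp only [_root_.phys, pow_zero, one_mul]
  rw [← (Equiv.neg ℤ).tsum_eq, Complex.conj_tsum]
  refine tsum_congr fun n => ?_
  simp only [Equiv.neg_apply, smul_eq_mul, map_mul]
  rw [mode_neg, h]

theorem RealProfile.eval_phys {E : ℂ → V →L[ℂ] ℂ} {w : Wiener V} (h : RealProfile E w) {v : ℝ}
    (hv : |v| < 2) {t : ℝ} (ht : t < 0) (x : ℝ) :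
    E v (phys 0 w t x) = starRingEnd ℂ (E v (phys 0 w t x)) := by
  rw [← phys_wmap 0 (E v) w ht x]
  exact Conjugate.phys (c := wmap (E v) w) (d := wmap (E v) w) (fun n t => h n t v hv) t x

end RealPart

section FlowOfWave

variable {V : Type*} [NormedCommRing V] [NormedAlgebra ℂ V] [CompleteSpace V]

namespace Wave

variable {E : ℂ → V →L[ℂ] ℂ} {υ : V} {U : ℝ → ℝ} {a : ℝ} {w : Wiener V} {f g p : Wiener ℂ}
  (h : Wave E υ U a w f g p) (hE : HolomorphicAlgebra E υ)
include h hE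

theorem eval_im {v : ℝ} (hv : |v| < 2) {t : ℝ} (ht : t < 0) (x : ℝ) :
    (E v (phys 0 w t x)).im = 0 :=
  Complex.conj_eq_iff_im.1 (h.real_w.eval_phys hv ht x).symm

theorem deriv_eval_im {v : ℝ} (hv : |v| < 2) {t : ℝ} (ht : t < 0) (x : ℝ) :
    (deriv E (v : ℂ) (phys 0 w t x)).im = 0 :=
  Complex.conj_eq_iff_im.1
    (hE.deriv_eval_conj (fun _ hv => h.real_w.eval_phys hv ht x) hv).symm

theorem deriv_eval_flux {v : ℝ} (hv : |v| < 2) (Y : V) :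
    deriv E (v : ℂ) (υ * Y + (1 / 2 : ℂ) • (Y * Y)) =
      E v Y + v * deriv E (v : ℂ) Y + E v Y * deriv E (v : ℂ) Y := by
  rw [map_add, map_smul, hE.deriv_eval_mul hv, hE.deriv_eval_mul hv, hE.deriv_eval_coord hv,
    hE.eval_coord _ (ofReal_mem_velRect hv), smul_eq_mul]
  ring

omit h hE in
theorem _root_.SmoothCoeff.contDiff_comp {c : Wiener V} (hc : ∀ k, SmoothCoeff k c) {χ : ℝ → ℝ}
    (hχ : ContDiff ℝ (⊤ : ℕ∞) χ) (hχ0 : ∀ t, χ t < 0) (j : ℕ) :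
    ContDiff ℝ (⊤ : ℕ∞) fun p : ℝ × ℝ => phys j c (χ p.1) p.2 := by
  have h1 : ContDiffOn ℝ (⊤ : ℕ∞) (fun p : ℝ × ℝ => phys j c p.1 p.2) (Iio 0 ×ˢ univ) :=
    contDiffOn_infty.2 fun k => hc k j
  exact h1.comp_contDiff (f := fun p : ℝ × ℝ => (χ p.1, p.2))
    ((hχ.comp contDiff_fst).prodMk contDiff_snd) fun p => ⟨hχ0 _, mem_univ _⟩

variable (hU : ContDiff ℝ (⊤ : ℕ∞) U) (hU1 : ∀ θ, |U θ| < 1) (hU0 : ∫ θ in (-1 : ℝ)..1, U θ = 0)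
include hU hU1 hU0

/-- The leading mode keeps the derivative of the profile from vanishing identically. -/
theorem exists_deriv_eval_ne_zero (ha : 0 < a) :
    ∃ θ ∈ Ioo (-1 : ℝ) 1, deriv E (U θ : ℂ) (phys 0 w (-2) 0) ≠ 0 := by
  by_contra! hcon
  set W := phys 0 w (-2) 0 with hW
  have hUc := hU.continuous
  have c1 : Continuous (1 : ℝ → ℝ) := continuous_const
  have hd : ∀ θ ∈ Icc (-1 : ℝ) 1, deriv E (U θ : ℂ) W = 0 := by
    have hc : Continuous fun θ => deriv E (U θ : ℂ) W :=
      (hE.continuous_deriv_eval_shear hUc hU1).clm_apply continuous_const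
    have hcl : IsClosed {θ | deriv E (U θ : ℂ) W = 0} := isClosed_eq hc continuous_const
    rw [← closure_Ioo (show (-1 : ℝ) ≠ 1 by norm_num)]
    exact fun θ hθ => hcl.closure_subset_iff.2 hcon hθ
  have hconst : ∀ θ ∈ Icc (-1 : ℝ) 1, E (U θ) W = E (U (-1)) W := by
    have hder : ∀ θ, HasDerivAt (fun θ => E (U θ) W) (deriv U θ • deriv E (U θ : ℂ) W) θ := fun θ =>
      (hE.hasDerivAt_eval_apply (HolomorphicAlgebra.abs_lt_two_of_lt_one (hU1 θ)) W).scomp θ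
        ((hU.differentiable (by simp)) θ).hasDerivAt
    refine constant_of_has_deriv_right_zero
      (fun θ _ => (hder θ).continuousAt.continuousWithinAt) fun θ hθ => ?_
    have := (hder θ).hasDerivWithinAt (s := Ici θ)
    rwa [hd θ (Ico_subset_Icc_self hθ), smul_zero] at this
  have h01 : uIcc (-1 : ℝ) 1 = Icc (-1) 1 := uIcc_of_le (by norm_num)
  have hc0 : E (U (-1)) W = 0 := by
    have hM := (h.constraints hE hUc hU1 hU0 (t := -2) (by norm_num) 0).2
    rw [← hW, hE.dmoment_apply hUc hU1 c1, intervalIntegral.integral_congr (g := fun _ => E (U (-1)) W)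
      fun θ hθ => by
        rw [h01] at hθ
        simp only [h.deriv_eval_flux hE (HolomorphicAlgebra.abs_lt_two_of_lt_one (hU1 θ)), hd θ hθ,
          hconst θ hθ]
        simp] at hM
    simpa using hM
  have hmom : ∀ κ : ℝ → ℝ, Continuous κ → moment E U κ W = 0 := fun κ hκ => by
    rw [hE.moment_apply hUc hU1 hκ, intervalIntegral.integral_congr (g := fun _ => (0 : ℂ))
      fun θ hθ => by
        rw [h01] at hθ
        simp [hconst θ hθ, hc0]]
    simp
  have hf : phys 0 f (-2) 0 = 0 := by
    have e : phys 0 f (-2) 0 = (moment E U 1 + Complex.I • moment E U U) W := by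
      rw [hW, ← phys_wmap 0 _ w (by norm_num)]
      refine tsum_congr fun n => ?_
      obtain ⟨e1, e2⟩ := h.consistent hE hUc hU1 hU0 n (show (-2 : ℝ) < 0 by norm_num)
      congr 1
      show f n (-2) = moment E U 1 (w n (-2)) + Complex.I * moment E U U (w n (-2))
      rw [e1, e2]
      linear_combination (1 / 2 * (f n (-2) - g n (-2))) * Complex.I_mul_I
    rw [e, _root_.add_apply, hmom 1 c1, _root_.smul_apply, hmom U hUc]
    simp
  obtain ⟨r, hr0, hr, hfr⟩ := h.lead
  rw [hfr, phys_add 0 _ _ (by norm_num), phys_single, seed_apply, add_eq_zero_iff_eq_neg] at hf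
  have h1 := congrArg norm hf
  rw [norm_neg, norm_smul, norm_mode, Complex.norm_real, Real.norm_eq_abs,
    min_eq_left (by norm_num)] at h1
  have h2 := norm_phys_zero_le_exp r hr0 (show (-2 : ℝ) ≤ 0 by norm_num) 0
  norm_num at h1 h2
  have h3 : (1 / 3 : ℝ) < Real.exp (-1) := by
    rw [Real.exp_neg, one_div]
    have := Real.exp_one_lt_d9
    exact inv_strictAnti₀ (Real.exp_pos 1) (by linarith)
  rw [abs_of_pos ha] at h1
  have h4 := mul_le_mul_of_nonneg_right hr (Real.exp_pos (-1)).le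
  have h5 : a * Real.exp (-1) ≤ a / 10 :=
    le_of_mul_le_mul_left (by linarith) (Real.exp_pos (-1))
  nlinarith

theorem exists_ancientFlow (ha : 0 < a) (ha' : a ≤ 1 / 10 ^ 6)
    (hinj : ∀ b c, deriv U b = deriv U c → b = c ∨ b = -c) :
    ∃ Z Q u, AncientFlow U Z Q u (-1) (1 / 4) := by
  obtain ⟨χ, hχ, hχid, hχle⟩ := exists_time_cutoff
  have hχ0 : ∀ t, χ t < 0 := fun t => (hχle t).trans_lt (by norm_num)
  have hUc := hU.continuous
  set ζ := heightFunctional E U with hζ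
  have hζ' := hE.hasDerivAt_heightFunctional hU hU1
  have hζs := hE.contDiff_heightFunctional hU hU1
  let W : ℝ → ℝ → V := fun t x => phys 0 w (χ t) x
  let X : ℝ → ℝ → V := fun t x => phys 1 w (χ t) x
  let Y : ℝ → ℝ → V := fun t x => υ * W t x + (1 / 2 : ℂ) • (W t x * W t x)
  have hWs : ContDiff ℝ (⊤ : ℕ∞) fun p : ℝ × ℝ => W p.1 p.2 :=
    SmoothCoeff.contDiff_comp (h.smoothCoeff hE hUc hU1 hU0) hχ hχ0 0
  have hYs : ContDiff ℝ (⊤ : ℕ∞) fun p : ℝ × ℝ => Y p.1 p.2 :=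
    (contDiff_const.mul hWs).add ((hWs.mul hWs).const_smul (1 / 2 : ℂ))
  have hWx : ∀ t x, HasDerivAt (W t) (X t x) x := fun t x => hasDerivAt_phys_x 0 w (hχ0 t) x
  have hYx : ∀ t x, HasDerivAt (Y t) (υ * X t x + W t x * X t x) x := fun t x => by
    refine (((hWx t x).const_mul υ).add
      ((hasDerivAt_phys_sq w (hχ0 t) x).const_smul (1 / 2 : ℂ))).congr_deriv ?_
    rw [smul_smul]
    norm_num
    rfl
  have hWper : ∀ t x, W t (x + 2 * Real.pi) = W t x := fun t x => phys_periodic 0 w (χ t) x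
  have hYper : ∀ t x, Y t (x + 2 * Real.pi) = Y t x := fun t x => by simp only [Y, hWper]
  have hZ3 : ∀ t x θ, HasDerivAt (fun θ => θ + readout ζ W t x θ)
      (1 + (deriv E (U θ : ℂ) (W t x)).re) θ := fun t x θ =>
    (hasDerivAt_id θ).add (hasDerivAt_readout (hζ' θ) (W t x))
  have hQ3 : ∀ t x θ, HasDerivAt (fun θ => (∫ s in (-1 : ℝ)..θ, U s) + readout ζ Y t x θ)
      (U θ + (deriv E (U θ : ℂ) (Y t x)).re) θ := fun t x θ =>
    (intervalIntegral.integral_hasDerivAt_right (hUc.intervalIntegrable _ _)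
      (hUc.stronglyMeasurableAtFilter _ _) hUc.continuousAt).add
      (hasDerivAt_readout (hζ' θ) (Y t x))
  have hWt : ∀ t ≤ (-1 : ℝ), ∀ x, HasDerivAt (fun t => W t x)
      (-(υ * X t x + phys 1 (pressureCoeff E U w) t x • (1 : V) + W t x * X t x)) t := by
    intro t ht x
    have e : χ t = t := hχid t (by linarith)
    have h1 := hasDerivAt_phys_t 0 (h.ode_momentum hE hUc hU1 hU0)
      (show t < 0 by linarith) x
    rw [phys_one_momentumFlux E υ U w (by linarith)] at h1
    simp only [X, W, e]
    refine h1.congr_of_eventuallyEq ?_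
    filter_upwards [Iio_mem_nhds (show t < -(3 / 4 : ℝ) by linarith)] with s hs
    rw [hχid s (le_of_lt hs)]
  have hconstr : ∀ t x, dmoment E U 1 (W t x) = 0 ∧ dmoment E U 1 (Y t x) = 0 := fun t x =>
    h.constraints hE hUc hU1 hU0 (by linarith [hχle t]) x
  have hUs : ContDiff ℝ (⊤ : ℕ∞) fun θ => ∫ s in (-1 : ℝ)..θ, U s := by
    have hd : ∀ θ, HasDerivAt (fun θ => ∫ s in (-1 : ℝ)..θ, U s) (U θ) θ := fun θ =>
      intervalIntegral.integral_hasDerivAt_right (hUc.intervalIntegrable _ _)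
        (hUc.stronglyMeasurableAtFilter _ _) hUc.continuousAt
    refine contDiff_infty_iff_deriv.2 ⟨fun θ => (hd θ).differentiableAt, ?_⟩
    rw [show deriv (fun θ => ∫ s in (-1 : ℝ)..θ, U s) = U from funext fun θ => (hd θ).deriv]
    exact hU
  refine ⟨fun t x θ => θ + readout ζ W t x θ,
    fun t x θ => (∫ s in (-1 : ℝ)..θ, U s) + readout ζ Y t x θ,
    fun t x θ => U θ + (E (U θ) (W t x)).re, ?_⟩
  exact {
    smooth_shear := hU
    shear_inj := hinj
    rate_pos := by norm_num
    smoothZ := Smooth3.thd.add (smooth3_readout hζs hWs)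
    smoothQ := Smooth3.add (Smooth3.comp1 hUs Smooth3.thd) (smooth3_readout hζs hYs)
    periodicZ := fun t x θ => by simp only [readout, hWper]
    periodicQ := fun t x θ => by simp only [readout, hYper]
    half_le := fun t x θ => by
      rw [d3, (hZ3 t x θ).deriv]
      have h1 := (deriv E (U θ : ℂ)).le_of_opNorm_le (hE.norm_deriv_eval_le (hU1 θ).le) (W t x)
      have h2 : ‖W t x‖ ≤ 8 * a := (norm_phys_zero_le w (hχ0 t).le x).trans h.norm_w
      have h3 := Complex.abs_re_le_norm (deriv E (U θ : ℂ) (W t x))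
      have h4 := neg_abs_le (deriv E (U θ : ℂ) (W t x)).re
      norm_num at ha'
      linarith
    continuity := fun t ht x θ => by
      have h1 : HasDerivAt (fun t => θ + readout ζ W t x θ) _ t :=
        (hasDerivAt_re_apply (ζ θ) (hWt t ht x)).const_add θ
      have h2 : HasDerivAt (fun x => (∫ s in (-1 : ℝ)..θ, U s) + readout ζ Y t x θ) _ x :=
        (hasDerivAt_re_apply (ζ θ) (hYx t x)).const_add _
      rw [d1, d2, h1.deriv, h2.deriv, map_neg, map_add, map_add, map_smul,
        hE.heightFunctional_one_apply hU hU1, map_add]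
      simp
    flux := fun t ht x θ => by
      have hv := HolomorphicAlgebra.abs_lt_two_of_lt_one (hU1 θ)
      rw [d3, d3, (hQ3 t x θ).deriv, (hZ3 t x θ).deriv, h.deriv_eval_flux hE hv]
      have i1 := h.eval_im hE hv (hχ0 t) x
      have i2 := h.deriv_eval_im hE hv (hχ0 t) x
      simp only [Complex.add_re, Complex.mul_re, Complex.ofReal_re, Complex.ofReal_im, W, i1, i2]
      ring
    vorticity := fun t ht x θ => by
      have hv := HolomorphicAlgebra.abs_lt_two_of_lt_one (hU1 θ)
      have hUd := ((hU.differentiable (by simp)) θ).hasDerivAt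
      rw [d3, (hZ3 t x θ).deriv]
      refine (hUd.add (hasDerivAt_re ((hE.hasDerivAt_eval_apply hv (W t x)).scomp θ hUd))).congr_deriv ?_
      simp only [Complex.smul_re, smul_eq_mul]
      ring
    bottomZ := fun t _ x => by simp [readout, hζ, heightFunctional]
    topZ := fun t _ x => by
      simp [readout, hζ, hE.heightFunctional_top hU hU1, (hconstr t x).1]
    bottomQ := fun t _ x => by simp [readout, hζ, heightFunctional]
    topQ := fun t _ x => by
      simp [readout, hζ, hE.heightFunctional_top hU hU1, (hconstr t x).2, hU0]
    decay := fun n => by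
      simpa only [add_sub_cancel_left] using
        boundedDerivs_readout hχid hχle h.zero_w n 0 ζ hζs
    nontrivial := by
      obtain ⟨θ, hθ, hne⟩ := h.exists_deriv_eval_ne_zero hE hU hU1 hU0 ha
      have e : χ (-2) = -2 := hχid _ (by norm_num)
      by_contra! hcon
      refine hne (Complex.ext ?_ (h.deriv_eval_im hE
        (HolomorphicAlgebra.abs_lt_two_of_lt_one (hU1 θ)) (by norm_num) 0))
      have h1 := hZ3 (-2) 0 θ
      have h2 : HasDerivAt (fun θ => θ + readout ζ W (-2) 0 θ) 1 θ := by
        refine (hasDerivAt_id θ).congr_of_eventuallyEq ?_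
        filter_upwards [Ioo_mem_nhds hθ.1 hθ.2] with s hs
        exact hcon (-2) (by norm_num) 0 s hs
      have h3 := h1.unique h2
      simp only [W, e] at h3
      simpa using h3 }

end Wave

end FlowOfWave

section ConcreteAlgebra

/-- A bounded, pointwise holomorphic family of functionals is holomorphic in operator norm. -/
theorem differentiableOn_of_pointwise {V : Type*} [NormedAddCommGroup V] [NormedSpace ℂ V]
    {E : ℂ → V →L[ℂ] ℂ} {s : Set ℂ} (hs : IsOpen s) (hE : ∀ z ∈ s, ‖E z‖ ≤ 1)
    (hd : ∀ v, DifferentiableOn ℂ (fun z => E z v) s) : DifferentiableOn ℂ E s := by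
  have hcont : ContinuousOn E s := by
    intro c hc
    obtain ⟨R, hR, hball⟩ := Metric.isOpen_iff.1 hs c hc
    refine ContinuousAt.continuousWithinAt ?_
    have key : ∀ z ∈ Metric.ball c R, ‖E z - E c‖ ≤ 2 / R * dist z c := by
      intro z hz
      refine ContinuousLinearMap.opNorm_le_bound _ (by positivity) fun v => ?_
      have h := Complex.dist_le_div_mul_dist_of_mapsTo_ball (f := fun z => E z v)
        (R₂ := 2 * ‖v‖) ((hd v).mono hball) (fun y hy => ?_) hz
      · rw [dist_eq_norm] at h
        calc ‖(E z - E c) v‖ = ‖E z v - E c v‖ := rfl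
          _ ≤ _ := h
          _ = _ := by ring
      · rw [Metric.mem_closedBall, dist_eq_norm]
        have h1 := (E y).le_of_opNorm_le (hE y (hball hy)) v
        have h2 := (E c).le_of_opNorm_le (hE c hc) v
        exact (norm_sub_le _ _).trans (by linarith)
    rw [ContinuousAt, tendsto_iff_norm_sub_tendsto_zero]
    refine squeeze_zero' (Eventually.of_forall fun _ => norm_nonneg _)
      (Filter.eventually_of_mem (Metric.ball_mem_nhds c hR) key) ?_
    have : Continuous fun z => 2 / R * dist z c := by fun_prop
    simpa using this.tendsto c
  intro c hc
  obtain ⟨R, hR, hball⟩ := Metric.nhds_basis_closedBall.mem_iff.1 (hs.mem_nhds hc)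
  lift R to NNReal using hR.le
  have hcirc : CircleIntegrable E c R :=
    (hcont.mono (Metric.sphere_subset_closedBall.trans hball)).circleIntegrable hR.le
  have hps := hasFPowerSeriesOn_cauchy_integral hcirc hR
  have han := hps.analyticAt.differentiableAt
  refine DifferentiableAt.differentiableWithinAt (han.congr_of_eventuallyEq ?_)
  filter_upwards [Metric.ball_mem_nhds c hR] with w hw
  ext v
  have hcau := Complex.two_pi_I_inv_smul_circleIntegral_sub_inv_smul_of_differentiable_on_off_countable
    (f := fun z => E z v) countable_empty hw ((hd v).continuousOn.mono hball)
    (fun x hx => (hd v).differentiableAt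
      (hs.mem_nhds (hball (Metric.ball_subset_closedBall hx.1))))
  rw [← hcau]
  simp only [_root_.smul_apply]
  congr 1
  have hint2 : CircleIntegrable (fun z => (z - w)⁻¹ • E z) c R := by
    have hsub : ContinuousOn (fun z => z - w) (Metric.sphere c R) := by fun_prop
    refine ContinuousOn.circleIntegrable hR.le ((hsub.inv₀ ?_).smul
      (hcont.mono (Metric.sphere_subset_closedBall.trans hball)))
    intro z hz hzw
    rw [sub_eq_zero.1 hzw] at hz
    rw [Metric.mem_sphere] at hz
    rw [Metric.mem_ball] at hw
    exact hw.ne hz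
  simp only [circleIntegral]
  rw [ContinuousLinearMap.intervalIntegral_apply hint2.out]
  rfl

/-- The extension by zero of a function on the strip of velocities. -/
noncomputable def extendVel (f : BoundedContinuousFunction velRect ℂ) (z : ℂ) : ℂ :=
  open Classical in if h : z ∈ velRect then f ⟨z, h⟩ else 0

theorem extendVel_of_mem (f : BoundedContinuousFunction velRect ℂ) {z : ℂ} (h : z ∈ velRect) :
    extendVel f z = f ⟨z, h⟩ := by
  classical
  exact dif_pos h

/-- Bounded holomorphic functions on the strip of velocities. -/
noncomputable def boundedHolo : Subalgebra ℂ (BoundedContinuousFunction velRect ℂ) where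
  carrier := {f | DifferentiableOn ℂ (extendVel f) velRect}
  mul_mem' := fun {f g} hf hg => (DifferentiableOn.mul hf hg).congr fun z hz => by
    simp [extendVel_of_mem _ hz]
  add_mem' := fun {f g} hf hg => (DifferentiableOn.add hf hg).congr fun z hz => by
    simp [extendVel_of_mem _ hz]
  algebraMap_mem' := fun r => (differentiableOn_const r).congr fun z hz => by
    simp [extendVel_of_mem _ hz]

theorem isClosed_boundedHolo :
    IsClosed (boundedHolo : Set (BoundedContinuousFunction velRect ℂ)) := by
  refine IsSeqClosed.isClosed fun u f hu hf => ?_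
  have h : TendstoUniformlyOn (fun n => extendVel (u n)) (extendVel f) atTop velRect := by
    rw [Metric.tendstoUniformlyOn_iff]
    intro ε hε
    filter_upwards [(Metric.tendsto_nhds.1 hf) ε hε] with n hn z hz
    rw [extendVel_of_mem _ hz, extendVel_of_mem _ hz]
    rw [dist_comm] at hn
    exact (BoundedContinuousFunction.dist_coe_le_dist _).trans_lt hn
  exact h.tendstoLocallyUniformlyOn.differentiableOn (Eventually.of_forall hu) isOpen_velRect

noncomputable instance : CompleteSpace boundedHolo :=
  isClosed_boundedHolo.completeSpace_coe

/-- Evaluation of a bounded holomorphic function. -/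
noncomputable def evalHolo (z : ℂ) : boundedHolo →L[ℂ] ℂ :=
  open Classical in
  if h : z ∈ velRect then
    (BoundedContinuousFunction.evalCLM ℂ (⟨z, h⟩ : velRect)).comp boundedHolo.toSubmodule.subtypeL
  else 0

theorem evalHolo_apply (z : ℂ) (f : boundedHolo) : evalHolo z f = extendVel f z := by
  classical
  by_cases h : z ∈ velRect
  · rw [extendVel_of_mem _ h, evalHolo, dif_pos h]
    rfl
  · rw [evalHolo, extendVel, dif_neg h, dif_neg h]
    rfl

/-- The coordinate function. -/
noncomputable def coordHolo : boundedHolo :=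
  ⟨BoundedContinuousFunction.ofNormedAddCommGroup (fun z : velRect => (z : ℂ))
      continuous_subtype_val 3 (fun z => by
        refine (Complex.norm_le_abs_re_add_abs_im _).trans ?_
        have h1 := z.2.1
        have h2 := z.2.2
        linarith),
    differentiableOn_id.congr fun z hz => by simp [extendVel_of_mem _ hz]⟩

theorem holomorphicAlgebra_evalHolo : HolomorphicAlgebra evalHolo coordHolo := by
  have hle : ∀ z ∈ velRect, ‖evalHolo z‖ ≤ 1 := fun z hz =>
    ContinuousLinearMap.opNorm_le_bound _ zero_le_one fun f => by
      rw [evalHolo_apply, extendVel_of_mem _ hz, one_mul]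
      exact BoundedContinuousFunction.norm_coe_le_norm _ _
  refine ⟨differentiableOn_of_pointwise isOpen_velRect hle fun f => ?_, hle, ?_, ?_, ?_, ?_⟩
  · simp only [evalHolo_apply]
    exact f.2
  · intro z hz a b
    simp [evalHolo_apply, extendVel_of_mem _ hz]
  · intro z hz
    simp [evalHolo_apply, extendVel_of_mem _ hz]
  · intro z hz
    simp [evalHolo_apply, extendVel_of_mem _ hz, coordHolo]
  · intro f C hC
    have h0 : (0 : ℂ) ∈ velRect := by simp [velRect]
    refine (BoundedContinuousFunction.norm_le ((norm_nonneg _).trans (hC 0 h0))).2 fun z => ?_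
    have := hC z z.2
    rwa [evalHolo_apply, extendVel_of_mem _ z.2] at this

end ConcreteAlgebra

section Shear

/-- A steep hyperbolic tangent profile. -/
noncomputable def steepShear (θ : ℝ) : ℝ := Real.tanh (10 ^ 4 * θ)

theorem steepShear_eq (θ : ℝ) :
    steepShear θ = Real.sinh (10 ^ 4 * θ) / Real.cosh (10 ^ 4 * θ) :=
  Real.tanh_eq_sinh_div_cosh _

theorem steepShear_analyticOnNhd (s : Set ℝ) : AnalyticOnNhd ℝ steepShear s := by
  intro θ _
  rw [funext steepShear_eq]
  have hl : AnalyticAt ℝ (fun θ : ℝ => 10 ^ 4 * θ) θ := by fun_prop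
  refine AnalyticAt.div ?_ ?_ (Real.cosh_pos _).ne'
  · exact (Real.analyticAt_sinh).comp hl
  · exact (Real.analyticAt_cosh).comp hl

theorem contDiff_steepShear : ContDiff ℝ (⊤ : ℕ∞) steepShear :=
  (steepShear_analyticOnNhd univ).contDiff.of_le le_top

theorem hasDerivAt_steepShear (θ : ℝ) :
    HasDerivAt steepShear (10 ^ 4 / Real.cosh (10 ^ 4 * θ) ^ 2) θ := by
  rw [funext steepShear_eq]
  have hl : HasDerivAt (fun θ : ℝ => 10 ^ 4 * θ) (10 ^ 4) θ := by
    simpa using (hasDerivAt_id θ).const_mul (10 ^ 4 : ℝ)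
  have hc := Real.cosh_pos (10 ^ 4 * θ)
  refine (hl.sinh.div hl.cosh hc.ne').congr_deriv ?_
  have := Real.cosh_sq (10 ^ 4 * θ)
  congr 1
  linear_combination (10 ^ 4) * this

theorem abs_steepShear_lt_one (θ : ℝ) : |steepShear θ| < 1 := by
  rw [steepShear_eq, abs_div, abs_of_pos (Real.cosh_pos _), div_lt_one (Real.cosh_pos _)]
  have := Real.cosh_sq (10 ^ 4 * θ)
  refine abs_lt_of_sq_lt_sq (by linarith) (Real.cosh_pos _).le

theorem integral_steepShear : ∫ θ in (-1 : ℝ)..1, steepShear θ = 0 := by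
  have h := intervalIntegral.integral_comp_neg (a := -1) (b := 1) steepShear
  have hodd : ∀ θ, steepShear (-θ) = - steepShear θ := fun θ => by
    rw [steepShear, mul_neg, Real.tanh_neg, steepShear]
  simp only [hodd, intervalIntegral.integral_neg, neg_neg] at h
  linarith

theorem one_sub_steepShear_sq (θ : ℝ) :
    |(steepShear * steepShear - 1) θ| = 1 / 10 ^ 4 * deriv steepShear θ := by
  have h1 := abs_steepShear_lt_one θ
  have h2 : (steepShear * steepShear - 1) θ = steepShear θ ^ 2 - 1 := by
    simp [sq]
  rw [h2, abs_of_nonpos (by nlinarith [sq_abs (steepShear θ), abs_nonneg (steepShear θ)]),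
    (hasDerivAt_steepShear θ).deriv, steepShear_eq]
  have hc := Real.cosh_pos (10 ^ 4 * θ)
  have := Real.cosh_sq (10 ^ 4 * θ)
  field_simp
  linarith

theorem integral_one_sub_steepShear_sq_le :
    ∫ θ in (-1 : ℝ)..1, |(steepShear * steepShear - 1) θ| ≤ 1 / 5000 := by
  simp only [one_sub_steepShear_sq]
  have hd : Continuous (deriv steepShear) := contDiff_steepShear.continuous_deriv (by simp)
  rw [intervalIntegral.integral_const_mul, intervalIntegral.integral_deriv_eq_sub
    (fun θ _ => (hasDerivAt_steepShear θ).differentiableAt) (hd.intervalIntegrable _ _)]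
  have h1 := (abs_lt.1 (abs_steepShear_lt_one 1)).2
  have h2 := (abs_lt.1 (abs_steepShear_lt_one (-1))).1
  linarith

theorem deriv_steepShear_injective {b c : ℝ} (h : deriv steepShear b = deriv steepShear c) :
    b = c ∨ b = -c := by
  rw [(hasDerivAt_steepShear b).deriv, (hasDerivAt_steepShear c).deriv] at h
  have hb := Real.cosh_pos (10 ^ 4 * b)
  have hc := Real.cosh_pos (10 ^ 4 * c)
  have hsq : Real.cosh (10 ^ 4 * b) ^ 2 = Real.cosh (10 ^ 4 * c) ^ 2 := by
    field_simp at h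
    linarith
  have heq := (sq_eq_sq₀ hb.le hc.le).1 hsq
  have habs : |10 ^ 4 * b| = |10 ^ 4 * c| :=
    le_antisymm (Real.cosh_le_cosh.1 heq.le) (Real.cosh_le_cosh.1 heq.ge)
  rcases abs_eq_abs.1 habs with h | h
  · left; linarith
  · right; linarith

theorem exists_ancientFlow_steepShear :
    ∃ Z Q u, AncientFlow steepShear Z Q u (-1) (1 / 4) := by
  obtain ⟨w, f, g, p, hw⟩ := holomorphicAlgebra_evalHolo.exists_wave
    contDiff_steepShear.continuous abs_steepShear_lt_one (a := 1 / 10 ^ 6) (by norm_num) le_rfl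
    le_rfl integral_one_sub_steepShear_sq_le
  exact hw.exists_ancientFlow holomorphicAlgebra_evalHolo contDiff_steepShear
    abs_steepShear_lt_one integral_steepShear (by norm_num) le_rfl
    fun _ _ => deriv_steepShear_injective

end Shear

/-- Ill-posedness of the hydrostatic Euler equations: there is a real-analytic shear flow `U`
such that for all `s ∈ ℕ`, `α ∈ (0,1]`, `k ∈ ℕ`, there are a point `(x₀,z₀) ∈ 𝕋 × (-1,1)`,
constants `C, ε₀ > 0`, and for every `ε ∈ (0,ε₀]` a time `t_ε ∈ (0, C ε |log ε|]` and a smooth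
solution `ω_ε` of the vorticity formulation of hydrostatic Euler on `[0,t_ε] × 𝕋 × [-1,1]`,
with `‖ω_ε - U'‖_{L²([0,t_ε] × Ω_ε)} / ‖ω_ε(0) - U'‖_{H^s}^α → ∞` as `ε → 0`, where
`Ω_ε = B(x₀, ε^k) × B(z₀, ε^k)`. -/
theorem illposedness_hydrostatic_euler :
    ∃ U : ℝ → ℝ, AnalyticOnNhd ℝ U (Set.Icc (-1) 1) ∧
      ∀ (s : ℕ) (α : ℝ), α ∈ Set.Ioc (0:ℝ) 1 → ∀ k : ℕ,
        ∃ (x₀ z₀ C ε₀ : ℝ), z₀ ∈ Set.Ioo (-1:ℝ) 1 ∧ 0 < C ∧ 0 < ε₀ ∧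
          ∃ (t : ℝ → ℝ) (ω : ℝ → ℝ → ℝ → ℝ → ℝ),
            (∀ ε ∈ Set.Ioc (0:ℝ) ε₀,
              0 < t ε ∧ t ε ≤ C * ε * |Real.log ε| ∧ IsHydroSol (t ε) (ω ε)) ∧
            Tendsto
              (fun ε : ℝ =>
                Real.sqrt (∫ p in (Set.Icc (0:ℝ) (t ε)) ×ˢ
                    ((Metric.ball x₀ (ε ^ k)) ×ˢ (Metric.ball z₀ (ε ^ k))),
                  (ω ε p.1 p.2.1 p.2.2 - deriv U p.2.2) ^ 2)
                / (HsNormTZ s (fun x z => ω ε 0 x z - deriv U z)) ^ α)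
              (nhdsWithin 0 (Set.Ioc 0 ε₀)) atTop := by
  obtain ⟨Z, Q, u, h⟩ := exists_ancientFlow_steepShear
  exact ⟨steepShear, steepShear_analyticOnNhd _, fun s α hα k => h.illposed s α hα k⟩
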